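/- arXiv:2303.11924 — 5 statements merged into one kernel-verified Lean document; each statement's English description precedes it below -/
import Mathlib

section
/- There exists a universal constant c' > 0 such that for every N ≥ 1, every homogeneous system with K = N (each ξ_k(t) = t^{d_k}) and every interval I ⊆ (−1,1), E[𝒵²_{N,N}(g, I)] ≤ c'·sup_{r∈I} Σ_{j=1}^N [ (ξ_j'(1)/ξ_j(1))·∏_{k∈{1,…,N}\{j}} (ξ_k'(1)²(1−r²)/(ξ_k(1)² − ξ_k(r)²))^{1/2} ]. -/
open MeasureTheory ProbabilityTheory
open scoped ENNReal

noncomputable section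

/-- Index triples `(k, p, i)` with `k ∈ {1,…,K}`, `2 ≤ p ≤ d k`, `i ∈ {0,…,N}^p`. -/
abbrev GIdx (N K : ℕ) (d : Fin K → ℕ) : Type :=
  (k : Fin K) × (p : {p : Fin (d k + 1) // 2 ≤ (p : ℕ)}) × (Fin (p.1 : ℕ) → Fin (N + 1))

/-- The product of standard Gaussian measures over the index set of triples. -/
abbrev GaussP (N K : ℕ) (d : Fin K → ℕ) : Measure (GIdx N K d → ℝ) :=
  Measure.pi fun _ => gaussianReal 0 1

/-- The random polynomial `f_k(g, x) = ∑_{p=2}^{d k} a_{p,k} ∑_i g_{k,p,i} x_{i₁} ⋯ x_{i_p}`. -/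
def rf (N K : ℕ) (d : Fin K → ℕ) (a : Fin K → ℕ → ℝ) (k : Fin K)
    (g : GIdx N K d → ℝ) (x : Fin (N + 1) → ℝ) : ℝ :=
  ∑ p : {p : Fin (d k + 1) // 2 ≤ (p : ℕ)},
    a k (p.1 : ℕ) * ∑ i : Fin (p.1 : ℕ) → Fin (N + 1), g ⟨k, p, i⟩ * ∏ j, x (i j)

/-- `ξ(t) = ∑_{p=2}^d a_p² t^p`. -/
def xi (d : ℕ) (a : ℕ → ℝ) (t : ℝ) : ℝ := ∑ p ∈ Finset.Icc 2 d, a p ^ 2 * t ^ p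

/-- `ξ'`, the derivative of `ξ`. -/
def xi' (d : ℕ) (a : ℕ → ℝ) : ℝ → ℝ := deriv (xi d a)

/-- `Vol(S^{d-1}) = 2 π^{d/2} / Γ(d/2)`. -/
def sphereVol (d : ℝ) : ℝ := 2 * Real.pi ^ (d / 2) / Real.Gamma (d / 2)

/-- `m_{N,K} = Vol(S^{N-K}) ∏_{k=1}^K √(ξ_k'(1)/ξ_k(1))`. -/
def mNK (N K : ℕ) (d : Fin K → ℕ) (a : Fin K → ℕ → ℝ) : ℝ :=
  sphereVol ((N : ℝ) - K + 1) * ∏ k, Real.sqrt (xi' (d k) (a k) 1 / xi (d k) (a k) 1)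

/-- The zero set of the system on the unit sphere. -/
def zeroSet (N K : ℕ) (d : Fin K → ℕ) (a : Fin K → ℕ → ℝ) (g : GIdx N K d → ℝ) :
    Set (EuclideanSpace ℝ (Fin (N + 1))) :=
  {x | ‖x‖ = 1 ∧ ∀ k, rf N K d a k g (fun i => x i) = 0}

/-- `𝒵_{N,K}(g)`: `(N-K)`-dimensional Hausdorff measure of the zero set. -/
def Znk (N K : ℕ) (d : Fin K → ℕ) (a : Fin K → ℕ → ℝ) (g : GIdx N K d → ℝ) : ℝ≥0∞ :=
  μH[(N : ℝ) - K] (zeroSet N K d a g)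


/-- The product `ℝ^{N+1} × ℝ^{N+1}` with the `L²` (Euclidean) product metric. -/
abbrev PairSpace (N : ℕ) : Type :=
  WithLp 2 (EuclideanSpace ℝ (Fin (N + 1)) × EuclideanSpace ℝ (Fin (N + 1)))

instance (N : ℕ) : MeasurableSpace (PairSpace N) := borel _
instance (N : ℕ) : BorelSpace (PairSpace N) := ⟨rfl⟩

/-- The set of pairs of zeros `(x, y)` on the unit sphere with `⟨x,y⟩ ∈ I`. -/
def zeroPairSet (N K : ℕ) (d : Fin K → ℕ) (a : Fin K → ℕ → ℝ) (g : GIdx N K d → ℝ)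
    (I : Set ℝ) : Set (PairSpace N) :=
  {z | ‖(WithLp.equiv 2 _ z).1‖ = 1 ∧ ‖(WithLp.equiv 2 _ z).2‖ = 1 ∧
       (∑ i, (WithLp.equiv 2 _ z).1 i * (WithLp.equiv 2 _ z).2 i) ∈ I ∧
       ∀ k, rf N K d a k g (fun i => (WithLp.equiv 2 _ z).1 i) = 0 ∧
            rf N K d a k g (fun i => (WithLp.equiv 2 _ z).2 i) = 0}

/-- `𝒵²_{N,K}(g, I)`: the `2(N-K)`-dimensional Hausdorff measure of the set of pairs of
zeros on the sphere whose inner product lies in `I`. -/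
def Znk2 (N K : ℕ) (d : Fin K → ℕ) (a : Fin K → ℕ → ℝ) (g : GIdx N K d → ℝ)
    (I : Set ℝ) : ℝ≥0∞ :=
  μH[2 * ((N : ℝ) - K)] (zeroPairSet N K d a g I)

section
open MeasureTheory Set
open scoped ENNReal

theorem kr_local_inj {E : Type*} [NormedAddCommGroup E] [NormedSpace ℝ E] [FiniteDimensional ℝ E]
    {ψ : E → E} {z : E} (h : ContDiffAt ℝ 1 ψ z) (hd : (fderiv ℝ ψ z).det ≠ 0) :
    ∃ U : Set E, IsOpen U ∧ z ∈ U ∧ InjOn ψ U := by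
  have h1 : HasStrictFDerivAt ψ (fderiv ℝ ψ z) z := h.hasStrictFDerivAt one_ne_zero
  let e := ContinuousLinearMap.toContinuousLinearEquivOfDetNeZero (fderiv ℝ ψ z) hd
  have h2 : HasStrictFDerivAt ψ (e : E →L[ℝ] E) z := by
    have : (e : E →L[ℝ] E) = fderiv ℝ ψ z := by ext; rfl
    rw [this]; exact h1
  refine ⟨(h2.toOpenPartialHomeomorph ψ).source, (h2.toOpenPartialHomeomorph ψ).open_source,
    h2.mem_toOpenPartialHomeomorph_source, ?_⟩
  have := (h2.toOpenPartialHomeomorph ψ).injOn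
  rwa [h2.toOpenPartialHomeomorph_coe] at this

theorem kr_area {E : Type*} [NormedAddCommGroup E] [NormedSpace ℝ E] [FiniteDimensional ℝ E]
    [MeasurableSpace E] [BorelSpace E] (μ : Measure E) [μ.IsAddHaarMeasure]
    {A : Set E} (hA : MeasurableSet A) {ψ : E → E} (hψ : ∀ z ∈ A, ContDiffAt ℝ 1 ψ z)
    {h : E → ℝ≥0∞} (hh : Measurable h) :
    ∫⁻ u, h u * Measure.count {z | z ∈ A ∧ ψ z = u} ∂μ
      ≤ ∫⁻ z in A, ENNReal.ofReal |(fderiv ℝ ψ z).det| * h (ψ z) ∂μ := by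
  have hder : ∀ z ∈ A, HasFDerivAt ψ (fderiv ℝ ψ z) z := fun z hz =>
    ((hψ z hz).differentiableAt one_ne_zero).hasFDerivAt
  have hmd : Measurable fun z => (fderiv ℝ ψ z).det :=
    ContinuousLinearMap.continuous_det.measurable.comp (measurable_fderiv ℝ ψ)
  set C : Set E := A ∩ {z | (fderiv ℝ ψ z).det = 0} with hC
  set A' : Set E := A ∩ {z | (fderiv ℝ ψ z).det ≠ 0} with hA'
  have hA'm : MeasurableSet A' := hA.inter (hmd (measurableSet_singleton 0).compl)
  have hC0 : μ (ψ '' C) = 0 :=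
    addHaar_image_eq_zero_of_det_fderivWithin_eq_zero μ (f' := fderiv ℝ ψ)
      (fun x hx => (hder x hx.1).hasFDerivWithinAt) (fun x hx => hx.2)
  have hloc : ∀ z ∈ A', ∃ U : Set E, IsOpen U ∧ z ∈ U ∧ InjOn ψ U := fun z hz =>
    kr_local_inj (hψ z hz.1) hz.2
  choose! U hUo hUz hUi using hloc
  obtain ⟨t, htA, htc, hcov⟩ := TopologicalSpace.countable_cover_nhdsWithin (f := U) (s := A')
    (fun x hx => mem_nhdsWithin_of_mem_nhds ((hUo x hx).mem_nhds (hUz x hx)))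
  rcases t.eq_empty_or_nonempty with rfl | htn
  · have hA0 : A' = ∅ := by simpa using hcov
    have : ∀ᵐ u ∂μ, h u * Measure.count {z | z ∈ A ∧ ψ z = u} = 0 := by
      filter_upwards [measure_eq_zero_iff_ae_notMem.1 hC0] with u hu
      have : {z | z ∈ A ∧ ψ z = u} = ∅ := by
        ext z
        simp only [mem_ofPred_eq, mem_empty_iff_false, iff_false]
        rintro ⟨hz, rfl⟩
        by_cases hd : (fderiv ℝ ψ z).det = 0
        · exact hu ⟨z, ⟨hz, hd⟩, rfl⟩
        · have : z ∈ A' := ⟨hz, hd⟩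
          simp [hA0] at this
      simp [this]
    rw [lintegral_congr_ae this]; simp
  obtain ⟨s, hs⟩ := htc.exists_eq_range htn
  set B : ℕ → Set E := fun n => A' ∩ disjointed (fun n => U (s n)) n with hB
  have hst : ∀ n, s n ∈ A' := fun n => htA (hs ▸ mem_range_self n)
  have hBm : ∀ n, MeasurableSet (B n) := fun n =>
    hA'm.inter (MeasurableSet.disjointed (fun n => (hUo _ (hst n)).measurableSet) n)
  have hBi : ∀ n, InjOn ψ (B n) := fun n =>
    (hUi _ (hst n)).mono (fun z hz => disjointed_subset _ _ hz.2)
  have hBd : Pairwise (Function.onFun Disjoint B) := fun i j hij =>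
    ((disjoint_disjointed (fun n => U (s n))) hij).mono inter_subset_right inter_subset_right
  have hBU : ⋃ n, B n = A' := by
    rw [hB, ← inter_iUnion, iUnion_disjointed]
    refine inter_eq_left.2 (hcov.trans ?_)
    rw [hs]; simp
  have hBA : ∀ n, B n ⊆ A := fun n z hz => hz.1.1
  have hBim : ∀ n, MeasurableSet (ψ '' B n) := fun n =>
    measurable_image_of_fderivWithin (hBm n)
      (fun x hx => (hder x (hBA n hx)).hasFDerivWithinAt) (hBi n)
  have key : ∀ᵐ u ∂μ, h u * Measure.count {z | z ∈ A ∧ ψ z = u}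
      ≤ ∑' n, (ψ '' B n).indicator h u := by
    filter_upwards [measure_eq_zero_iff_ae_notMem.1 hC0] with u hu
    have hsub : {z | z ∈ A ∧ ψ z = u} ⊆ ⋃ n, {z | z ∈ B n ∧ ψ z = u} := by
      rintro z ⟨hz, rfl⟩
      have hzA : z ∈ A' := by
        refine ⟨hz, fun hd => hu ⟨z, ⟨hz, hd⟩, rfl⟩⟩
      rw [← hBU, mem_iUnion] at hzA
      obtain ⟨n, hn⟩ := hzA
      exact mem_iUnion.2 ⟨n, hn, rfl⟩
    calc h u * Measure.count {z | z ∈ A ∧ ψ z = u}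
        ≤ h u * ∑' n, Measure.count {z | z ∈ B n ∧ ψ z = u} := by
          gcongr
          exact (measure_mono hsub).trans (measure_iUnion_le _)
      _ = ∑' n, h u * Measure.count {z | z ∈ B n ∧ ψ z = u} := ENNReal.tsum_mul_left.symm
      _ ≤ ∑' n, (ψ '' B n).indicator h u := by
          refine ENNReal.tsum_le_tsum fun n => ?_
          by_cases hun : u ∈ ψ '' B n
          · obtain ⟨z, hz, rfl⟩ := hun
            have : {z' | z' ∈ B n ∧ ψ z' = ψ z} = {z} := by
              ext z'
              constructor
              · rintro ⟨h1, h2⟩; exact hBi n h1 hz h2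
              · rintro rfl; exact ⟨hz, rfl⟩
            rw [this, indicator_of_mem (mem_image_of_mem ψ hz)]; simp
          · have : {z' | z' ∈ B n ∧ ψ z' = u} = ∅ := by
              ext z'
              simp only [mem_ofPred_eq, mem_empty_iff_false, iff_false]
              rintro ⟨h1, h2⟩; exact hun ⟨z', h1, h2⟩
            simp [this]
  calc ∫⁻ u, h u * Measure.count {z | z ∈ A ∧ ψ z = u} ∂μ
      ≤ ∫⁻ u, ∑' n, (ψ '' B n).indicator h u ∂μ := lintegral_mono_ae key
    _ = ∑' n, ∫⁻ u in ψ '' B n, h u ∂μ := by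
        rw [lintegral_tsum (fun n => (hh.indicator (hBim n)).aemeasurable)]
        congr 1; ext n
        rw [lintegral_indicator (hBim n)]
    _ = ∑' n, ∫⁻ z in B n, ENNReal.ofReal |(fderiv ℝ ψ z).det| * h (ψ z) ∂μ := by
        congr 1; ext n
        exact lintegral_image_eq_lintegral_abs_det_fderiv_mul μ (hBm n)
          (fun x hx => (hder x (hBA n hx)).hasFDerivWithinAt) (hBi n) h
    _ = ∫⁻ z in A', ENNReal.ofReal |(fderiv ℝ ψ z).det| * h (ψ z) ∂μ := by
        rw [← hBU, lintegral_iUnion hBm hBd]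
    _ ≤ _ := lintegral_mono_set inter_subset_left

/-- Measurability of the number of solutions. -/
theorem kr_count_measurable {X W T : Type*} [TopologicalSpace X] [MeasurableSpace X] [BorelSpace X]
    [TopologicalSpace W] [T2Space W] [SecondCountableTopology W] [MeasurableSpace W]
    [MeasurableSingletonClass W]
    (hbas : ∀ U : Set W, IsOpen U → IsSigmaCompact U)
    [TopologicalSpace T] [T1Space T]
    {A : Set W} (hA : IsSigmaCompact A) {Φ : X → W → T} (hΦ : Continuous (Function.uncurry Φ)) (τ : T) :
    Measurable fun g => (Measure.count {z | z ∈ A ∧ Φ g z = τ} : ℝ≥0∞) := by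
  -- projection along sigma-compact
  have hproj : ∀ K : Set W, IsSigmaCompact K → MeasurableSet {g | ∃ z ∈ K, Φ g z = τ} := by
    rintro K ⟨C, hC, rfl⟩
    have : {g | ∃ z ∈ ⋃ n, C n, Φ g z = τ} = ⋃ n, {g | ∃ z ∈ C n, Φ g z = τ} := by
      ext g; simp only [mem_iUnion, mem_ofPred_eq]; 
      constructor
      · rintro ⟨z, ⟨n, hn⟩, h⟩; exact ⟨n, z, hn, h⟩
      · rintro ⟨n, z, hn, h⟩; exact ⟨z, ⟨n, hn⟩, h⟩
    rw [this]
    refine MeasurableSet.iUnion fun n => IsClosed.measurableSet ?_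
    have := isCompact_iff_compactSpace.1 (hC n)
    have hcl : IsClosed {p : (C n) × X | Φ p.2 p.1 = τ} :=
      isClosed_singleton.preimage (f := fun p : (C n) × X => Φ p.2 p.1)
        (hΦ.comp (continuous_snd.prodMk (continuous_subtype_val.comp continuous_fst)))
    have := isClosedMap_snd_of_compactSpace _ hcl
    convert this using 1
    ext g
    simp only [mem_ofPred_eq, mem_image, Prod.exists, exists_eq_right, Subtype.exists]
    constructor
    · rintro ⟨z, hz, h⟩; exact ⟨z, hz, h⟩
    · rintro ⟨z, hz, h⟩; exact ⟨z, hz, h⟩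
  have hinter : ∀ U : Set W, IsOpen U → IsSigmaCompact (A ∩ U) := by
    intro U hU
    obtain ⟨C, hC, hCA⟩ := hA
    obtain ⟨D, hD, hDU⟩ := hbas U hU
    have : A ∩ U = ⋃ p : ℕ × ℕ, C p.1 ∩ D p.2 := by
      rw [← hCA, ← hDU]
      ext z
      simp only [mem_inter_iff, mem_iUnion, Prod.exists]
      constructor
      · rintro ⟨⟨i, hi⟩, ⟨j, hj⟩⟩; exact ⟨i, j, hi, hj⟩
      · rintro ⟨i, j, hi, hj⟩; exact ⟨⟨i, hi⟩, ⟨j, hj⟩⟩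
    rw [this]
    exact isSigmaCompact_iUnion _ fun p => ((hC p.1).inter (hD p.2)).isSigmaCompact
  let Ix := {F : (n : ℕ) × (Fin n → TopologicalSpace.countableBasis W) //
    Pairwise fun i j => Disjoint (F.2 i : Set W) (F.2 j : Set W)}
  have hIxc : Countable Ix := by
    have := (TopologicalSpace.countable_countableBasis W).to_subtype
    infer_instance
  have hbo : ∀ B : TopologicalSpace.countableBasis W, IsOpen (B : Set W) := fun B =>
    (TopologicalSpace.isBasis_countableBasis W).isOpen B.2
  let G : X → ℝ≥0∞ := fun g => ⨆ F : Ix, ∑ i : Fin F.1.1,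
    {g | ∃ z ∈ A ∩ (F.1.2 i : Set W), Φ g z = τ}.indicator (fun _ => (1 : ℝ≥0∞)) g
  have hG : Measurable G := by
    refine Measurable.iSup fun F => Finset.measurable_sum _ fun i _ => ?_
    exact measurable_const.indicator (hproj _ (hinter _ (hbo _)))
  have hfin : ∀ g, ∀ T : Finset W, (↑T : Set W) ⊆ {z | z ∈ A ∧ Φ g z = τ} → (T.card : ℝ≥0∞) ≤ G g := by
    intro g T hT
    obtain ⟨U, hU, hUd⟩ := T.finite_toSet.t2_separation
    have hex : ∀ x : W, ∃ B ∈ TopologicalSpace.countableBasis W, x ∈ B ∧ B ⊆ U x := fun x =>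
      (TopologicalSpace.isBasis_countableBasis W).exists_subset_of_mem_open (hU x).1 (hU x).2
    choose B hBb hxB hBU using hex
    let e := T.equivFin
    let F : Ix := ⟨⟨T.card, fun i => ⟨B (e.symm i), hBb _⟩⟩, fun i j hij => by
      refine Disjoint.mono (hBU _) (hBU _) (hUd (e.symm i).2 (e.symm j).2 ?_)
      intro h
      exact hij (e.symm.injective (Subtype.ext h))⟩
    refine le_trans ?_ (le_iSup _ F)
    have : ∀ i : Fin F.1.1, {g | ∃ z ∈ A ∩ (F.1.2 i : Set W), Φ g z = τ}.indicator
        (fun _ => (1 : ℝ≥0∞)) g = 1 := by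
      intro i
      have h1 := hT (e.symm i).2
      exact indicator_of_mem (s := {g | ∃ z ∈ A ∩ (F.1.2 i : Set W), Φ g z = τ})
        ⟨(e.symm i : W), ⟨h1.1, hxB _⟩, h1.2⟩ _
    rw [Finset.sum_congr rfl fun i _ => this i]
    simp [F]
  have : (fun g => (Measure.count {z | z ∈ A ∧ Φ g z = τ} : ℝ≥0∞)) = G := by
    ext g
    apply le_antisymm
    · by_cases hf : {z | z ∈ A ∧ Φ g z = τ}.Finite
      · rw [Measure.count_apply_finite _ hf]
        exact hfin g _ (by simp)
      · have : G g = ⊤ := by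
          refine ENNReal.eq_top_of_forall_nnreal_le fun r => ?_
          obtain ⟨n, hn⟩ := exists_nat_ge r
          obtain ⟨T, hT, hc⟩ := Set.Infinite.exists_subset_card_eq hf n
          have := hfin g T hT
          rw [hc] at this
          exact le_trans (by exact_mod_cast hn) this
        rw [this]; exact le_top
    · refine iSup_le fun F => ?_
      by_cases hf : {z | z ∈ A ∧ Φ g z = τ}.Finite
      swap
      · rw [Measure.count_apply_infinite hf]; exact le_top
      classical
      have hle : ∑ i : Fin F.1.1, {g | ∃ z ∈ A ∩ (F.1.2 i : Set W), Φ g z = τ}.indicator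
          (fun _ => (1 : ℝ≥0∞)) g ≤
          ∑ i : Fin F.1.1, Measure.count ({z | z ∈ A ∧ Φ g z = τ} ∩ (F.1.2 i : Set W)) := by
        refine Finset.sum_le_sum fun i _ => ?_
        refine indicator_le (s := {g | ∃ z ∈ A ∩ (F.1.2 i : Set W), Φ g z = τ}) (f := fun _ => (1 : ℝ≥0∞)) (g := fun g => Measure.count ({z | z ∈ A ∧ Φ g z = τ} ∩ (F.1.2 i : Set W))) ?_ g
        rintro g ⟨z, hz, hz'⟩
        calc (1 : ℝ≥0∞) = Measure.count {z} := by simp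
          _ ≤ _ := measure_mono (by
            rintro _ rfl
            exact ⟨⟨hz.1, hz'⟩, hz.2⟩)
      refine hle.trans ?_
      rw [← measure_biUnion_finset]
      · refine measure_mono ?_
        intro z hz
        simp only [mem_iUnion] at hz
        obtain ⟨i, _, hi⟩ := hz
        exact hi.1
      · intro i _ j _ hij
        exact (F.2 hij).mono inter_subset_right inter_subset_right
      · intro i _
        exact (hf.subset inter_subset_left).measurableSet
  rw [this]; exact hG

end

section
open MeasureTheory Set
open scoped ENNReal RealInnerProductSpace Matrix

theorem kr_decomp {V : Type*} [NormedAddCommGroup V] [InnerProductSpace ℝ V]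
    [FiniteDimensional ℝ V] [MeasurableSpace V] [BorelSpace V] (S : Submodule ℝ V)
    {F : V → ℝ≥0∞} (hF : Measurable F) :
    ∫⁻ w, F w = ∫⁻ s : S, ∫⁻ κ : Sᗮ, F ((s : V) + (κ : V)) := by
  have h1 : MeasurePreserving S.orthogonalDecomposition.symm :=
    S.orthogonalDecomposition.symm.measurePreserving
  have h2 : MeasurePreserving (@WithLp.toLp 2 (S × Sᗮ)) := WithLp.volume_preserving_toLp _ _
  have h3 := h1.comp h2
  rw [← h3.lintegral_comp hF]
  have hm : Measurable fun p : S × Sᗮ => F ((p.1 : V) + (p.2 : V)) := by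
    refine hF.comp ?_
    exact (measurable_subtype_coe.comp measurable_fst).add (measurable_subtype_coe.comp measurable_snd)
  rw [← lintegral_prod _ hm.aemeasurable]
  congr 1

/-- Gaussian density -/
noncomputable def gd {V : Type*} [NormedAddCommGroup V] [InnerProductSpace ℝ V] (w : V) : ℝ≥0∞ :=
  ENNReal.ofReal ((2 * Real.pi) ^ (-(Module.finrank ℝ V : ℝ) / 2) * Real.exp (-‖w‖ ^ 2 / 2))

theorem gd_measurable {V : Type*} [NormedAddCommGroup V] [InnerProductSpace ℝ V]
    [MeasurableSpace V] [BorelSpace V] : Measurable (gd : V → ℝ≥0∞) := by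
  have : Continuous fun w : V => ((2 * Real.pi) ^ (-(Module.finrank ℝ V : ℝ) / 2) * Real.exp (-‖w‖ ^ 2 / 2)) := by
    fun_prop
  exact this.measurable.ennreal_ofReal

theorem kr_gauss_int {V : Type*} [NormedAddCommGroup V] [InnerProductSpace ℝ V]
    [FiniteDimensional ℝ V] [MeasurableSpace V] [BorelSpace V] :
    ∫⁻ w : V, ENNReal.ofReal (Real.exp (-‖w‖ ^ 2 / 2)) =
      ENNReal.ofReal ((2 * Real.pi) ^ ((Module.finrank ℝ V : ℝ) / 2)) := by
  have h := GaussianFourier.integral_rexp_neg_mul_sq_norm (V := V) (b := 1/2) (by norm_num)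
  have h' : ∀ w : V, Real.exp (-‖w‖ ^ 2 / 2) = Real.exp (-(1/2) * ‖w‖^2) := by
    intro w; congr 1; ring
  simp_rw [h']
  rw [← ofReal_integral_eq_lintegral_ofReal, h]
  · congr 2; ring
  · by_contra hc
    rw [integral_undef hc] at h
    have : 0 < (Real.pi / (1/2)) ^ ((Module.finrank ℝ V : ℝ) / 2) := by positivity
    linarith
  · exact Filter.Eventually.of_forall fun w => (Real.exp_pos _).le

theorem kr_key {V : Type*} [NormedAddCommGroup V] [InnerProductSpace ℝ V]
    [FiniteDimensional ℝ V] [MeasurableSpace V] [BorelSpace V]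
    {J : Type*} [Fintype J] [DecidableEq J] (X v Ev : J → V) (hv : Orthonormal ℝ v)
    (T Λ : Matrix J J ℝ) (hT : T.det ≠ 0) (hX : ∀ j, X j = ∑ i, T j i • v i)
    (hΛ : ∀ i j, Λ i j = ⟪X i, Ev j⟫) (hΛd : Λ.det ≠ 0)
    (u : V → J → ℝ) (hu : ∀ w, Λ *ᵥ (u w) = fun j => - ⟪X j, w⟫)
    (θ : (J → ℝ) → ℝ≥0∞) (hθ : Measurable θ) (H : V → ℝ≥0∞) (hH : Measurable H) :
    ∫⁻ w, θ (u w) * (gd (w + ∑ j, u w j • Ev j) * H (w + ∑ j, u w j • Ev j)) =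
      ENNReal.ofReal (|Λ.det| / |T.det| * (2 * Real.pi) ^ (-(Fintype.card J : ℝ) / 2)) * (∫⁻ c, θ c) *
        ∫⁻ w, gd w * H (w - ∑ j, ⟪v j, w⟫ • v j) := by
  have hTu : IsUnit T.det := isUnit_iff_ne_zero.2 hT
  have hΛu : IsUnit Λ.det := isUnit_iff_ne_zero.2 hΛd
  have hu' : ∀ w, u w = Λ⁻¹ *ᵥ (fun j => - ⟪X j, w⟫) := by
    intro w
    rw [← hu w, Matrix.mulVec_mulVec, Matrix.nonsing_inv_mul _ hΛu, Matrix.one_mulVec]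
  have huc : Continuous u := by
    have : u = fun w => Λ⁻¹ *ᵥ (fun j => - ⟪X j, w⟫) := funext hu'
    rw [this]
    fun_prop
  set S : Submodule ℝ V := Submodule.span ℝ (Set.range v) with hS
  have hvS : ∀ j, v j ∈ S := fun j => Submodule.subset_span (mem_range_self j)
  have hXS : ∀ j, X j ∈ S := fun j => by
    rw [hX]; exact Submodule.sum_mem _ fun i _ => Submodule.smul_mem _ _ (hvS i)
  -- elements orthogonal to all X are in Sᗮ
  have hperp : ∀ p : V, (∀ j, ⟪X j, p⟫ = 0) → p ∈ Sᗮ := by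
    intro p hp
    have h1 : T *ᵥ (fun i => ⟪v i, p⟫) = 0 := by
      ext j
      have := hp j
      rw [hX, sum_inner] at this
      simp only [real_inner_smul_left] at this
      simpa [Matrix.mulVec, dotProduct] using this
    have h2 : (fun i => ⟪v i, p⟫) = 0 := by
      have := congrArg (fun x => T⁻¹ *ᵥ x) h1
      simpa [Matrix.mulVec_mulVec, Matrix.nonsing_inv_mul _ hTu] using this
    rw [Submodule.mem_orthogonal]
    intro s hs
    induction hs using Submodule.span_induction with
    | mem x hx => obtain ⟨j, rfl⟩ := hx; exact congrFun h2 j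
    | zero => simp
    | add x y _ _ hx hy => rw [inner_add_left, hx, hy, add_zero]
    | smul a x _ hx => rw [real_inner_smul_left, hx, mul_zero]
  have hE0 : ∀ w j, ⟪X j, w + ∑ i, u w i • Ev i⟫ = 0 := by
    intro w j
    have := congrFun (hu w) j
    simp only [Matrix.mulVec, dotProduct, hΛ] at this
    rw [inner_add_right, inner_sum]
    simp only [real_inner_smul_right]
    have h3 : ∑ x, u w x * ⟪X j, Ev x⟫ = ∑ x, ⟪X j, Ev x⟫ * u w x :=
      Finset.sum_congr rfl fun _ _ => mul_comm _ _
    rw [h3, this]; ring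
  have husk : ∀ (s : S) (κ : Sᗮ), u ((s : V) + κ) = u s := by
    intro s κ
    rw [hu', hu']
    congr 1; ext j
    rw [inner_add_right, (Submodule.mem_orthogonal _ _).1 κ.2 _ (hXS j), add_zero]
  let β : S → Sᗮ := fun s => ⟨(s : V) + ∑ j, u s j • Ev j, hperp _ (hE0 s)⟩
  set Q : ℝ≥0∞ := ∫⁻ κ : Sᗮ, gd (κ : V) * H (κ : V) with hQ
  have hGHm : Measurable fun κ : Sᗮ => gd (κ : V) * H (κ : V) :=
    (gd_measurable.comp measurable_subtype_coe).mul (hH.comp measurable_subtype_coe)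
  have hmL : Measurable fun w => θ (u w) * (gd (w + ∑ j, u w j • Ev j) * H (w + ∑ j, u w j • Ev j)) := by
    have h1 : Measurable fun w => w + ∑ j, u w j • Ev j := by
      have : Continuous fun w => w + ∑ j, u w j • Ev j := by fun_prop
      exact this.measurable
    exact (hθ.comp huc.measurable).mul ((gd_measurable.comp h1).mul (hH.comp h1))
  have hLHS : ∫⁻ w, θ (u w) * (gd (w + ∑ j, u w j • Ev j) * H (w + ∑ j, u w j • Ev j)) =
      (∫⁻ s : S, θ (u s)) * Q := by
    rw [kr_decomp S hmL, ← lintegral_mul_const]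
    · congr 1; ext s
      have : ∀ κ : Sᗮ, θ (u ((s : V) + κ)) * (gd ((s : V) + κ + ∑ j, u ((s : V) + κ) j • Ev j) *
          H ((s : V) + κ + ∑ j, u ((s : V) + κ) j • Ev j)) =
          θ (u s) * (gd ((κ + β s : Sᗮ) : V) * H ((κ + β s : Sᗮ) : V)) := by
        intro κ
        have e1 : (s : V) + κ + ∑ j, u ((s : V) + κ) j • Ev j = ((κ + β s : Sᗮ) : V) := by
          rw [husk]
          simp only [β, Submodule.coe_add]
          abel
        rw [e1, husk]
      simp_rw [this]
      rw [lintegral_const_mul]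
      · rw [lintegral_add_right_eq_self (fun κ : Sᗮ => gd (κ : V) * H (κ : V)) (β s)]
      · exact hGHm.comp (measurable_add_const _)
    · exact hθ.comp (huc.measurable.comp measurable_subtype_coe)
  -- orthonormal basis of S
  have hvSo : Orthonormal ℝ (fun j => (⟨v j, hvS j⟩ : S)) := by
    constructor
    · intro j; exact hv.1 j
    · intro i j hij; exact hv.2 hij
  let b : OrthonormalBasis J ℝ S := OrthonormalBasis.mk hvSo (by
    intro s _
    have : Submodule.map S.subtype (Submodule.span ℝ (Set.range (fun j => (⟨v j, hvS j⟩ : S)))) = S := by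
      rw [Submodule.map_span, ← Set.range_comp]; rfl
    have h0 : (s : V) ∈ Submodule.map S.subtype (Submodule.span ℝ (Set.range (fun j => (⟨v j, hvS j⟩ : S)))) :=
      this.symm ▸ s.2
    obtain ⟨t, ht, hts⟩ := h0
    have : t = s := Subtype.ext hts
    rwa [← this])
  have hSint : ∀ φ : S → ℝ≥0∞, Measurable φ → ∫⁻ s, φ s = ∫⁻ c : J → ℝ, φ (∑ j, c j • b j) := by
    intro φ hφ
    have h3 := (b.measurePreserving_repr_symm).comp (PiLp.volume_preserving_toLp J)
    rw [← h3.lintegral_comp hφ]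
    congr 1; ext c
    simp [← OrthonormalBasis.sum_repr_symm]
  have hbv : ∀ j, ((b j : S) : V) = v j := fun j => by simp [b]
  have hS1 : ∫⁻ s : S, θ (u s) = ENNReal.ofReal (|Λ.det| / |T.det|) * ∫⁻ c, θ c := by
    rw [hSint (fun s => θ (u s)) (hθ.comp (huc.measurable.comp measurable_subtype_coe))]
    set M : Matrix J J ℝ := -(Λ⁻¹ * T) with hM
    have huM : ∀ c : J → ℝ, u ((∑ j, c j • b j : S) : V) = M *ᵥ c := by
      intro c
      rw [hu', hM, Matrix.neg_mulVec, ← Matrix.mulVec_mulVec, ← Matrix.mulVec_neg]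
      congr 1; ext j
      simp only [Submodule.coe_sum, Submodule.coe_smul, hbv, Pi.neg_apply, Matrix.mulVec, dotProduct]
      congr 1
      rw [inner_sum]
      refine Finset.sum_congr rfl fun i _ => ?_
      rw [real_inner_smul_right, hX, sum_inner]
      simp only [real_inner_smul_left, orthonormal_iff_ite.1 hv]
      simp [mul_comm]
    simp_rw [huM]
    have hMd : M.det ≠ 0 := by
      rw [hM, Matrix.det_neg, Matrix.det_mul, Matrix.det_nonsing_inv]
      simp [hT, hΛd]
    have hMa : |M.det⁻¹| = |Λ.det| / |T.det| := by
      rw [hM, Matrix.det_neg, Matrix.det_mul, Matrix.det_nonsing_inv]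
      simp [abs_mul, div_eq_mul_inv, mul_comm]
    have := Real.map_matrix_volume_pi_eq_smul_volume_pi hMd
    have hmm : Measurable (Matrix.toLin' M) := (LinearMap.continuous_of_finiteDimensional _).measurable
    rw [← hMa, ← smul_eq_mul, ← lintegral_smul_measure, ← this, lintegral_map hθ hmm]
    rfl
  have hRHS : ∫⁻ w, gd w * H (w - ∑ j, ⟪v j, w⟫ • v j) =
      ENNReal.ofReal ((2 * Real.pi) ^ ((Fintype.card J : ℝ) / 2)) * Q := by
    have hm2 : Measurable fun w => gd w * H (w - ∑ j, ⟪v j, w⟫ • v j) := by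
      have : Continuous fun w => (w - ∑ j, ⟪v j, w⟫ • v j) := by fun_prop
      exact gd_measurable.mul (hH.comp this.measurable)
    rw [kr_decomp S hm2]
    have : ∀ (s : S) (κ : Sᗮ), gd ((s : V) + κ) * H ((s : V) + κ - ∑ j, ⟪v j, (s : V) + κ⟫ • v j)
        = ENNReal.ofReal (Real.exp (-‖s‖ ^ 2 / 2)) * (gd (κ : V) * H (κ : V)) := by
      intro s κ
      have e1 : ∑ j, ⟪v j, (s : V) + κ⟫ • v j = s := by
        have h := b.sum_repr s
        have h4 := congrArg (Subtype.val) h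
        simp only [Submodule.coe_sum, Submodule.coe_smul, hbv, b.repr_apply_apply] at h4
        refine Eq.trans (Finset.sum_congr rfl fun j _ => ?_) h4
        congr 1
        rw [inner_add_right, (Submodule.mem_orthogonal _ _).1 κ.2 _ (hvS j), add_zero, ← hbv j]
        rfl
      have e2 : ‖(s : V) + κ‖ ^ 2 = ‖s‖ ^ 2 + ‖(κ : V)‖ ^ 2 := by
        have := norm_add_sq_eq_norm_sq_add_norm_sq_of_inner_eq_zero (s : V) (κ : V)
          ((Submodule.mem_orthogonal _ _).1 κ.2 _ s.2)
        rw [pow_two, pow_two, pow_two, this]; rfl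
      rw [e1, add_sub_cancel_left, ← mul_assoc]
      congr 1
      unfold gd
      rw [← ENNReal.ofReal_mul (Real.exp_pos _).le]
      congr 1
      rw [e2, neg_add, add_div, Real.exp_add]; ring
    simp_rw [this]
    have h5 : ∀ s : S, ∫⁻ κ : Sᗮ, ENNReal.ofReal (Real.exp (-‖s‖ ^ 2 / 2)) * (gd (κ : V) * H (κ : V))
        = ENNReal.ofReal (Real.exp (-‖s‖ ^ 2 / 2)) * Q := fun s => lintegral_const_mul _ hGHm
    simp_rw [h5]
    rw [lintegral_mul_const, kr_gauss_int, Module.finrank_eq_card_basis b.toBasis]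
    exact (Continuous.measurable (by fun_prop)).ennreal_ofReal
  rw [hLHS, hS1, hRHS]
  have h6 : ENNReal.ofReal ((2 * Real.pi) ^ (-(Fintype.card J : ℝ) / 2)) *
      ENNReal.ofReal ((2 * Real.pi) ^ ((Fintype.card J : ℝ) / 2)) = 1 := by
    rw [← ENNReal.ofReal_mul (by positivity), ← Real.rpow_add (by positivity)]
    rw [show -(Fintype.card J : ℝ) / 2 + (Fintype.card J : ℝ) / 2 = 0 by ring]
    simp
  rw [ENNReal.ofReal_mul (by positivity)]
  calc _ = ENNReal.ofReal (|Λ.det| / |T.det|) * (∫⁻ c, θ c) * Q * 1 := by ring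
    _ = _ := by rw [← h6]; ring

end

section
open MeasureTheory Set ProbabilityTheory
open scoped ENNReal RealInnerProductSpace Matrix

theorem kr_stdGaussian {V : Type*} [NormedAddCommGroup V] [InnerProductSpace ℝ V]
    [FiniteDimensional ℝ V] [MeasurableSpace V] [BorelSpace V] :
    stdGaussian V = (volume : Measure V).withDensity gd := by
  have hfin : ∫⁻ w : V, gd w = 1 := by
    unfold gd
    simp_rw [ENNReal.ofReal_mul (show (0:ℝ) ≤ (2 * Real.pi) ^ (-(Module.finrank ℝ V : ℝ) / 2) by positivity)]
    rw [lintegral_const_mul, kr_gauss_int, ← ENNReal.ofReal_mul (by positivity), ← Real.rpow_add (by positivity)]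
    · simp [← add_div]
    · exact (Continuous.measurable (by fun_prop)).ennreal_ofReal
  have : IsProbabilityMeasure ((volume : Measure V).withDensity gd) :=
    ⟨by rw [withDensity_apply _ MeasurableSet.univ, Measure.restrict_univ, hfin]⟩
  apply Measure.ext_of_charFun (E := V)
  ext t
  rw [charFun_stdGaussian, charFun_apply]
  have hg : (gd : V → ℝ≥0∞) = fun w => ((Real.toNNReal ((2 * Real.pi) ^ (-(Module.finrank ℝ V : ℝ) / 2) * Real.exp (-‖w‖ ^ 2 / 2)) : NNReal) : ℝ≥0∞) := rfl
  rw [hg, integral_withDensity_eq_integral_smul]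
  · have h1 := GaussianFourier.integral_cexp_neg_mul_sq_norm_add (V := V) (b := 1/2) (by norm_num) Complex.I t
    have h2 : ∀ w : V, (Real.toNNReal ((2 * Real.pi) ^ (-(Module.finrank ℝ V : ℝ) / 2) * Real.exp (-‖w‖ ^ 2 / 2))) • Complex.exp (⟪w, t⟫ * Complex.I)
       = (((2 * Real.pi) ^ (-(Module.finrank ℝ V : ℝ) / 2) : ℝ) : ℂ) * Complex.exp (-(1/2) * ‖w‖ ^ 2 + Complex.I * ⟪t, w⟫) := by
      intro w
      rw [NNReal.smul_def, Real.coe_toNNReal _ (by positivity), Complex.exp_add, real_inner_comm, Complex.real_smul, Complex.ofReal_mul, mul_assoc]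
      congr 2
      · rw [Complex.ofReal_exp]; congr 1; push_cast; ring
      · rw [mul_comm]
    simp_rw [h2]
    rw [integral_const_mul, h1, ← mul_assoc]
    have h3 : (((2 * Real.pi) ^ (-(Module.finrank ℝ V : ℝ) / 2) : ℝ) : ℂ) * (Real.pi / (1/2)) ^ (Module.finrank ℝ V / 2 : ℂ) = 1 := by
      have h4 : (Real.pi / (1/2) : ℂ) = ((2 * Real.pi : ℝ) : ℂ) := by push_cast; ring
      have h5 : (Module.finrank ℝ V / 2 : ℂ) = (((Module.finrank ℝ V : ℝ) / 2 : ℝ) : ℂ) := by push_cast; ring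
      rw [h4, h5, ← Complex.ofReal_cpow (by positivity), ← Complex.ofReal_mul, ← Real.rpow_add (by positivity)]
      simp [← add_div]
    rw [h3, one_mul]
    congr 1
    rw [Complex.I_sq]; ring
  · exact (Continuous.measurable (by fun_prop)).real_toNNReal

theorem kr_det_sq {V : Type*} [NormedAddCommGroup V] [InnerProductSpace ℝ V]
    [FiniteDimensional ℝ V] [MeasurableSpace V] [BorelSpace V] {n : ℕ}
    (q : Fin n → Fin n → V) (s : Fin n → Fin n → ℝ)
    (hq1 : ∀ k i l j, k ≠ l → ⟪q k i, q l j⟫ = 0)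
    (hq2 : ∀ k i j, i ≠ j → ⟪q k i, q k j⟫ = 0) (hq3 : ∀ k i, ⟪q k i, q k i⟫ = s k i) :
    ∫⁻ w, gd w * ENNReal.ofReal ((Matrix.of fun i k => ⟪q k i, w⟫).det ^ 2) =
      ENNReal.ofReal (∑ σ : Equiv.Perm (Fin n), ∏ k, s k (σ k)) := by
  set μ := stdGaussian V with hμ
  have hdet : Measurable fun w : V => (Matrix.of fun i k => ⟪q k i, w⟫).det ^ 2 := by
    apply Continuous.measurable
    refine Continuous.pow ?_ 2
    apply Continuous.matrix_det
    refine continuous_matrix fun i j => ?_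
    simp only [Matrix.of_apply]; fun_prop
  have e1 : ∫⁻ w, gd w * ENNReal.ofReal ((Matrix.of fun i k => ⟪q k i, w⟫).det ^ 2) =
      ∫⁻ w, ENNReal.ofReal ((Matrix.of fun i k => ⟪q k i, w⟫).det ^ 2) ∂μ := by
    rw [hμ, kr_stdGaussian, lintegral_withDensity_eq_lintegral_mul _ gd_measurable hdet.ennreal_ofReal]
    rfl
  rw [e1]
  have hm2 : MemLp (id : V → V) 2 μ := IsGaussian.memLp_two_id
  have hcov : ∀ x y : V, cov[fun u ↦ ⟪x, u⟫, fun u ↦ ⟪y, u⟫; μ] = ⟪x, y⟫ := by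
    intro x y
    rw [← covarianceBilin_apply_eq_cov hm2, covarianceBilin_stdGaussian]; rfl
  have hmom : ∀ x y : V, ∫ u, ⟪x, u⟫ * ⟪y, u⟫ ∂μ = ⟪x, y⟫ := by
    intro x y
    have := covarianceBilin_apply hm2 x y
    simp only [covarianceBilin_stdGaussian, hμ, integral_id_stdGaussian, sub_zero, id] at this
    rw [← this]; rfl
  have hlp : ∀ (x : V) (p : ℝ≥0∞), p ≠ ∞ → MemLp (fun u => ⟪x, u⟫) p μ := by
    intro x p hp
    exact IsGaussian.memLp_dual μ (innerSL ℝ x) p hp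
  have hgl : HasGaussianLaw (fun (w : V) (k : Fin n) (i : Fin n) => ⟪q k i, w⟫) μ := by
    let L : V →L[ℝ] (Fin n → Fin n → ℝ) :=
      ContinuousLinearMap.pi fun k => ContinuousLinearMap.pi fun i => innerSL ℝ (q k i)
    exact (IsGaussian.hasGaussianLaw_id (μ := μ)).map_of_measurable L L.continuous.measurable
  have hind : iIndepFun (fun (k : Fin n) (w : V) (i : Fin n) => ⟪q k i, w⟫) μ := by
    refine HasGaussianLaw.iIndepFun_of_covariance_eval (X := fun k i w => ⟪q k i, w⟫) hgl ?_
    intro i j hij k l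
    rw [hcov, hq1 i k j l hij]
  have hE : ∀ σ τ : Equiv.Perm (Fin n), ∫ w, ∏ k, (⟪q k (σ k), w⟫ * ⟪q k (τ k), w⟫) ∂μ =
      if σ = τ then ∏ k, s k (σ k) else 0 := by
    intro σ τ
    have h := hind.integral_fun_prod_comp (f := fun k y => y (σ k) * y (τ k)) (fun k => by
      apply Continuous.aemeasurable; fun_prop) (fun k => by
      apply Continuous.aestronglyMeasurable; fun_prop)
    rw [h]
    simp only [hmom]
    split_ifs with hst
    · subst hst; simp only [hq3]
    · obtain ⟨k, hk⟩ : ∃ k, σ k ≠ τ k := by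
        by_contra hc; push Not at hc; exact hst (Equiv.ext hc)
      exact Finset.prod_eq_zero (Finset.mem_univ k) (hq2 _ _ _ hk)
  have hI : ∀ σ τ : Equiv.Perm (Fin n), Integrable (fun w => ∏ k, (⟪q k (σ k), w⟫ * ⟪q k (τ k), w⟫)) μ := by
    intro σ τ
    simp_rw [Finset.prod_mul_distrib]
    have hpr : ∀ ρ : Equiv.Perm (Fin n), MemLp (fun w : V => ∏ k, ⟪q k (ρ k), w⟫) 2 μ := by
      intro ρ
      have := MemLp.prod' (s := Finset.univ) (μ := μ) (f := fun k w => ⟪q k (ρ k), w⟫)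
        (p := fun _ => 2 * (n : ℝ≥0∞)) (fun k _ => hlp _ _ (by finiteness))
      refine this.mono_exponent ?_
      rcases Nat.eq_zero_or_pos n with h0 | h0
      · subst h0; simp
      · rw [Finset.sum_const, Finset.card_univ, Fintype.card_fin, nsmul_eq_mul,
          ENNReal.mul_inv (Or.inl (by simp only [ne_eq, Nat.cast_eq_zero]; omega)) (by simp), inv_inv, mul_left_comm,
          ENNReal.inv_mul_cancel (by simp only [ne_eq, Nat.cast_eq_zero]; omega) (by simp), mul_one]
    exact (hpr σ).integrable_mul (hpr τ)
  have hexp : ∀ w : V, (Matrix.of fun i k => ⟪q k i, w⟫).det ^ 2 = ∑ σ : Equiv.Perm (Fin n), ∑ τ : Equiv.Perm (Fin n),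
      (((Equiv.Perm.sign σ : ℤ) : ℝ) * ((Equiv.Perm.sign τ : ℤ) : ℝ)) * ∏ k, (⟪q k (σ k), w⟫ * ⟪q k (τ k), w⟫) := by
    intro w
    rw [pow_two, Matrix.det_apply', Finset.sum_mul_sum]
    refine Finset.sum_congr rfl fun σ _ => Finset.sum_congr rfl fun τ _ => ?_
    simp only [Matrix.of_apply, Finset.prod_mul_distrib]; ring
  rw [← ofReal_integral_eq_lintegral_ofReal]
  · congr 1
    simp_rw [hexp]
    rw [integral_finsetSum]
    · refine Finset.sum_congr rfl fun σ _ => ?_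
      rw [integral_finsetSum]
      · simp_rw [integral_const_mul, hE]
        simp only [mul_ite, mul_zero, Finset.sum_ite_eq, Finset.mem_univ, if_true]
        rw [← Int.cast_mul, ← Units.val_mul]; simp
      · intro τ _; exact (hI σ τ).const_mul _
    · intro σ _; exact integrable_finsetSum _ fun τ _ => (hI σ τ).const_mul _
  · simp_rw [hexp]
    exact integrable_finsetSum _ fun σ _ => integrable_finsetSum _ fun τ _ => (hI σ τ).const_mul _
  · exact Filter.Eventually.of_forall fun w => sq_nonneg _

end

section
open MeasureTheory Set ProbabilityTheory
open scoped ENNReal RealInnerProductSpace Matrix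

abbrev PE (N : ℕ) := EuclideanSpace ℝ (Fin (N + 1))

structure FeatSys {N : ℕ} {V : Type*} [NormedAddCommGroup V] [InnerProductSpace ℝ V]
    (d : Fin N → ℕ) (m : Fin N → PE N → V) : Prop where
  inner_eq : ∀ k l x y, ⟪m k x, m l y⟫ = if k = l then ⟪x, y⟫ ^ (d k) else 0
  smooth : ∀ k, ContDiff ℝ 2 (m k)
  two_le : ∀ k, 2 ≤ d k

namespace FeatSys
variable {N : ℕ} {V : Type*} [NormedAddCommGroup V] [InnerProductSpace ℝ V]
  {d : Fin N → ℕ} {m : Fin N → PE N → V}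

theorem hd (F : FeatSys d m) (k : Fin N) (x : PE N) : HasFDerivAt (m k) (fderiv ℝ (m k) x) x :=
  (((F.smooth k).differentiable (by norm_num)) x).hasFDerivAt

theorem d1 (F : FeatSys d m) (k l : Fin N) (x y h : PE N) :
    ⟪fderiv ℝ (m k) x h, m l y⟫ = if k = l then (d k : ℝ) * ⟪x, y⟫ ^ (d k - 1) * ⟪h, y⟫ else 0 := by
  have h1 : HasFDerivAt (fun x => ⟪m k x, m l y⟫) _ x := (F.hd k x).inner ℝ (hasFDerivAt_const (m l y) x)
  have h2 : HasFDerivAt (fun x : PE N => ⟪x, y⟫) _ x := (hasFDerivAt_id x).inner ℝ (hasFDerivAt_const y x)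
  have h3 := h2.pow (d k)
  by_cases hk : k = l
  · simp only [F.inner_eq, if_pos hk] at h1
    have := congrArg (fun L => L h) (h1.unique h3)
    simp [fderivInnerCLM_apply] at this
    rw [if_pos hk, this]
  · simp only [F.inner_eq, if_neg hk] at h1
    have := congrArg (fun L => L h) (h1.unique (hasFDerivAt_const 0 x))
    simp [fderivInnerCLM_apply] at this
    rw [if_neg hk, this]

theorem d2 (F : FeatSys d m) (k l : Fin N) (x y h h' : PE N) :
    ⟪fderiv ℝ (m k) x h, fderiv ℝ (m l) y h'⟫ = if k = l then
      (d k : ℝ) * (⟪x, y⟫ ^ (d k - 1) * ⟪h, h'⟫ + ((d k - 1 : ℕ) : ℝ) * ⟪x, y⟫ ^ (d k - 1 - 1) * ⟪x, h'⟫ * ⟪h, y⟫)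
      else 0 := by
  have h1 : HasFDerivAt (fun y => ⟪fderiv ℝ (m k) x h, m l y⟫) _ y :=
    (hasFDerivAt_const (fderiv ℝ (m k) x h) y).inner ℝ (F.hd l y)
  have h2 : HasFDerivAt (fun y : PE N => ⟪x, y⟫) _ y := (hasFDerivAt_const x y).inner ℝ (hasFDerivAt_id y)
  have h2' : HasFDerivAt (fun y : PE N => ⟪h, y⟫) _ y := (hasFDerivAt_const h y).inner ℝ (hasFDerivAt_id y)
  have h3 := ((h2.pow (d k - 1)).const_mul (d k : ℝ)).mul h2'
  by_cases hk : k = l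
  · simp only [F.d1, if_pos hk] at h1
    have := congrArg (fun L => L h') (h1.unique h3)
    simp [fderivInnerCLM_apply] at this
    rw [if_pos hk, this]; ring
  · simp only [F.d1, if_neg hk] at h1
    have := congrArg (fun L => L h') (h1.unique (hasFDerivAt_const 0 y))
    simp [fderivInnerCLM_apply] at this
    rw [if_neg hk, this]
end FeatSys

/-- the derivative operator of the system at x -/
noncomputable def Lop {N : ℕ} {V : Type*} [NormedAddCommGroup V] [InnerProductSpace ℝ V]
    (m : Fin N → PE N → V) (x : PE N) (g : V) : PE N →L[ℝ] PE N :=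
  (EuclideanSpace.equiv (Fin (N + 1)) ℝ).symm.toContinuousLinearMap ∘L
    ContinuousLinearMap.pi (Fin.cons ((2 : ℝ) • innerSL ℝ x)
      (fun k => (innerSL ℝ g) ∘L (fderiv ℝ (m k) x)))

theorem Lop_zero {N : ℕ} {V : Type*} [NormedAddCommGroup V] [InnerProductSpace ℝ V]
    (m : Fin N → PE N → V) (x : PE N) (g : V) (h : PE N) : Lop m x g h 0 = 2 * ⟪x, h⟫ := by
  simp [Lop]

theorem Lop_succ {N : ℕ} {V : Type*} [NormedAddCommGroup V] [InnerProductSpace ℝ V]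
    (m : Fin N → PE N → V) (x : PE N) (g : V) (h : PE N) (k : Fin N) :
    Lop m x g h k.succ = ⟪g, fderiv ℝ (m k) x h⟫ := by
  simp [Lop]

theorem Lop_det {N : ℕ} {V : Type*} [NormedAddCommGroup V] [InnerProductSpace ℝ V]
    (m : Fin N → PE N → V) (x : PE N) (g : V) (b : OrthonormalBasis (Fin (N + 1)) ℝ (PE N))
    (hb : x = ‖x‖ • b 0) :
    |(Lop m x g).det| = 2 * ‖x‖ * |(Matrix.of fun i k => ⟪fderiv ℝ (m k) x (b (Fin.succ i)), g⟫).det| := by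
  let e := EuclideanSpace.basisFun (Fin (N + 1)) ℝ
  have h1 : (Lop m x g).det = LinearMap.det (Lop m x g : PE N →ₗ[ℝ] PE N) := rfl
  let B : PE N ≃ₗᵢ[ℝ] PE N := e.equiv b (Equiv.refl _)
  have hB : |LinearMap.det (B.toLinearEquiv : PE N →ₗ[ℝ] PE N)| = 1 := by
    have h := Measure.addHaar_image_linearMap (volume : Measure (PE N)) (B.toLinearEquiv : PE N →ₗ[ℝ] PE N)
      (Metric.ball 0 1)
    have h5 : ((B.toLinearEquiv : PE N →ₗ[ℝ] PE N) : PE N → PE N) '' (Metric.ball 0 1) = Metric.ball 0 1 := by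
      simp
    rw [h5] at h
    have h6 : (volume : Measure (PE N)) (Metric.ball 0 1) ≠ 0 := (Metric.measure_ball_pos _ _ one_pos).ne'
    have h7 : (volume : Measure (PE N)) (Metric.ball 0 1) ≠ ∞ := measure_ball_lt_top.ne
    have h8 := (ENNReal.mul_eq_right h6 h7).1 h.symm
    have h9 := congrArg ENNReal.toReal h8
    rwa [ENNReal.toReal_ofReal (abs_nonneg _), ENNReal.toReal_one] at h9
  have h2 : |LinearMap.det (Lop m x g : PE N →ₗ[ℝ] PE N)| =
      |LinearMap.det ((Lop m x g : PE N →ₗ[ℝ] PE N) ∘ₗ (B.toLinearEquiv : PE N →ₗ[ℝ] PE N))| := by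
    rw [LinearMap.det_comp, abs_mul, hB, mul_one]
  rw [h1, h2, ← LinearMap.det_toMatrix e.toBasis]
  set M := LinearMap.toMatrix e.toBasis e.toBasis ((Lop m x g : PE N →ₗ[ℝ] PE N) ∘ₗ (B.toLinearEquiv : PE N →ₗ[ℝ] PE N)) with hM
  have hMe : ∀ i j, M i j = Lop m x g (b j) i := by
    intro i j
    rw [hM, LinearMap.toMatrix_apply]
    have hBj : B (e j) = b j := by simp only [B]; simp
    simp only [OrthonormalBasis.coe_toBasis, OrthonormalBasis.coe_toBasis_repr_apply, LinearMap.comp_apply]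
    change e.repr (Lop m x g (B (e j))) i = _
    rw [hBj]; rfl
  have hx : ∀ i : Fin N, ⟪x, b i.succ⟫ = 0 := by
    intro i
    rw [hb, real_inner_smul_left, b.orthonormal.2 (Fin.succ_ne_zero i).symm, mul_zero]
  have hx0 : ⟪x, b 0⟫ = ‖x‖ := by
    conv_lhs => rw [hb]
    rw [real_inner_smul_left, real_inner_self_eq_norm_sq, b.orthonormal.1 0]; simp
  rw [Matrix.det_succ_row_zero, Fin.sum_univ_succ, Finset.sum_eq_zero]
  · simp only [hMe, Lop_zero, hx0]
    rw [← Matrix.det_transpose (Matrix.of _)]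
    simp only [Fin.val_zero, pow_zero, one_mul, add_zero, abs_mul, abs_norm, abs_two]
    congr 2
    congr 1
    ext i k
    simp [hMe, Lop_succ, real_inner_comm]
  · intro j _
    rw [hMe, Lop_zero, hx]; ring

end

section
open MeasureTheory Set ProbabilityTheory
open scoped ENNReal RealInnerProductSpace Matrix

theorem kr_basis {n : ℕ} (x y : PE (n + 1)) (hxy : |⟪x, y⟫| < ‖x‖ * ‖y‖) :
    ∃ (b : OrthonormalBasis (Fin (n + 2)) ℝ (PE (n + 1))) (α β : ℝ), x = ‖x‖ • b 0 ∧
      y = α • b 0 + β • b 1 := by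
  have hx : x ≠ 0 := by rintro rfl; simp at hxy
  have hxn : ‖x‖ ≠ 0 := norm_ne_zero_iff.2 hx
  set u0 : PE (n + 1) := ‖x‖⁻¹ • x with hu0
  have hu0n : ‖u0‖ = 1 := by rw [hu0, norm_smul, norm_inv, norm_norm, inv_mul_cancel₀ hxn]
  have hxu : x = ‖x‖ • u0 := by rw [hu0, smul_smul, mul_inv_cancel₀ hxn, one_smul]
  set t : PE (n + 1) := y - ⟪u0, y⟫ • u0 with ht
  have h0t : ⟪u0, t⟫ = 0 := by
    rw [ht, inner_sub_right, real_inner_smul_right, real_inner_self_eq_norm_sq, hu0n]; ring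
  have htn : t ≠ 0 := by
    intro h
    have hy : y = ⟪u0, y⟫ • u0 := by rwa [ht, sub_eq_zero] at h
    have h1 : ‖y‖ = |⟪u0, y⟫| := by
      conv_lhs => rw [hy]
      rw [norm_smul, hu0n, mul_one, Real.norm_eq_abs]
    have h2 : ⟪x, y⟫ = ‖x‖ * ⟪u0, y⟫ := by
      conv_lhs => rw [hxu]
      rw [real_inner_smul_left]
    rw [h2, abs_mul, abs_norm, ← h1] at hxy
    exact lt_irrefl _ hxy
  have htnn : ‖t‖ ≠ 0 := norm_ne_zero_iff.2 htn
  set u1 : PE (n + 1) := ‖t‖⁻¹ • t with hu1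
  have hu1n : ‖u1‖ = 1 := by rw [hu1, norm_smul, norm_inv, norm_norm, inv_mul_cancel₀ htnn]
  have htu : t = ‖t‖ • u1 := by rw [hu1, smul_smul, mul_inv_cancel₀ htnn, one_smul]
  have h01 : ⟪u0, u1⟫ = 0 := by rw [hu1, real_inner_smul_right, h0t, mul_zero]
  let v : Fin (n + 2) → PE (n + 1) := Fin.cons u0 (fun _ => u1)
  have hv : Orthonormal ℝ (({0, 1} : Set (Fin (n + 2))).domRestrict v) := by
    constructor
    · rintro ⟨i, hi⟩
      rcases hi with rfl | hi
      · exact hu0n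
      · rw [Set.mem_singleton_iff] at hi; subst hi; exact hu1n
    · rintro ⟨i, hi⟩ ⟨j, hj⟩ hij
      rcases hi with rfl | hi <;> rcases hj with rfl | hj
      · exact absurd rfl hij
      · rw [Set.mem_singleton_iff] at hj; subst hj; exact h01
      · rw [Set.mem_singleton_iff] at hi; subst hi; exact (real_inner_comm _ _).trans h01
      · rw [Set.mem_singleton_iff] at hi hj; subst hi; subst hj; exact absurd rfl hij
  obtain ⟨b, hb⟩ := hv.exists_orthonormalBasis_extension_of_card_eq (by simp)
  have hb0 : b 0 = u0 := hb 0 (by simp)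
  have hb1 : b 1 = u1 := hb 1 (by simp)
  refine ⟨b, ⟪u0, y⟫, ‖t‖, by rw [hb0]; exact hxu, ?_⟩
  rw [hb0, hb1, ← htu, ht]; abel

theorem kr_perm_sum {n : ℕ} (s : Fin (n + 1) → ℝ) (c : Fin (n + 1) → ℝ) :
    ∑ σ : Equiv.Perm (Fin (n + 1)), ∏ k, (if σ k = 0 then s k else c k) =
      (n.factorial : ℝ) * ∑ j, s j * ∏ k ∈ Finset.univ.erase j, c k := by
  have h1 : ∑ σ : Equiv.Perm (Fin (n + 1)), ∏ k, (if σ k = 0 then s k else c k) =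
      ∑ σ : Equiv.Perm (Fin (n + 1)), s (σ 0) * ∏ k ∈ Finset.univ.erase (σ 0), c k := by
    rw [← Equiv.sum_comp (Equiv.inv (Equiv.Perm (Fin (n + 1))))]
    refine Finset.sum_congr rfl fun σ _ => ?_
    rw [← Finset.mul_prod_erase Finset.univ _ (Finset.mem_univ (σ 0))]
    congr 1
    · simp
    · refine Finset.prod_congr rfl fun k hk => ?_
      have : ¬ (Equiv.inv (Equiv.Perm (Fin (n + 1))) σ) k = 0 := by
        intro h
        have : k = σ 0 := by
          rw [← h]; simp
        exact (Finset.ne_of_mem_erase hk) this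
      rw [if_neg this]
  rw [h1, ← Equiv.sum_comp Equiv.Perm.decomposeFin.symm, Fintype.sum_prod_type]
  simp only [Equiv.Perm.decomposeFin_symm_apply_zero, Finset.sum_const, Finset.card_univ, Fintype.card_perm,
    Fintype.card_fin, nsmul_eq_mul, Finset.mul_sum]

theorem kr_num (e : ℕ) (ρ s r : ℝ) (hρ : 0 < ρ) (hs : 0 < s) (hr : r ^ 2 < 1) :
    ((e + 1 : ℕ) : ℝ) * ρ ^ (2 * e) - (((e + 1 : ℕ) : ℝ) * (r * ρ * s) ^ e) ^ 2 * (s ^ 2 * (1 - r ^ 2)) /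
      (s ^ (2 * (e + 1)) * (1 - r ^ (2 * (e + 1)))) ≤
      ρ ^ (2 * e) * (((e + 1 : ℕ) : ℝ) * Real.sqrt (1 - r ^ (2 * (e + 1)))) := by
  have hr2 : r ^ (2 * (e + 1)) < 1 := by rw [pow_mul]; exact pow_lt_one₀ (sq_nonneg r) hr (by omega)
  have hr0 : 0 ≤ r ^ (2 * (e + 1)) := by rw [pow_mul]; positivity
  have hre : 0 ≤ r ^ (2 * e) := by rw [pow_mul]; positivity
  have hD : 0 < 1 - r ^ (2 * (e + 1)) := by linarith
  have e1 : (((e + 1 : ℕ) : ℝ) * (r * ρ * s) ^ e) ^ 2 * (s ^ 2 * (1 - r ^ 2)) /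
      (s ^ (2 * (e + 1)) * (1 - r ^ (2 * (e + 1)))) =
      ρ ^ (2 * e) * (((e + 1 : ℕ) : ℝ) * (((e + 1 : ℕ) : ℝ) * r ^ (2 * e) * (1 - r ^ 2) / (1 - r ^ (2 * (e + 1))))) := by
    field_simp
    ring
  have e2 : 1 - r ^ (2 * (e + 1)) ≤ ((e + 1 : ℕ) : ℝ) * (1 - r ^ 2) := by
    have := one_add_mul_le_pow (a := r ^ 2 - 1) (by nlinarith [sq_nonneg r]) (e + 1)
    rw [pow_mul]
    have h3 : (1 + (r ^ 2 - 1)) = r ^ 2 := by ring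
    rw [h3] at this
    push_cast at this ⊢
    linarith
  have e3 : r ^ (2 * (e + 1)) ≤ ((e + 1 : ℕ) : ℝ) * r ^ (2 * e) * (1 - r ^ 2) / (1 - r ^ (2 * (e + 1))) := by
    rw [le_div_iff₀ hD]
    calc r ^ (2 * (e + 1)) * (1 - r ^ (2 * (e + 1))) ≤ r ^ (2 * e) * (((e + 1 : ℕ) : ℝ) * (1 - r ^ 2)) := by
          apply mul_le_mul _ e2 hD.le hre
          rw [show r ^ (2 * (e + 1)) = r ^ (2 * e) * r ^ 2 by ring]; nlinarith
      _ = _ := by ring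
  have e4 : 1 - r ^ (2 * (e + 1)) ≤ Real.sqrt (1 - r ^ (2 * (e + 1))) := by
    apply Real.le_sqrt_of_sq_le; nlinarith
  rw [e1]
  have : (0:ℝ) < ((e + 1 : ℕ) : ℝ) := by positivity
  calc _ = ρ ^ (2 * e) * (((e + 1 : ℕ) : ℝ) * (1 - ((e + 1 : ℕ) : ℝ) * r ^ (2 * e) * (1 - r ^ 2) / (1 - r ^ (2 * (e + 1))))) := by ring
    _ ≤ _ := by gcongr; linarith

section Proj
variable {V : Type*} [NormedAddCommGroup V] [InnerProductSpace ℝ V]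
  {J : Type*} [Fintype J]

/-- projection onto the orthogonal complement of an orthonormal family -/
noncomputable def prj (v : J → V) (w : V) : V := w - ∑ j, ⟪v j, w⟫ • v j

theorem prj_inner (v : J → V) (w a : V) : ⟪a, prj v w⟫ = ⟪prj v a, w⟫ := by
  simp only [prj, inner_sub_right, inner_sub_left, inner_sum, sum_inner, real_inner_smul_left,
    real_inner_smul_right]
  congr 1
  refine Finset.sum_congr rfl fun j _ => ?_
  rw [real_inner_comm (v j) a]; ring

theorem prj_prj_inner [DecidableEq J] (v : J → V) (hv : Orthonormal ℝ v) (a b : V) :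
    ⟪prj v a, prj v b⟫ = ⟪a, b⟫ - ∑ j, ⟪v j, a⟫ * ⟪v j, b⟫ := by
  have h : ∀ j, ⟪v j, prj v b⟫ = 0 := by
    intro j
    simp only [prj, inner_sub_right, inner_sum, real_inner_smul_right, orthonormal_iff_ite.1 hv]
    simp
  conv_lhs => rw [prj]
  rw [inner_sub_left, sum_inner]
  simp only [real_inner_smul_left, h, mul_zero, Finset.sum_const_zero, sub_zero]
  simp only [prj, inner_sub_right, inner_sum, real_inner_smul_right]
  congr 1
  refine Finset.sum_congr rfl fun j _ => ?_
  rw [real_inner_comm (v j) a]; ring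

theorem prj_sub_smul (v : J → V) (a u : V) (t : ℝ) (hu : prj v u = 0) : prj v (a - t • u) = prj v a := by
  have : prj v (a - t • u) = prj v a - t • prj v u := by
    simp only [prj, inner_sub_right, real_inner_smul_right, sub_smul, Finset.sum_sub_distrib, smul_sub,
      Finset.smul_sum, mul_smul]
    abel
  rw [this, hu]; simp
end Proj

theorem feat_Edet {n : ℕ} {V : Type*} [NormedAddCommGroup V] [InnerProductSpace ℝ V]
    [FiniteDimensional ℝ V] [MeasurableSpace V] [BorelSpace V]
    {d : Fin (n + 1) → ℕ} {m : Fin (n + 1) → PE (n + 1) → V} (F : FeatSys d m)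
    {J : Type*} [Fintype J] [DecidableEq J] (v : J → V) (hv : Orthonormal ℝ v) (κ : J → Fin (n + 1))
    (x y : PE (n + 1)) (hxy : |⟪x, y⟫| < ‖x‖ * ‖y‖)
    (hvs : ∀ j, v j ∈ Submodule.span ℝ {m (κ j) x, m (κ j) y})
    (hpx : ∀ k, prj v (m k x) = 0) (hpy : ∀ k, prj v (m k y) = 0) :
    ∫⁻ w, gd w * ENNReal.ofReal ((Lop m x (prj v w)).det ^ 2) ≤
      ENNReal.ofReal ((2 * ‖x‖ * ∏ k, ‖x‖ ^ (d k - 1)) ^ 2 * (n.factorial * ∑ j, (d j : ℝ) *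
        Real.sqrt (1 - (⟪x, y⟫ / (‖x‖ * ‖y‖)) ^ (2 * d j)) * ∏ k ∈ Finset.univ.erase j, (d k : ℝ))) := by
  obtain ⟨b, α, β, hbx, hby⟩ := kr_basis x y hxy
  have hx : x ≠ 0 := by rintro rfl; simp at hxy
  have hy : y ≠ 0 := by rintro rfl; simp at hxy
  have hxn : 0 < ‖x‖ := norm_pos_iff.2 hx
  have hyn : 0 < ‖y‖ := norm_pos_iff.2 hy
  have hbo := orthonormal_iff_ite.1 b.orthonormal
  set r := ⟪x, y⟫ / (‖x‖ * ‖y‖) with hr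
  have hpr : ⟪x, y⟫ = r * ‖x‖ * ‖y‖ := by rw [hr]; field_simp
  have hr1 : r ^ 2 < 1 := by
    rw [sq_lt_one_iff_abs_lt_one, hr, abs_div, abs_of_pos (mul_pos hxn hyn), div_lt_one (mul_pos hxn hyn)]
    exact hxy
  have hα : α = r * ‖y‖ := by
    have h1 : ⟪x, y⟫ = ‖x‖ * α := by
      conv_lhs => rw [hbx, hby]
      simp only [real_inner_smul_left, inner_add_right, real_inner_smul_right, hbo]
      simp [mul_comm]
    rw [hpr] at h1
    have : ‖x‖ * α = ‖x‖ * (r * ‖y‖) := by rw [← h1]; ring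
    exact mul_left_cancel₀ hxn.ne' this
  have hβ : β ^ 2 = ‖y‖ ^ 2 * (1 - r ^ 2) := by
    have h1 : ‖y‖ ^ 2 = α ^ 2 + β ^ 2 := by
      rw [← real_inner_self_eq_norm_sq]
      conv_lhs => rw [hby]
      simp only [real_inner_smul_left, inner_add_left, inner_add_right, real_inner_smul_right, hbo]
      simp; ring
    rw [hα] at h1; linarith [h1]
  have hb0x : ∀ i : Fin (n + 1), ⟪b i.succ, x⟫ = 0 := by
    intro i; rw [hbx, real_inner_smul_right, hbo]; simp
  have hxb0 : ∀ i : Fin (n + 1), ⟪x, b i.succ⟫ = 0 := by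
    intro i; rw [real_inner_comm, hb0x]
  have hb1y : ⟪b 1, y⟫ = β := by
    rw [hby]; simp only [inner_add_right, real_inner_smul_right, hbo]; simp
  have hbiy : ∀ i : Fin (n + 1), i ≠ 0 → ⟪b i.succ, y⟫ = 0 := by
    intro i hi
    rw [hby]; simp only [inner_add_right, real_inner_smul_right, hbo]
    have : i.succ ≠ 1 := by
      intro h; exact hi (Fin.succ_injective _ (by simpa using h))
    simp [this]
  set a : Fin (n + 1) → Fin (n + 1) → V := fun k i => fderiv ℝ (m k) x (b i.succ) with ha
  have haa : ∀ k i l j, ⟪a k i, a l j⟫ = if k = l then (if i = j then (d k : ℝ) * ‖x‖ ^ (2 * (d k - 1)) else 0) else 0 := by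
    intro k i l j
    simp only [ha, F.d2, hxb0, hb0x, hbo]
    rw [real_inner_self_eq_norm_sq]
    by_cases h1 : k = l
    · by_cases h2 : i = j
      · simp [h1, h2, pow_mul]
      · simp [h1, h2]
    · simp [h1]
  have hamx : ∀ k i l, ⟪a k i, m l x⟫ = 0 := by
    intro k i l
    simp only [ha, F.d1, hb0x]; simp
  have hamy : ∀ k i l, i ≠ 0 → ⟪a k i, m l y⟫ = 0 := by
    intro k i l hi
    simp only [ha, F.d1, hbiy i hi]; simp
  have hamy1 : ∀ k l, k ≠ l → ∀ i, ⟪a k i, m l y⟫ = 0 := by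
    intro k l hk i
    simp only [ha, F.d1, if_neg hk]
  have hvz : ∀ (j : J) (p : V), ⟪p, m (κ j) x⟫ = 0 → ⟪p, m (κ j) y⟫ = 0 → ⟪v j, p⟫ = 0 := by
    intro j p h1 h2
    obtain ⟨c1, c2, hc⟩ := Submodule.mem_span_pair.1 (hvs j)
    rw [← hc, inner_add_left, real_inner_smul_left, real_inner_smul_left, real_inner_comm, h1,
      real_inner_comm, h2]; ring
  have hva1 : ∀ j k i, i ≠ 0 → ⟪v j, a k i⟫ = 0 := fun j k i hi => hvz j _ (hamx _ _ _) (hamy _ _ _ hi)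
  have hva2 : ∀ j k i, k ≠ κ j → ⟪v j, a k i⟫ = 0 := fun j k i hk => hvz j _ (hamx _ _ _) (hamy1 _ _ hk _)
  set q : Fin (n + 1) → Fin (n + 1) → V := fun k i => prj v (a k i) with hq
  set s : Fin (n + 1) → Fin (n + 1) → ℝ := fun k i => ⟪q k i, q k i⟫ with hs
  have hE := kr_det_sq q s (by
      intro k i l j hkl
      simp only [hq]
      rw [prj_prj_inner v hv, haa, if_neg hkl, Finset.sum_eq_zero, sub_zero]
      intro j' _
      by_cases h : k = κ j'
      · rw [hva2 j' l j (fun h' => hkl (h.trans h'.symm)), mul_zero]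
      · rw [hva2 j' k i h, zero_mul]) (by
      intro k i j hij
      simp only [hq]
      rw [prj_prj_inner v hv, haa, if_pos rfl, if_neg hij, Finset.sum_eq_zero, sub_zero]
      intro j' _
      by_cases h : i = 0
      · rw [hva1 j' k j (fun h' => hij (h.trans h'.symm)), mul_zero]
      · rw [hva1 j' k i h, zero_mul]) (fun k i => rfl)
  have hdet : ∀ w, (Lop m x (prj v w)).det ^ 2 = (2 * ‖x‖) ^ 2 * (Matrix.of fun i k => ⟪q k i, w⟫).det ^ 2 := by
    intro w
    rw [← sq_abs, Lop_det m x _ b hbx, mul_pow, sq_abs]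
    simp only [hq, ← prj_inner]; rfl
  have hdet' : ∀ w, gd w * ENNReal.ofReal ((Lop m x (prj v w)).det ^ 2) = ENNReal.ofReal ((2 * ‖x‖) ^ 2) *
      (gd w * ENNReal.ofReal ((Matrix.of fun i k => ⟪q k i, w⟫).det ^ 2)) := by
    intro w
    rw [hdet, ENNReal.ofReal_mul (sq_nonneg (2 * ‖x‖)), mul_left_comm]
  simp_rw [hdet']
  rw [lintegral_const_mul', hE, ← ENNReal.ofReal_mul (sq_nonneg _)]
  swap
  · exact ENNReal.ofReal_ne_top
  apply ENNReal.ofReal_le_ofReal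
  have hsi : ∀ k i, i ≠ 0 → s k i = (d k : ℝ) * ‖x‖ ^ (2 * (d k - 1)) := by
    intro k i hi
    simp only [hs, hq]
    rw [prj_prj_inner v hv, haa, if_pos rfl, if_pos rfl, Finset.sum_eq_zero, sub_zero]
    intro j' _
    rw [hva1 j' k i hi, zero_mul]
  have hs0 : ∀ k, s k 0 ≤ ‖x‖ ^ (2 * (d k - 1)) * ((d k : ℝ) * Real.sqrt (1 - r ^ (2 * d k))) := by
    intro k
    obtain ⟨e, he⟩ : ∃ e, d k = e + 1 := ⟨d k - 1, by have := F.two_le k; omega⟩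
    set c : ℝ := ⟪x, y⟫ ^ (d k) / ‖x‖ ^ (2 * d k) with hc
    set u : V := m k y - c • m k x with hu
    have hpu : prj v u = 0 := by rw [hu, prj_sub_smul v _ _ _ (hpx k), hpy k]
    have hau : ⟪a k 0, u⟫ = ((e + 1 : ℕ) : ℝ) * (r * ‖x‖ * ‖y‖) ^ e * β := by
      rw [hu, inner_sub_right, real_inner_smul_right, hamx, mul_zero, sub_zero]
      simp only [ha, F.d1, if_true, he, Nat.add_sub_cancel]
      rw [hpr, show (0 : Fin (n+1)).succ = 1 from rfl, hb1y]
    have huu : ⟪u, u⟫ = ‖y‖ ^ (2 * (e + 1)) * (1 - r ^ (2 * (e + 1))) := by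
      rw [hu]
      simp only [inner_sub_left, inner_sub_right, real_inner_smul_left, real_inner_smul_right, F.inner_eq,
        if_true]
      rw [real_inner_comm x y, real_inner_self_eq_norm_sq, real_inner_self_eq_norm_sq, hc, hpr, he]
      field_simp
      ring
    have hr2 : r ^ (2 * (e + 1)) < 1 := by rw [pow_mul]; exact pow_lt_one₀ (sq_nonneg r) hr1 (by omega)
    have huu0 : 0 < ⟪u, u⟫ := by rw [huu]; apply mul_pos (by positivity); linarith
    set t : ℝ := ⟪a k 0, u⟫ / ⟪u, u⟫ with ht
    have h1 : s k 0 ≤ ⟪a k 0 - t • u, a k 0 - t • u⟫ := by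
      simp only [hs, hq]
      rw [← prj_sub_smul v (a k 0) u t hpu, prj_prj_inner v hv]
      have : 0 ≤ ∑ j, ⟪v j, a k 0 - t • u⟫ * ⟪v j, a k 0 - t • u⟫ :=
        Finset.sum_nonneg fun j _ => mul_self_nonneg _
      linarith
    refine h1.trans ?_
    have h2 : ⟪a k 0 - t • u, a k 0 - t • u⟫ = ⟪a k 0, a k 0⟫ - ⟪a k 0, u⟫ ^ 2 / ⟪u, u⟫ := by
      simp only [inner_sub_left, inner_sub_right, real_inner_smul_left, real_inner_smul_right]
      rw [real_inner_comm (a k 0) u, ht]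
      field_simp
      ring
    rw [h2, haa, if_pos rfl, if_pos rfl, hau, huu, mul_pow _ β, hβ, he, Nat.add_sub_cancel]
    exact kr_num e ‖x‖ ‖y‖ r hxn hyn hr1
  have hs00 : ∀ k i, 0 ≤ s k i := fun k i => real_inner_self_nonneg
  set X : Fin (n + 1) → ℝ := fun k => ‖x‖ ^ (2 * (d k - 1)) with hX
  have hX0 : ∀ k, 0 ≤ X k := fun k => by positivity
  calc (2 * ‖x‖) ^ 2 * ∑ σ : Equiv.Perm (Fin (n + 1)), ∏ k, s k (σ k)
      ≤ (2 * ‖x‖) ^ 2 * ∑ σ : Equiv.Perm (Fin (n + 1)), ∏ k,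
        (X k * if σ k = 0 then ((d k : ℝ) * Real.sqrt (1 - r ^ (2 * d k))) else (d k : ℝ)) := by
        apply mul_le_mul_of_nonneg_left _ (sq_nonneg _)
        apply Finset.sum_le_sum
        intro σ _
        apply Finset.prod_le_prod
        · intro k _; exact hs00 _ _
        · intro k _
          split_ifs with h
          · rw [h]; exact hs0 k
          · rw [hsi k _ h, mul_comm]
    _ = _ := by
        simp_rw [Finset.prod_mul_distrib]
        rw [← Finset.mul_sum, kr_perm_sum, mul_pow _ (∏ k, ‖x‖ ^ (d k - 1)), ← Finset.prod_pow]
        simp only [hX, ← pow_mul, mul_comm 2, mul_assoc]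

end

section
open MeasureTheory Set ProbabilityTheory
open scoped ENNReal RealInnerProductSpace Matrix

theorem Lop_det_cont {N : ℕ} {V : Type*} [NormedAddCommGroup V] [InnerProductSpace ℝ V]
    {d : Fin N → ℕ} {m : Fin N → PE N → V} (F : FeatSys d m) :
    Continuous fun p : PE N × V => (Lop m p.1 p.2).det := by
  let e := EuclideanSpace.basisFun (Fin (N + 1)) ℝ
  have h : ∀ p : PE N × V, (Lop m p.1 p.2).det = (Matrix.of fun i j => Lop m p.1 p.2 (e j) i).det := by
    intro p
    change LinearMap.det (Lop m p.1 p.2 : PE N →ₗ[ℝ] PE N) = _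
    rw [← LinearMap.det_toMatrix e.toBasis]
    congr 1
    ext i j
    rw [LinearMap.toMatrix_apply]
    simp [e]
  simp_rw [h]
  apply Continuous.matrix_det
  refine continuous_matrix fun i j => ?_
  simp only [Matrix.of_apply]
  refine Fin.cases ?_ (fun k => ?_) i
  · simp only [Lop_zero]; fun_prop
  · simp only [Lop_succ]
    have hc : Continuous fun x => fderiv ℝ (m k) x := (F.smooth k).continuous_fderiv (by norm_num)
    have hc2 : Continuous fun p : PE N × V => fderiv ℝ (m k) p.1 (e j) :=
      (hc.comp continuous_fst).clm_apply continuous_const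
    exact continuous_snd.inner hc2

theorem kr_onb {N : ℕ} {V : Type*} [NormedAddCommGroup V] [InnerProductSpace ℝ V]
    {d : Fin N → ℕ} {m : Fin N → PE N → V} (F : FeatSys d m)
    (x y : PE N) (hxy : |⟪x, y⟫| < ‖x‖ * ‖y‖) :
    ∃ (v : Fin N ⊕ Fin N → V) (T : Matrix (Fin N ⊕ Fin N) (Fin N ⊕ Fin N) ℝ), Orthonormal ℝ v ∧
      (∀ j, Sum.elim (fun k => m k x) (fun k => m k y) j = ∑ i, T j i • v i) ∧
      T.det = ∏ k, Real.sqrt ((‖x‖ * ‖y‖) ^ (2 * d k) - ⟪x, y⟫ ^ (2 * d k)) ∧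
      (∀ j, v j ∈ Submodule.span ℝ {m (Sum.elim id id j) x, m (Sum.elim id id j) y}) ∧
      (∀ k, prj v (m k x) = 0) ∧ (∀ k, prj v (m k y) = 0) := by
  have hx : x ≠ 0 := by rintro rfl; simp at hxy
  have hxn : 0 < ‖x‖ := norm_pos_iff.2 hx
  have hG : ∀ k, 0 < (‖x‖ * ‖y‖) ^ (2 * d k) - ⟪x, y⟫ ^ (2 * d k) := by
    intro k
    rw [sub_pos, ← (even_two_mul (d k)).pow_abs]
    exact pow_lt_pow_left₀ hxy (abs_nonneg _) (by have := F.two_le k; omega)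
  set α : Fin N → ℝ := fun k => ‖x‖ ^ d k with hα
  set γ : Fin N → ℝ := fun k => ⟪x, y⟫ ^ d k / ‖x‖ ^ d k with hγ
  set δ : Fin N → ℝ := fun k => Real.sqrt ((‖x‖ * ‖y‖) ^ (2 * d k) - ⟪x, y⟫ ^ (2 * d k)) / ‖x‖ ^ d k with hδ
  have hα0 : ∀ k, α k ≠ 0 := fun k => by positivity
  have hδ0 : ∀ k, δ k ≠ 0 := fun k => by
    have := Real.sqrt_pos.2 (hG k)
    positivity
  have hδ2 : ∀ k, δ k ^ 2 = ((‖x‖ * ‖y‖) ^ (2 * d k) - ⟪x, y⟫ ^ (2 * d k)) / ‖x‖ ^ (2 * d k) := by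
    intro k
    simp only [hδ]
    rw [div_pow, Real.sq_sqrt (hG k).le, ← pow_mul, mul_comm (d k) 2]
  let v0 : Fin N → V := fun k => (α k)⁻¹ • m k x
  let v1 : Fin N → V := fun k => (δ k)⁻¹ • (m k y - γ k • v0 k)
  have h00 : ∀ k l, ⟪v0 k, v0 l⟫ = if k = l then 1 else 0 := by
    intro k l
    simp only [v0, real_inner_smul_left, real_inner_smul_right, F.inner_eq]
    split_ifs with h
    · subst h
      rw [real_inner_self_eq_norm_sq, ← pow_mul, mul_comm 2, pow_mul, pow_two]
      have := hα0 k
      field_simp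
      rfl
    · ring
  have h0y : ∀ k l, ⟪v0 k, m l y⟫ = if k = l then γ k else 0 := by
    intro k l
    simp only [v0, real_inner_smul_left, F.inner_eq]
    split_ifs with h
    · simp only [hγ, hα]; field_simp
    · ring
  have h01 : ∀ k l, ⟪v0 k, v1 l⟫ = 0 := by
    intro k l
    simp only [v1, inner_sub_right, real_inner_smul_right, h00, h0y]
    split_ifs with h
    · subst h; ring
    · ring
  have h11 : ∀ k l, ⟪v1 k, v1 l⟫ = if k = l then 1 else 0 := by
    intro k l
    have : ⟪v1 k, v1 l⟫ = (δ k)⁻¹ * ⟪m k y, v1 l⟫ := by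
      conv_lhs => rw [show v1 k = (δ k)⁻¹ • (m k y - γ k • v0 k) from rfl]
      rw [real_inner_smul_left, inner_sub_left, real_inner_smul_left, h01]; ring
    rw [this]
    simp only [v1, inner_sub_right, real_inner_smul_right, F.inner_eq]
    rw [real_inner_comm (v0 l) (m k y), h0y]
    by_cases h : k = l
    · subst h
      simp only [if_true]
      have h2 : ⟪y, y⟫ ^ d k - γ k * γ k = δ k ^ 2 := by
        rw [hδ2, real_inner_self_eq_norm_sq]
        simp only [hγ]
        field_simp
        ring
      rw [h2]
      have := hδ0 k
      field_simp
    · simp [h, Ne.symm h]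
  let v : Fin N ⊕ Fin N → V := Sum.elim v0 v1
  have hv : Orthonormal ℝ v := by
    rw [orthonormal_iff_ite]
    rintro (k | k) (l | l)
    · simp [v, h00]
    · simp [v, h01]
    · simp [v, real_inner_comm, h01]
    · simp [v, h11]
  have hX0 : ∀ k, m k x = α k • v0 k := fun k => by
    simp only [v0]; rw [smul_smul, mul_inv_cancel₀ (hα0 k), one_smul]
  have hX1 : ∀ k, m k y = γ k • v0 k + δ k • v1 k := fun k => by
    have h : δ k • v1 k = m k y - γ k • v0 k := smul_inv_smul₀ (hδ0 k) _
    rw [h]; abel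
  have hpv : ∀ j, prj v (v j) = 0 := by
    intro j
    simp only [prj, orthonormal_iff_ite.1 hv]
    simp
  have hpadd : ∀ a b : V, prj v (a + b) = prj v a + prj v b := by
    intro a b
    simp only [prj, inner_add_right, add_smul, Finset.sum_add_distrib]; abel
  have hpsm : ∀ (c : ℝ) (a : V), prj v (c • a) = c • prj v a := by
    intro c a
    simp only [prj, real_inner_smul_right, mul_smul, smul_sub, Finset.smul_sum]
  refine ⟨v, Matrix.fromBlocks (Matrix.diagonal α) 0 (Matrix.diagonal γ) (Matrix.diagonal δ), hv, ?_, ?_, ?_, ?_, ?_⟩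
  · rintro (k | k)
    · simp only [Sum.elim_inl, Fintype.sum_sum_type, Matrix.fromBlocks_apply₁₁, Matrix.fromBlocks_apply₁₂, v,
        Sum.elim_inr, Matrix.zero_apply, zero_smul, Finset.sum_const_zero, add_zero, Matrix.diagonal_apply,
        ite_smul, Finset.sum_ite_eq, Finset.mem_univ, if_true]
      exact hX0 k
    · simp only [Sum.elim_inl, Fintype.sum_sum_type, Matrix.fromBlocks_apply₂₁, Matrix.fromBlocks_apply₂₂, v,
        Sum.elim_inr, zero_smul, Matrix.diagonal_apply,
        ite_smul, Finset.sum_ite_eq, Finset.mem_univ, if_true]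
      exact hX1 k
  · rw [Matrix.det_fromBlocks_zero₁₂, Matrix.det_diagonal, Matrix.det_diagonal, ← Finset.prod_mul_distrib]
    refine Finset.prod_congr rfl fun k _ => ?_
    simp only [hα, hδ]; field_simp
  · have hm0 : ∀ k, v0 k ∈ Submodule.span ℝ {m k x, m k y} := fun k =>
      Submodule.smul_mem _ _ (Submodule.subset_span (by simp))
    rintro (k | k)
    · exact hm0 k
    · exact Submodule.smul_mem _ _ (Submodule.sub_mem _ (Submodule.subset_span (by simp))
        (Submodule.smul_mem _ _ (hm0 k)))
  · intro k; rw [hX0, hpsm, show v0 k = v (Sum.inl k) from rfl, hpv, smul_zero]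
  · intro k
    rw [hX1, hpadd, hpsm (γ k) (v0 k), hpsm (δ k) (v1 k), show prj v (v0 k) = 0 from hpv (Sum.inl k),
      show prj v (v1 k) = 0 from hpv (Sum.inr k)]
    simp

/-- the sum of degree products -/
noncomputable def S0 {n : ℕ} (d : Fin (n + 1) → ℕ) (r : ℝ) : ℝ :=
  ∑ j, (d j : ℝ) * Real.sqrt (1 - r ^ (2 * d j)) * ∏ k ∈ Finset.univ.erase j, (d k : ℝ)

theorem S0_nonneg {n : ℕ} (d : Fin (n + 1) → ℕ) (r : ℝ) : 0 ≤ S0 d r := by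
  unfold S0; positivity

theorem feat_E2 {n : ℕ} {V : Type*} [NormedAddCommGroup V] [InnerProductSpace ℝ V]
    [FiniteDimensional ℝ V] [MeasurableSpace V] [BorelSpace V]
    {d : Fin (n + 1) → ℕ} {m : Fin (n + 1) → PE (n + 1) → V} (F : FeatSys d m)
    {J : Type*} [Fintype J] [DecidableEq J] (v : J → V) (hv : Orthonormal ℝ v) (κ : J → Fin (n + 1))
    (x y : PE (n + 1)) (hxy : |⟪x, y⟫| < ‖x‖ * ‖y‖)
    (hvs : ∀ j, v j ∈ Submodule.span ℝ {m (κ j) x, m (κ j) y})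
    (hpx : ∀ k, prj v (m k x) = 0) (hpy : ∀ k, prj v (m k y) = 0) :
    ∫⁻ w, gd w * ENNReal.ofReal (|(Lop m x (prj v w)).det| * |(Lop m y (prj v w)).det|) ≤
      ENNReal.ofReal (4 * (n.factorial * ((‖x‖ * ‖y‖ * ∏ k, (‖x‖ * ‖y‖) ^ (d k - 1)) *
        S0 d (⟪x, y⟫ / (‖x‖ * ‖y‖))))) := by
  have hx : x ≠ 0 := by rintro rfl; simp at hxy
  have hy : y ≠ 0 := by rintro rfl; simp at hxy
  have hxn : 0 < ‖x‖ := norm_pos_iff.2 hx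
  have hyn : 0 < ‖y‖ := norm_pos_iff.2 hy
  set A := 2 * ‖x‖ * ∏ k, ‖x‖ ^ (d k - 1) with hA
  set B := 2 * ‖y‖ * ∏ k, ‖y‖ ^ (d k - 1) with hB
  have hA0 : 0 < A := by positivity
  have hB0 : 0 < B := by positivity
  have h1 := feat_Edet F v hv κ x y hxy hvs hpx hpy
  have h2 := feat_Edet F v hv κ y x (by rwa [real_inner_comm, mul_comm]) (by
    intro j; rw [Set.pair_comm]; exact hvs j) hpy hpx
  rw [real_inner_comm x y, mul_comm ‖y‖ ‖x‖] at h2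
  set r := ⟪x, y⟫ / (‖x‖ * ‖y‖) with hr
  change _ ≤ ENNReal.ofReal (A ^ 2 * (n.factorial * S0 d r)) at h1
  change _ ≤ ENNReal.ofReal (B ^ 2 * (n.factorial * S0 d r)) at h2
  have hS := S0_nonneg d r
  have hpc : Continuous (prj v) := by unfold prj; fun_prop
  have hmx : ∀ p : PE (n + 1), Measurable fun w => gd w * ENNReal.ofReal ((Lop m p (prj v w)).det ^ 2) := by
    intro p
    have : Continuous fun w => (Lop m p (prj v w)).det ^ 2 :=
      ((Lop_det_cont F).comp (continuous_const.prodMk hpc)).pow 2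
    exact gd_measurable.mul this.measurable.ennreal_ofReal
  calc _ ≤ ∫⁻ w, (ENNReal.ofReal (B / (2 * A)) * (gd w * ENNReal.ofReal ((Lop m x (prj v w)).det ^ 2)) +
      ENNReal.ofReal (A / (2 * B)) * (gd w * ENNReal.ofReal ((Lop m y (prj v w)).det ^ 2))) := by
        apply lintegral_mono
        intro w
        simp only
        rw [mul_left_comm, mul_left_comm (ENNReal.ofReal (A / (2 * B))), ← mul_add]
        apply mul_le_mul_right
        rw [← ENNReal.ofReal_mul (by positivity), ← ENNReal.ofReal_mul (by positivity),
          ← ENNReal.ofReal_add (by positivity) (by positivity)]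
        apply ENNReal.ofReal_le_ofReal
        rw [← sq_abs, ← sq_abs (Lop m y (prj v w)).det]
        generalize |(Lop m x (prj v w)).det| = a
        generalize |(Lop m y (prj v w)).det| = b
        have : B / (2 * A) * a ^ 2 + A / (2 * B) * b ^ 2 - a * b = (B * a - A * b) ^ 2 / (2 * A * B) := by
          field_simp; ring
        have h3 : 0 ≤ (B * a - A * b) ^ 2 / (2 * A * B) := by positivity
        linarith
    _ = ENNReal.ofReal (B / (2 * A)) * (∫⁻ w, gd w * ENNReal.ofReal ((Lop m x (prj v w)).det ^ 2)) +
      ENNReal.ofReal (A / (2 * B)) * (∫⁻ w, gd w * ENNReal.ofReal ((Lop m y (prj v w)).det ^ 2)) := by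
        rw [lintegral_add_left ((hmx x).const_mul _), lintegral_const_mul _ (hmx x), lintegral_const_mul _ (hmx y)]
    _ ≤ ENNReal.ofReal (B / (2 * A)) * ENNReal.ofReal (A ^ 2 * (n.factorial * S0 d r)) +
      ENNReal.ofReal (A / (2 * B)) * ENNReal.ofReal (B ^ 2 * (n.factorial * S0 d r)) := by gcongr
    _ = ENNReal.ofReal (A * B * (n.factorial * S0 d r)) := by
        rw [← ENNReal.ofReal_mul (by positivity), ← ENNReal.ofReal_mul (by positivity),
          ← ENNReal.ofReal_add (by positivity) (by positivity)]
        congr 1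
        field_simp; ring
    _ = _ := by
        congr 1
        simp only [hA, hB, mul_pow, Finset.prod_mul_distrib]; ring

end

section
open MeasureTheory Set ProbabilityTheory
open scoped ENNReal RealInnerProductSpace Matrix

section defs
variable {N : ℕ} {V : Type*} [NormedAddCommGroup V] [InnerProductSpace ℝ V]

/-- the 2N feature vectors of a pair -/
def Xf (m : Fin N → PE N → V) (z : PE N × PE N) : Fin N ⊕ Fin N → V :=
  Sum.elim (fun k => m k z.1) (fun k => m k z.2)

/-- the Gram-type matrix against reference vectors -/
noncomputable def Lam (m : Fin N → PE N → V) (E : Fin N ⊕ Fin N → V) (z : PE N × PE N) :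
    Matrix (Fin N ⊕ Fin N) (Fin N ⊕ Fin N) ℝ :=
  Matrix.of fun i j => ⟪Xf m z i, E j⟫

/-- the solution of the linear system -/
noncomputable def uf (m : Fin N → PE N → V) (E : Fin N ⊕ Fin N → V) (w : V) (z : PE N × PE N) :
    Fin N ⊕ Fin N → ℝ :=
  (Lam m E z).det⁻¹ • Matrix.cramer (Lam m E z) (fun j => -⟪Xf m z j, w⟫)

/-- repacking coordinates -/
noncomputable def pk (N : ℕ) : ((ℝ × ℝ) × (Fin N ⊕ Fin N → ℝ)) ≃ₗ[ℝ] (PE N × PE N) where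
  toFun p := (WithLp.toLp 2 (Fin.cons p.1.1 fun k => p.2 (Sum.inl k)),
    WithLp.toLp 2 (Fin.cons p.1.2 fun k => p.2 (Sum.inr k)))
  invFun t := ((t.1 0, t.2 0), Sum.elim (fun k => t.1 k.succ) (fun k => t.2 k.succ))
  map_add' p q := by
    refine Prod.ext ?_ ?_ <;> ext i <;> refine Fin.cases ?_ (fun k => ?_) i <;> simp
  map_smul' c q := by
    refine Prod.ext ?_ ?_ <;> ext i <;> refine Fin.cases ?_ (fun k => ?_) i <;> simp
  left_inv p := by
    refine Prod.ext ?_ ?_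
    · simp
    · ext j; rcases j with j | j <;> simp
  right_inv t := by
    refine Prod.ext ?_ ?_ <;> ext i <;> refine Fin.cases ?_ (fun k => ?_) i <;> simp

/-- the local chart -/
noncomputable def psi (m : Fin N → PE N → V) (E : Fin N ⊕ Fin N → V) (w : V) (z : PE N × PE N) :
    PE N × PE N := pk N ((‖z.1‖ ^ 2, ‖z.2‖ ^ 2), uf m E w z)

/-- the system -/
noncomputable def Phi (m : Fin N → PE N → V) (g : V) (z : PE N × PE N) :
    PE N × PE N := pk N ((‖z.1‖ ^ 2, ‖z.2‖ ^ 2), fun j => ⟪Xf m z j, g⟫)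

end defs

section lems
variable {N : ℕ} {V : Type*} [NormedAddCommGroup V] [InnerProductSpace ℝ V]
  {d : Fin N → ℕ} {m : Fin N → PE N → V}

theorem kr_contDiff_det {ι E : Type*} [Fintype ι] [DecidableEq ι] [NormedAddCommGroup E] [NormedSpace ℝ E]
    {n : WithTop ℕ∞} {M : E → Matrix ι ι ℝ} (h : ∀ i j, ContDiff ℝ n fun z => M z i j) :
    ContDiff ℝ n fun z => (M z).det := by
  simp only [Matrix.det_apply, Units.smul_def, zsmul_eq_mul]
  exact ContDiff.sum fun σ _ => contDiff_const.mul (contDiff_prod fun i _ => h _ _)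

theorem Xf_contDiff (F : FeatSys d m) (j : Fin N ⊕ Fin N) : ContDiff ℝ 2 fun z => Xf m z j := by
  rcases j with k | k
  · exact (F.smooth k).comp contDiff_fst
  · exact (F.smooth k).comp contDiff_snd

theorem Lam_contDiff (F : FeatSys d m) (E : Fin N ⊕ Fin N → V) (i j) : ContDiff ℝ 2 fun z => Lam m E z i j :=
  (Xf_contDiff F i).inner ℝ contDiff_const

theorem Lam_det_contDiff (F : FeatSys d m) (E : Fin N ⊕ Fin N → V) :
    ContDiff ℝ 2 fun z => (Lam m E z).det := kr_contDiff_det (Lam_contDiff F E)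

theorem cramer_contDiff (F : FeatSys d m) (E : Fin N ⊕ Fin N → V) (j) :
    ContDiff ℝ 2 fun p : V × (PE N × PE N) =>
      Matrix.cramer (Lam m E p.2) (fun j => -⟪Xf m p.2 j, p.1⟫) j := by
  simp only [Matrix.cramer_apply]
  refine kr_contDiff_det fun a b => ?_
  simp only [Matrix.updateCol_apply]
  split_ifs
  · exact (((Xf_contDiff F a).comp contDiff_snd).inner ℝ contDiff_fst).neg
  · exact (Lam_contDiff F E a b).comp contDiff_snd

theorem uf_contDiffAt (F : FeatSys d m) (E : Fin N ⊕ Fin N → V) (w : V) {z : PE N × PE N}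
    (hz : (Lam m E z).det ≠ 0) : ContDiffAt ℝ 2 (uf m E w) z := by
  rw [contDiffAt_pi]
  intro j
  have h1 := ((Lam_det_contDiff F E).contDiffAt (x := z)).inv hz
  have h2 : ContDiffAt ℝ 2 (fun z => Matrix.cramer (Lam m E z) (fun j => -⟪Xf m z j, w⟫) j) z :=
    ContDiff.contDiffAt (ContDiff.comp (g := fun p : V × (PE N × PE N) =>
      Matrix.cramer (Lam m E p.2) (fun j => -⟪Xf m p.2 j, p.1⟫) j) (f := fun z => (w, z))
      (cramer_contDiff F E j) (contDiff_const.prodMk contDiff_id))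
  have h3 : (fun z => uf m E w z j) = fun z => (Lam m E z).det⁻¹ *
      Matrix.cramer (Lam m E z) (fun j => -⟪Xf m z j, w⟫) j := by
    ext z; simp only [uf, Pi.smul_apply, smul_eq_mul]
  rw [h3]
  exact h1.mul h2

theorem uf_measurable [FiniteDimensional ℝ V] [MeasurableSpace V] [BorelSpace V]
    (F : FeatSys d m) (E : Fin N ⊕ Fin N → V) :
    Measurable fun p : V × (PE N × PE N) => uf m E p.1 p.2 := by
  rw [measurable_pi_iff]
  intro j
  have h1 : Measurable fun p : V × (PE N × PE N) => (Lam m E p.2).det⁻¹ :=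
    ((Lam_det_contDiff F E).continuous.comp continuous_snd).measurable.inv
  exact h1.mul (cramer_contDiff F E j).continuous.measurable

theorem uf_spec (E : Fin N ⊕ Fin N → V) (w : V) {z : PE N × PE N}
    (hz : (Lam m E z).det ≠ 0) : Lam m E z *ᵥ uf m E w z = fun j => - ⟪Xf m z j, w⟫ := by
  rw [uf, Matrix.mulVec_smul, Matrix.mulVec_cramer, smul_smul, inv_mul_cancel₀ hz, one_smul]

theorem Lam_mulVec (E : Fin N ⊕ Fin N → V) (z : PE N × PE N) (u : Fin N ⊕ Fin N → ℝ) (i) :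
    (Lam m E z *ᵥ u) i = ⟪Xf m z i, ∑ j, u j • E j⟫ := by
  simp only [Matrix.mulVec, dotProduct, Lam, Matrix.of_apply, inner_sum, real_inner_smul_right]
  exact Finset.sum_congr rfl fun j _ => mul_comm _ _

theorem uf_iff (E : Fin N ⊕ Fin N → V) (w : V) {z : PE N × PE N}
    (hz : (Lam m E z).det ≠ 0) (u : Fin N ⊕ Fin N → ℝ) :
    uf m E w z = u ↔ (fun j => ⟪Xf m z j, w + ∑ j, u j • E j⟫) = 0 := by
  have h : (fun j => ⟪Xf m z j, w + ∑ j, u j • E j⟫) = Lam m E z *ᵥ u - Lam m E z *ᵥ uf m E w z := by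
    ext j
    rw [uf_spec E w hz, Pi.sub_apply, Lam_mulVec, inner_add_right]; ring
  rw [h, sub_eq_zero]
  constructor
  · rintro rfl; rfl
  · intro h
    exact (Matrix.mulVec_injective_iff_isUnit.2 ((Matrix.isUnit_iff_isUnit_det _).2 hz.isUnit) h).symm

theorem psi_iff (E : Fin N ⊕ Fin N → V) (w : V) {z : PE N × PE N}
    (hz : (Lam m E z).det ≠ 0) (t : PE N × PE N) :
    psi m E w z = t ↔ Phi m (w + ∑ j, ((pk N).symm t).2 j • E j) z = pk N (((pk N).symm t).1, 0) := by
  obtain ⟨⟨a, b⟩, rfl⟩ := (pk N).surjective t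
  rw [psi, Phi, (pk N).injective.eq_iff, (pk N).injective.eq_iff, LinearEquiv.symm_apply_apply]
  simp only [Prod.mk_inj, uf_iff E w hz]

theorem Phi_continuous (F : FeatSys d m) : Continuous fun p : V × (PE N × PE N) => Phi m p.1 p.2 := by
  have h : Continuous (pk N) := (pk N).toLinearMap.continuous_of_finiteDimensional
  refine h.comp ?_
  refine Continuous.prodMk (by fun_prop) (continuous_pi fun j => ?_)
  exact ((Xf_contDiff F j).continuous.comp continuous_snd).inner continuous_fst

theorem psi_contDiffAt (F : FeatSys d m) (E : Fin N ⊕ Fin N → V) (w : V) {z : PE N × PE N}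
    (hz : (Lam m E z).det ≠ 0) : ContDiffAt ℝ 1 (psi m E w) z := by
  have h1 := (uf_contDiffAt F E w hz).of_le (m := 1) (by norm_num)
  have h2 : ContDiff ℝ 1 fun z : PE N × PE N => (‖z.1‖ ^ 2, ‖z.2‖ ^ 2) :=
    (contDiff_fst.norm_sq ℝ).prodMk (contDiff_snd.norm_sq ℝ)
  exact ((pk N).toContinuousLinearEquiv.contDiff (n := 1)).contDiffAt.comp z (h2.contDiffAt.prodMk h1)

theorem psi_det (F : FeatSys d m) (E : Fin N ⊕ Fin N → V) (w : V) {z : PE N × PE N}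
    (hz : (Lam m E z).det ≠ 0) :
    |(fderiv ℝ (psi m E w) z).det| = |(Lam m E z).det|⁻¹ *
      (|(Lop m z.1 (w + ∑ j, uf m E w z j • E j)).det| * |(Lop m z.2 (w + ∑ j, uf m E w z j • E j)).det|) := by
  set g := w + ∑ j, uf m E w z j • E j with hg
  have hu := (uf_contDiffAt F E w hz).differentiableAt (by norm_num)
  set Du := fderiv ℝ (uf m E w) z with hDu
  have hud : HasFDerivAt (uf m E w) Du z := hu.hasFDerivAt
  have hX : ∀ j, HasFDerivAt (fun z => Xf m z j) (fderiv ℝ (fun z => Xf m z j) z) z := fun j =>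
    ((Xf_contDiff F j).differentiable (by norm_num) z).hasFDerivAt
  have hη : HasFDerivAt (fun z : PE N × PE N => ((‖z.1‖ ^ 2, ‖z.2‖ ^ 2), uf m E w z)) _ z :=
    ((hasFDerivAt_fst (𝕜 := ℝ) (p := z)).norm_sq.prodMk (hasFDerivAt_snd (𝕜 := ℝ) (p := z)).norm_sq).prodMk hud
  have hψ := ((pk N).toContinuousLinearEquiv.toContinuousLinearMap.hasFDerivAt
    (x := ((‖z.1‖ ^ 2, ‖z.2‖ ^ 2), uf m E w z))).comp z hη
  have hψ' := HasFDerivAt.fderiv (f := psi m E w) hψ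
  -- differentiate the defining relation
  have hrel : ∀ i h, (Lam m E z *ᵥ Du h) i + ⟪fderiv ℝ (fun z => Xf m z i) z h, g⟫ = 0 := by
    intro i h
    have e1 : (fun z' => ⟪Xf m z' i, w + ∑ j, uf m E w z' j • E j⟫) =ᶠ[nhds z] fun _ => (0 : ℝ) := by
      have : ∀ᶠ z' in nhds z, (Lam m E z').det ≠ 0 :=
        (Lam_det_contDiff F E).continuous.continuousAt.eventually_ne hz
      filter_upwards [this] with z' hz'
      exact congrFun ((uf_iff E w hz' _).1 rfl) i
    have e2 : HasFDerivAt (fun z' => w + ∑ j, uf m E w z' j • E j) _ z :=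
      (HasFDerivAt.fun_sum fun j (_ : j ∈ Finset.univ) => ((hasFDerivAt_pi'.1 hud j).smul_const (E j))).const_add w
    have e3 := (hX i).inner ℝ e2
    have e4 := (e1.hasFDerivAt_iff.1 e3).unique (hasFDerivAt_const (0:ℝ) z)
    have e5 := congrArg (fun L => L h) e4
    simp only [ContinuousLinearMap.comp_apply, ContinuousLinearMap.prod_apply, fderivInnerCLM_apply] at e5
    rw [Lam_mulVec]
    simpa [hg] using e5
  let B : (PE N × PE N) →ₗ[ℝ] (PE N × PE N) :=
    (pk N).toLinearMap ∘ₗ (LinearMap.prodMap LinearMap.id (Matrix.toLin' (-Lam m E z))) ∘ₗ (pk N).symm.toLinearMap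
  have hBdet : LinearMap.det B = (-Lam m E z).det := by
    rw [show B = _ from rfl, LinearMap.det_conj, LinearMap.det_prodMap, LinearMap.det_id, one_mul, LinearMap.det_toLin']
  have hcomp : B ∘ₗ (fderiv ℝ (psi m E w) z : (PE N × PE N) →ₗ[ℝ] (PE N × PE N)) =
      LinearMap.prodMap (Lop m z.1 g : PE N →ₗ[ℝ] PE N) (Lop m z.2 g : PE N →ₗ[ℝ] PE N) := by
    refine LinearMap.ext fun h => ?_
    have hr : ∀ i, ((-Lam m E z) *ᵥ Du h) i = ⟪fderiv ℝ (fun z => Xf m z i) z h, g⟫ := by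
      intro i
      rw [Matrix.neg_mulVec, Pi.neg_apply]; linarith [hrel i h]
    have hXl : ∀ k, fderiv ℝ (fun z => Xf m z (Sum.inl k)) z h = fderiv ℝ (m k) z.1 h.1 := by
      intro k
      have := ((F.hd k z.1).comp z (hasFDerivAt_fst (𝕜 := ℝ) (p := z))).unique (hX (Sum.inl k))
      rw [← this]; rfl
    have hXr : ∀ k, fderiv ℝ (fun z => Xf m z (Sum.inr k)) z h = fderiv ℝ (m k) z.2 h.2 := by
      intro k
      have := ((F.hd k z.2).comp z (hasFDerivAt_snd (𝕜 := ℝ) (p := z))).unique (hX (Sum.inr k))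
      rw [← this]; rfl
    rw [hψ']
    have hh : (B ∘ₗ ((((pk N).toContinuousLinearEquiv.toContinuousLinearMap) ∘L
        (((2 • (innerSL ℝ z.1).comp (ContinuousLinearMap.fst ℝ (PE N) (PE N))).prod
          (2 • (innerSL ℝ z.2).comp (ContinuousLinearMap.snd ℝ (PE N) (PE N)))).prod Du) :
          (PE N × PE N) →L[ℝ] (PE N × PE N)) : (PE N × PE N) →ₗ[ℝ] (PE N × PE N))) h =
        pk N ((2 * ⟪z.1, h.1⟫, 2 * ⟪z.2, h.2⟫), (-Lam m E z) *ᵥ Du h) := by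
      simp [B, Matrix.neg_mulVec]
    refine Eq.trans hh ?_
    refine Prod.ext ?_ ?_ <;> ext i <;> refine Fin.cases ?_ (fun k => ?_) i
    · simp [pk, Lop_zero]
    · simp only [pk, LinearEquiv.coe_mk, LinearMap.coe_mk, AddHom.coe_mk, Fin.cons_succ, LinearMap.prodMap_apply,
        ContinuousLinearMap.coe_coe, Lop_succ, hr, hXl]
      exact real_inner_comm _ _
    · simp [pk, Lop_zero]
    · simp only [pk, LinearEquiv.coe_mk, LinearMap.coe_mk, AddHom.coe_mk, Fin.cons_succ, LinearMap.prodMap_apply,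
        ContinuousLinearMap.coe_coe, Lop_succ, hr, hXr]
      exact real_inner_comm _ _
  have hdet := congrArg LinearMap.det hcomp
  rw [LinearMap.det_comp, hBdet, LinearMap.det_prodMap] at hdet
  have h2 := congrArg abs hdet
  rw [abs_mul, abs_mul, Matrix.det_neg, abs_mul, abs_pow, abs_neg, abs_one, one_pow, one_mul] at h2
  rw [eq_inv_mul_iff_mul_eq₀ (abs_ne_zero.2 hz)]
  exact h2
end lems

end

section
open MeasureTheory Set ProbabilityTheory
open scoped ENNReal RealInnerProductSpace Matrix

/-- radial weight -/
noncomputable def th0 (p : ℝ × ℝ) : ℝ≥0∞ :=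
  ({p : ℝ × ℝ | 0 < p.1 ∧ 0 < p.2} : Set (ℝ × ℝ)).indicator
    (fun p => ENNReal.ofReal (Real.exp (-(p.1 + p.2) / 2))) p

/-- cube weight -/
noncomputable def thc (N : ℕ) (c : Fin N ⊕ Fin N → ℝ) : ℝ≥0∞ :=
  (Set.pi Set.univ fun _ => Set.Icc (0:ℝ) 1).indicator (fun _ => 1) c

/-- full weight -/
noncomputable def Th (N : ℕ) (t : PE N × PE N) : ℝ≥0∞ := th0 ((pk N).symm t).1 * thc N ((pk N).symm t).2

theorem Th_eq (N : ℕ) (t : PE N × PE N) : Th N t = th0 ((pk N).symm t).1 * thc N ((pk N).symm t).2 := rfl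

theorem th0_measurable : Measurable th0 := by
  refine Measurable.indicator (by fun_prop) ?_
  exact (measurableSet_lt measurable_const measurable_fst).inter (measurableSet_lt measurable_const measurable_snd)

theorem thc_measurable (N : ℕ) : Measurable (thc N) :=
  measurable_const.indicator (MeasurableSet.univ_pi fun _ => measurableSet_Icc)

theorem thc_int (N : ℕ) : ∫⁻ c, thc N c = 1 := by
  have : (thc N) = (Set.pi Set.univ fun _ => Set.Icc (0:ℝ) 1).indicator (fun _ => 1) := rfl
  rw [this, lintegral_indicator_const (MeasurableSet.univ_pi fun _ => measurableSet_Icc), volume_pi_pi]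
  simp

theorem pk_symm_measurable (N : ℕ) : Measurable (pk N).symm :=
  ((pk N).symm.toLinearMap.continuous_of_finiteDimensional).measurable

theorem Th_measurable (N : ℕ) : Measurable (Th N) :=
  (th0_measurable.comp (measurable_fst.comp (pk_symm_measurable N))).mul
    ((thc_measurable N).comp (measurable_snd.comp (pk_symm_measurable N)))

theorem th0_le (p : ℝ × ℝ) : th0 p ≤ ENNReal.ofReal (Real.exp (-(p.1 + p.2) / 2)) :=
  Set.indicator_le_self _ _ _

/-- the target point -/
noncomputable def tau (N : ℕ) (t : PE N × PE N) : PE N × PE N := pk N (((pk N).symm t).1, 0)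

theorem open_sigmaCompact {X : Type*} [PseudoEMetricSpace X] [SigmaCompactSpace X] {U : Set X} (hU : IsOpen U) :
    IsSigmaCompact U := by
  obtain ⟨F, hF, -, h, -⟩ := hU.exists_iUnion_isClosed
  rw [← h]
  exact isSigmaCompact_iUnion _ fun n => isSigmaCompact_univ.of_isClosed_subset (hF n) (subset_univ _)

/-- raw density -/
noncomputable def dens {n : ℕ} (d : Fin (n + 1) → ℕ) (z : PE (n + 1) × PE (n + 1)) : ℝ :=
  Real.exp (-(‖z.1‖ ^ 2 + ‖z.2‖ ^ 2) / 2) *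
    (1 / |∏ k, Real.sqrt ((‖z.1‖ * ‖z.2‖) ^ (2 * d k) - ⟪z.1, z.2⟫ ^ (2 * d k))| *
      (2 * Real.pi) ^ (-(Fintype.card (Fin (n + 1) ⊕ Fin (n + 1)) : ℝ) / 2)) *
    (4 * (n.factorial * ((‖z.1‖ * ‖z.2‖ * ∏ k, (‖z.1‖ * ‖z.2‖) ^ (d k - 1)) *
        S0 d (⟪z.1, z.2⟫ / (‖z.1‖ * ‖z.2‖)))))

theorem Lop_det_meas {N : ℕ} {V : Type*} [NormedAddCommGroup V] [InnerProductSpace ℝ V]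
    [FiniteDimensional ℝ V] [MeasurableSpace V] [BorelSpace V] {Y : Type*} [MeasurableSpace Y]
    {d : Fin N → ℕ} {m : Fin N → PE N → V} (F : FeatSys d m) {f : Y → PE N} {g : Y → V}
    (hf : Measurable f) (hg : Measurable g) :
    Measurable fun y => |(Lop m (f y) (g y)).det| := by
  have h := (Lop_det_cont F).abs.measurable
  have h2 : Measurable fun y => (f y, g y) := hf.prodMk hg
  have h3 := h.comp h2
  simpa only [Function.comp_def] using h3

theorem kr_inner_bound {n : ℕ} {V : Type*} [NormedAddCommGroup V] [InnerProductSpace ℝ V]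
    [FiniteDimensional ℝ V] [MeasurableSpace V] [BorelSpace V]
    {d : Fin (n + 1) → ℕ} {m : Fin (n + 1) → PE (n + 1) → V} (F : FeatSys d m)
    (E : Fin (n + 1) ⊕ Fin (n + 1) → V) (z : PE (n + 1) × PE (n + 1)) (hz : (Lam m E z).det ≠ 0)
    (hxy : |⟪z.1, z.2⟫| < ‖z.1‖ * ‖z.2‖) :
    ENNReal.ofReal (|(Lam m E z).det|⁻¹) * th0 (‖z.1‖ ^ 2, ‖z.2‖ ^ 2) *
      ∫⁻ w, thc (n + 1) (uf m E w z) * (gd (w + ∑ j, uf m E w z j • E j) *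
        ENNReal.ofReal (|(Lop m z.1 (w + ∑ j, uf m E w z j • E j)).det| *
          |(Lop m z.2 (w + ∑ j, uf m E w z j • E j)).det|)) ≤ ENNReal.ofReal (dens d z) := by
  obtain ⟨v, T, hv, hX, hT, hvs, hpx, hpy⟩ := kr_onb F z.1 z.2 hxy
  have hTpos : 0 < T.det := by
    rw [hT]
    refine Finset.prod_pos fun k _ => Real.sqrt_pos.2 ?_
    rw [sub_pos, ← (even_two_mul (d k)).pow_abs]
    exact pow_lt_pow_left₀ hxy (abs_nonneg _) (by have := F.two_le k; omega)
  have hH : Measurable fun g : V => ENNReal.ofReal (|(Lop m z.1 g).det| * |(Lop m z.2 g).det|) := by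
    exact ((Lop_det_meas F measurable_const measurable_id).mul
      (Lop_det_meas F measurable_const measurable_id)).ennreal_ofReal
  have hkey := kr_key (Xf m z) v E hv T (Lam m E z) hTpos.ne' hX (fun i j => rfl) hz
    (fun w => uf m E w z) (fun w => uf_spec E w hz) (thc (n + 1)) (thc_measurable _)
    (fun g => ENNReal.ofReal (|(Lop m z.1 g).det| * |(Lop m z.2 g).det|)) hH
  have hE := feat_E2 F v hv (Sum.elim id id) z.1 z.2 hxy hvs hpx hpy
  rw [hkey, thc_int, mul_one]
  calc _ ≤ ENNReal.ofReal (|(Lam m E z).det|⁻¹) * ENNReal.ofReal (Real.exp (-(‖z.1‖ ^ 2 + ‖z.2‖ ^ 2) / 2)) *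
        (ENNReal.ofReal (|(Lam m E z).det| / |T.det| *
          (2 * Real.pi) ^ (-(Fintype.card (Fin (n + 1) ⊕ Fin (n + 1)) : ℝ) / 2)) *
        ENNReal.ofReal (4 * (n.factorial * ((‖z.1‖ * ‖z.2‖ * ∏ k, (‖z.1‖ * ‖z.2‖) ^ (d k - 1)) *
        S0 d (⟪z.1, z.2⟫ / (‖z.1‖ * ‖z.2‖)))))) := by
        gcongr
        · exact th0_le _
        · exact hE
    _ = ENNReal.ofReal (dens d z) := by
        have hl : 0 < |(Lam m E z).det| := abs_pos.2 hz
        rw [← ENNReal.ofReal_mul (by positivity), ← ENNReal.ofReal_mul (by positivity),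
          ← ENNReal.ofReal_mul (by positivity)]
        congr 1
        unfold dens
        rw [← hT]
        have : |T.det| ≠ 0 := abs_ne_zero.2 hTpos.ne'
        field_simp

theorem tau_continuous (N : ℕ) : Continuous (tau N) := by
  have hpc : Continuous (pk N) := (pk N).toLinearMap.continuous_of_finiteDimensional
  have hpc' : Continuous (pk N).symm := (pk N).symm.toLinearMap.continuous_of_finiteDimensional
  exact hpc.comp ((continuous_fst.comp hpc').prodMk continuous_const)

theorem psi_iff' {N : ℕ} {V : Type*} [NormedAddCommGroup V] [InnerProductSpace ℝ V]
    {m : Fin N → PE N → V} (E : Fin N ⊕ Fin N → V) (w : V) {z : PE N × PE N}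
    (hz : (Lam m E z).det ≠ 0) (t : PE N × PE N) :
    psi m E w z = t ↔ Phi m (w + ∑ j, ((pk N).symm t).2 j • E j) z = tau N t := psi_iff E w hz t

theorem psi_symm {N : ℕ} {V : Type*} [NormedAddCommGroup V] [InnerProductSpace ℝ V]
    {m : Fin N → PE N → V} (E : Fin N ⊕ Fin N → V) (w : V) (z : PE N × PE N) :
    (pk N).symm (psi m E w z) = ((‖z.1‖ ^ 2, ‖z.2‖ ^ 2), uf m E w z) := LinearEquiv.symm_apply_apply _ _

attribute [local irreducible] pk psi Phi tau Lop gd Th thc th0 uf Lam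

set_option maxHeartbeats 1000000 in
theorem kr_piece {n : ℕ} {V : Type*} [NormedAddCommGroup V] [InnerProductSpace ℝ V]
    [FiniteDimensional ℝ V] [MeasurableSpace V] [BorelSpace V]
    {d : Fin (n + 1) → ℕ} {m : Fin (n + 1) → PE (n + 1) → V} (F : FeatSys d m)
    (E : Fin (n + 1) ⊕ Fin (n + 1) → V) (A : Set (PE (n + 1) × PE (n + 1))) (hA : IsSigmaCompact A)
    (hAU : ∀ z ∈ A, (Lam m E z).det ≠ 0) (hAn : ∀ z ∈ A, |⟪z.1, z.2⟫| < ‖z.1‖ * ‖z.2‖) :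
    ∫⁻ g : V, ∫⁻ t, gd g * (Th (n + 1) t * Measure.count {z | z ∈ A ∧ Phi m g z = tau (n + 1) t}) ≤
      ∫⁻ z in A, ENNReal.ofReal (dens d z) := by
  have hAm : MeasurableSet A := by
    obtain ⟨K, hK, rfl⟩ := hA
    exact MeasurableSet.iUnion fun i => (hK i).measurableSet
  have hpc' : Continuous (pk (n + 1)).symm := (pk (n + 1)).symm.toLinearMap.continuous_of_finiteDimensional
  have htau := tau_continuous (n + 1)
  let Eu : (PE (n + 1) × PE (n + 1)) → V := fun t => ∑ j, ((pk (n + 1)).symm t).2 j • E j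
  have hEu : Continuous Eu := by
    refine continuous_finsetSum _ fun j _ => ?_
    exact (((continuous_apply j).comp continuous_snd).comp hpc').smul continuous_const
  have hcm : Measurable fun p : V × (PE (n + 1) × PE (n + 1)) =>
      (Measure.count {z | z ∈ A ∧ Phi m p.1 z = tau (n + 1) p.2} : ℝ≥0∞) := by
    have := kr_count_measurable (X := V × (PE (n + 1) × PE (n + 1))) (T := PE (n + 1) × PE (n + 1))
      (fun U hU => open_sigmaCompact hU) hA
      (Φ := fun p z => Phi m p.1 z - tau (n + 1) p.2) ?_ 0
    · simpa only [sub_eq_zero] using this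
    · have h1 : Continuous fun q : (V × (PE (n + 1) × PE (n + 1))) × (PE (n + 1) × PE (n + 1)) =>
          (q.1.1, q.2) := by fun_prop
      have h2 : Continuous fun q : (V × (PE (n + 1) × PE (n + 1))) × (PE (n + 1) × PE (n + 1)) =>
          tau (n + 1) q.1.2 := htau.comp (continuous_snd.comp continuous_fst)
      have h3 := ((Phi_continuous F).comp h1).sub h2
      simpa only [Function.comp_def, Function.uncurry_def, Pi.sub_def] using h3
  have hgd : Measurable (gd : V → ℝ≥0∞) := gd_measurable
  have hm1 : Measurable fun p : V × (PE (n + 1) × PE (n + 1)) =>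
      gd p.1 * (Th (n + 1) p.2 * Measure.count {z | z ∈ A ∧ Phi m p.1 z = tau (n + 1) p.2}) :=
    (hgd.comp measurable_fst).mul (((Th_measurable _).comp measurable_snd).mul hcm)
  rw [lintegral_lintegral_swap hm1.aemeasurable]
  have hst : ∀ t, ∫⁻ g : V, gd g * (Th (n + 1) t * Measure.count {z | z ∈ A ∧ Phi m g z = tau (n + 1) t}) =
      ∫⁻ w : V, gd (w + Eu t) * (Th (n + 1) t * Measure.count {z | z ∈ A ∧ Phi m (w + Eu t) z = tau (n + 1) t}) :=
    fun t => (lintegral_add_right_eq_self _ (Eu t)).symm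
  simp_rw [hst]
  have hm2 : Measurable fun p : (PE (n + 1) × PE (n + 1)) × V =>
      gd (p.2 + Eu p.1) * (Th (n + 1) p.1 * Measure.count {z | z ∈ A ∧ Phi m (p.2 + Eu p.1) z = tau (n + 1) p.1}) :=
    hm1.comp ((measurable_snd.add (hEu.measurable.comp measurable_fst)).prodMk measurable_fst)
  rw [lintegral_lintegral_swap hm2.aemeasurable]
  -- joint function
  let G : V → (PE (n + 1) × PE (n + 1)) → ℝ≥0∞ := fun w z =>
    ENNReal.ofReal (|(Lam m E z).det|⁻¹) * th0 (‖z.1‖ ^ 2, ‖z.2‖ ^ 2) *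
      (thc (n + 1) (uf m E w z) * (gd (w + ∑ j, uf m E w z j • E j) *
        ENNReal.ofReal (|(Lop m z.1 (w + ∑ j, uf m E w z j • E j)).det| *
          |(Lop m z.2 (w + ∑ j, uf m E w z j • E j)).det|)))
  have hgm : Measurable fun p : V × (PE (n + 1) × PE (n + 1)) => p.1 + ∑ j, uf m E p.1 p.2 j • E j := by
    refine measurable_fst.add (Finset.measurable_sum _ fun j _ => ?_)
    exact ((measurable_pi_iff.1 (uf_measurable F E)) j).smul_const _
  have hG2 : Measurable fun p : V × (PE (n + 1) × PE (n + 1)) => (thc (n + 1) (uf m E p.1 p.2) *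
      (gd (p.1 + ∑ j, uf m E p.1 p.2 j • E j) *
        ENNReal.ofReal (|(Lop m p.2.1 (p.1 + ∑ j, uf m E p.1 p.2 j • E j)).det| *
          |(Lop m p.2.2 (p.1 + ∑ j, uf m E p.1 p.2 j • E j)).det|))) := by
    refine ((thc_measurable _).comp (uf_measurable F E)).mul ((hgd.comp hgm).mul ?_)
    refine Measurable.ennreal_ofReal ?_
    exact (Lop_det_meas F (measurable_fst.comp measurable_snd) hgm).mul
      (Lop_det_meas F (measurable_snd.comp measurable_snd) hgm)
  have hG : Measurable (Function.uncurry G) := by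
    refine Measurable.mul (Measurable.mul ?_ ?_) hG2
    · refine Measurable.ennreal_ofReal (Measurable.inv ?_)
      exact ((Lam_det_contDiff F E).continuous.abs.comp continuous_snd).measurable
    · refine th0_measurable.comp ?_
      fun_prop
  calc _ ≤ ∫⁻ w : V, ∫⁻ z in A, G w z := by
        refine lintegral_mono fun w => ?_
        have hh : Measurable fun t => gd (w + Eu t) * Th (n + 1) t :=
          (hgd.comp (hEu.measurable.const_add w)).mul (Th_measurable _)
        haveI : (volume : Measure (PE (n + 1) × PE (n + 1))).IsAddHaarMeasure :=
          Measure.prod.instIsAddHaarMeasure _ _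
        have := kr_area volume hAm (ψ := psi m E w) (fun z hz => psi_contDiffAt F E w (hAU z hz)) hh
        calc _ = ∫⁻ t, gd (w + Eu t) * Th (n + 1) t * Measure.count {z | z ∈ A ∧ psi m E w z = t} := by
              refine lintegral_congr fun t => ?_
              rw [mul_assoc]
              congr 4
              ext z
              refine and_congr_right fun hz => ?_
              exact (psi_iff' E w (hAU z hz) t).symm
          _ ≤ _ := this
          _ = _ := by
              refine setLIntegral_congr_fun hAm fun z hz => ?_
              have hp : (pk (n + 1)).symm (psi m E w z) = ((‖z.1‖ ^ 2, ‖z.2‖ ^ 2), uf m E w z) :=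
                psi_symm E w z
              simp only [G, Eu, Th_eq, hp]
              rw [psi_det F E w (hAU z hz), ENNReal.ofReal_mul (by positivity)]
              ring
    _ = ∫⁻ z in A, ∫⁻ w : V, G w z := lintegral_lintegral_swap hG.aemeasurable
    _ ≤ _ := by
        refine setLIntegral_mono' hAm fun z hz => ?_
        refine le_trans (le_of_eq ?_) (kr_inner_bound F E z (hAU z hz) (hAn z hz))
        simp only [G]
        rw [lintegral_const_mul]
        exact hG2.comp (measurable_id.prodMk measurable_const)

end

section
open MeasureTheory Set ProbabilityTheory
open scoped ENNReal RealInnerProductSpace Matrix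

theorem sc_inter_closed {X : Type*} [TopologicalSpace X] {A B : Set X} (hA : IsSigmaCompact A) (hB : IsClosed B) :
    IsSigmaCompact (A ∩ B) := by
  obtain ⟨K, hK, rfl⟩ := hA
  rw [iUnion_inter]
  exact isSigmaCompact_iUnion _ fun n => ((hK n).inter_right hB).isSigmaCompact

theorem sc_inter_open {X : Type*} [PseudoEMetricSpace X] {A B : Set X} (hA : IsSigmaCompact A) (hB : IsOpen B) :
    IsSigmaCompact (A ∩ B) := by
  obtain ⟨F, hF, -, h, -⟩ := hB.exists_iUnion_isClosed
  rw [← h, inter_iUnion]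
  exact isSigmaCompact_iUnion _ fun n => sc_inter_closed hA (hF n)

theorem sc_measurable {X : Type*} [TopologicalSpace X] [T2Space X] [MeasurableSpace X] [BorelSpace X]
    {A : Set X} (hA : IsSigmaCompact A) : MeasurableSet A := by
  obtain ⟨K, hK, rfl⟩ := hA
  exact MeasurableSet.iUnion fun i => (hK i).measurableSet

theorem Lam_self_ne {N : ℕ} {V : Type*} [NormedAddCommGroup V] [InnerProductSpace ℝ V]
    {d : Fin N → ℕ} {m : Fin N → PE N → V} (F : FeatSys d m) (z : PE N × PE N)
    (hxy : |⟪z.1, z.2⟫| < ‖z.1‖ * ‖z.2‖) : (Lam m (Xf m z) z).det ≠ 0 := by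
  obtain ⟨v, T, hv, hX, hT, -⟩ := kr_onb F z.1 z.2 hxy
  have hTpos : 0 < T.det := by
    rw [hT]
    refine Finset.prod_pos fun k _ => Real.sqrt_pos.2 ?_
    rw [sub_pos, ← (even_two_mul (d k)).pow_abs]
    exact pow_lt_pow_left₀ hxy (abs_nonneg _) (by have := F.two_le k; omega)
  have hX' : ∀ j, Xf m z j = ∑ i, T j i • v i := hX
  have h : Lam m (Xf m z) z = T * Tᵀ := by
    ext i j
    simp only [Lam, Matrix.of_apply, hX', sum_inner, inner_sum, real_inner_smul_left, real_inner_smul_right,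
      orthonormal_iff_ite.1 hv, Matrix.mul_apply, Matrix.transpose_apply]
    simp [mul_comm]
  rw [h, Matrix.det_mul, Matrix.det_transpose]
  positivity

theorem kr_count_meas2 {n : ℕ} {V : Type*} [NormedAddCommGroup V] [InnerProductSpace ℝ V]
    [FiniteDimensional ℝ V] [MeasurableSpace V] [BorelSpace V]
    {d : Fin (n + 1) → ℕ} {m : Fin (n + 1) → PE (n + 1) → V} (F : FeatSys d m)
    (A : Set (PE (n + 1) × PE (n + 1))) (hA : IsSigmaCompact A) :
    Measurable fun p : V × (PE (n + 1) × PE (n + 1)) =>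
      gd p.1 * (Th (n + 1) p.2 * Measure.count {z | z ∈ A ∧ Phi m p.1 z = tau (n + 1) p.2}) := by
  have htau := tau_continuous (n + 1)
  have hcm : Measurable fun p : V × (PE (n + 1) × PE (n + 1)) =>
      (Measure.count {z | z ∈ A ∧ Phi m p.1 z = tau (n + 1) p.2} : ℝ≥0∞) := by
    have := kr_count_measurable (X := V × (PE (n + 1) × PE (n + 1))) (T := PE (n + 1) × PE (n + 1))
      (fun U hU => open_sigmaCompact hU) hA
      (Φ := fun p z => Phi m p.1 z - tau (n + 1) p.2) ?_ 0
    · simpa only [sub_eq_zero] using this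
    · have h1 : Continuous fun q : (V × (PE (n + 1) × PE (n + 1))) × (PE (n + 1) × PE (n + 1)) =>
          (q.1.1, q.2) := by fun_prop
      have h2 : Continuous fun q : (V × (PE (n + 1) × PE (n + 1))) × (PE (n + 1) × PE (n + 1)) =>
          tau (n + 1) q.1.2 := htau.comp (continuous_snd.comp continuous_fst)
      have h3 := ((Phi_continuous F).comp h1).sub h2
      simpa only [Function.comp_def, Function.uncurry_def, Pi.sub_def] using h3
  have hgd : Measurable (gd : V → ℝ≥0∞) := gd_measurable
  exact (hgd.comp measurable_fst).mul (((Th_measurable _).comp measurable_snd).mul hcm)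

theorem kr_cover {n : ℕ} {V : Type*} [NormedAddCommGroup V] [InnerProductSpace ℝ V]
    [FiniteDimensional ℝ V] [MeasurableSpace V] [BorelSpace V]
    {d : Fin (n + 1) → ℕ} {m : Fin (n + 1) → PE (n + 1) → V} (F : FeatSys d m)
    (C : Set (PE (n + 1) × PE (n + 1))) (hC : IsSigmaCompact C)
    (hCn : ∀ z ∈ C, |⟪z.1, z.2⟫| < ‖z.1‖ * ‖z.2‖) :
    ∫⁻ g : V, ∫⁻ t, gd g * (Th (n + 1) t * Measure.count {z | z ∈ C ∧ Phi m g z = tau (n + 1) t}) ≤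
      ∫⁻ z in C, ENNReal.ofReal (dens d z) := by
  rcases C.eq_empty_or_nonempty with rfl | hne
  · simp
  let U : PE (n + 1) × PE (n + 1) → Set (PE (n + 1) × PE (n + 1)) := fun z0 => {z | (Lam m (Xf m z0) z).det ≠ 0}
  have hU : ∀ z0, IsOpen (U z0) := fun z0 =>
    isOpen_ne_fun (Lam_det_contDiff F (Xf m z0)).continuous continuous_const
  obtain ⟨t, htC, htc, hcov⟩ := TopologicalSpace.countable_cover_nhdsWithin (s := C) (f := U)
    fun z hz => mem_nhdsWithin_of_mem_nhds ((hU z).mem_nhds (Lam_self_ne F z (hCn z hz)))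
  have htne : t.Nonempty := by
    by_contra h
    rw [not_nonempty_iff_eq_empty] at h
    subst h
    obtain ⟨z, hz⟩ := hne
    simpa using hcov hz
  obtain ⟨e, rfl⟩ := htc.exists_eq_range htne
  let A : ℕ → Set (PE (n + 1) × PE (n + 1)) := fun i => C ∩ disjointed (fun i => U (e i)) i
  have hAs : ∀ i, IsSigmaCompact (A i) := by
    intro i
    simp only [A]
    rw [disjointed_eq_inter_compl, ← inter_assoc]
    refine sc_inter_closed (sc_inter_open hC (hU _)) ?_
    exact isClosed_biInter fun j _ => (hU _).isClosed_compl
  have hAC : ⋃ i, A i = C := by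
    simp only [A]
    rw [← inter_iUnion, iUnion_disjointed, inter_eq_left]
    refine hcov.trans ?_
    rw [biUnion_range]
  have hAd : Pairwise (Function.onFun Disjoint A) := fun i j hij =>
    ((disjoint_disjointed _ hij).mono inter_subset_right inter_subset_right)
  have hp : ∀ i, ∫⁻ g : V, ∫⁻ t, gd g * (Th (n + 1) t * Measure.count {z | z ∈ A i ∧ Phi m g z = tau (n + 1) t}) ≤
      ∫⁻ z in A i, ENNReal.ofReal (dens d z) := fun i =>
    kr_piece F (Xf m (e i)) (A i) (hAs i) (fun z hz => disjointed_subset _ _ hz.2) fun z hz => hCn z hz.1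
  calc _ ≤ ∫⁻ g : V, ∫⁻ t, ∑' i, gd g * (Th (n + 1) t * Measure.count {z | z ∈ A i ∧ Phi m g z = tau (n + 1) t}) := by
        refine lintegral_mono fun g => lintegral_mono fun t => ?_
        rw [ENNReal.tsum_mul_left, ENNReal.tsum_mul_left]
        gcongr
        refine le_trans (le_of_eq ?_) (measure_iUnion_le _)
        congr 1
        ext z
        rw [← hAC]
        simp
    _ = ∑' i, ∫⁻ g : V, ∫⁻ t, gd g * (Th (n + 1) t * Measure.count {z | z ∈ A i ∧ Phi m g z = tau (n + 1) t}) := by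
        rw [← lintegral_tsum]
        · refine lintegral_congr fun g => ?_
          rw [lintegral_tsum]
          exact fun i => ((kr_count_meas2 F (A i) (hAs i)).comp (measurable_const.prodMk measurable_id)).aemeasurable
        · exact fun i => (kr_count_meas2 F (A i) (hAs i)).lintegral_prod_right'.aemeasurable
    _ ≤ ∑' i, ∫⁻ z in A i, ENNReal.ofReal (dens d z) := ENNReal.tsum_le_tsum hp
    _ = _ := by
        rw [← lintegral_iUnion (fun i => sc_measurable (hAs i)) hAd, hAC]

/-- the comparison function -/
noncomputable def hfun {n : ℕ} (d : Fin (n + 1) → ℕ) (r : ℝ) : ℝ :=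
  ∑ j, (d j : ℝ) * ∏ k ∈ Finset.univ.erase j, Real.sqrt ((d k : ℝ) ^ 2 * (1 - r ^ 2) / (1 - (r ^ d k) ^ 2))

/-- the base kernel -/
noncomputable def kern (n : ℕ) (z : PE (n + 1) × PE (n + 1)) : ℝ :=
  Real.exp (-(‖z.1‖ ^ 2 + ‖z.2‖ ^ 2) / 2) * (Real.sqrt (‖z.1‖ ^ 2 * ‖z.2‖ ^ 2 - ⟪z.1, z.2⟫ ^ 2) ^ n)⁻¹

theorem dens_eq {n : ℕ} (d : Fin (n + 1) → ℕ) (hd : ∀ k, 2 ≤ d k) (z : PE (n + 1) × PE (n + 1))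
    (hxy : |⟪z.1, z.2⟫| < ‖z.1‖ * ‖z.2‖) :
    dens d z = 4 * n.factorial * (2 * Real.pi) ^ (-((n : ℝ) + 1)) * kern n z *
      hfun d (⟪z.1, z.2⟫ / (‖z.1‖ * ‖z.2‖)) := by
  have hs : 0 < ‖z.1‖ * ‖z.2‖ := lt_of_le_of_lt (abs_nonneg _) hxy
  unfold dens kern
  have hG0 : ‖z.1‖ ^ 2 * ‖z.2‖ ^ 2 = (‖z.1‖ * ‖z.2‖) ^ 2 := by ring
  rw [hG0]
  set s := ‖z.1‖ * ‖z.2‖ with hsdef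
  set r := ⟪z.1, z.2⟫ / s with hr
  have hrs : ⟪z.1, z.2⟫ = s * r := by rw [hr]; field_simp
  clear_value r s
  rw [hrs] at hxy ⊢
  clear hsdef hr hG0 hrs
  have hr1 : |r| < 1 := by
    rw [abs_mul, abs_of_pos hs] at hxy
    exact (mul_lt_iff_lt_one_right hs).1 hxy
  have hr2 : 0 < 1 - r ^ 2 := by
    have := (sq_lt_one_iff_abs_lt_one r).2 hr1; linarith
  have hrd : ∀ k, 0 < 1 - (r ^ d k) ^ 2 := by
    intro k
    have h1 : |r ^ d k| < 1 := by
      rw [abs_pow]; exact pow_lt_one₀ (abs_nonneg _) hr1 (by have := hd k; omega)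
    have := (sq_lt_one_iff_abs_lt_one _).2 h1; linarith
  have e1 : ∀ k, Real.sqrt (s ^ (2 * d k) - (s * r) ^ (2 * d k)) = s ^ d k * Real.sqrt (1 - (r ^ d k) ^ 2) := by
    intro k
    rw [show s ^ (2 * d k) - (s * r) ^ (2 * d k) = (s ^ d k) ^ 2 * (1 - (r ^ d k) ^ 2) by
      rw [mul_pow]; ring, Real.sqrt_mul (by positivity), Real.sqrt_sq (by positivity)]
  have e2 : Real.sqrt (s ^ 2 - (s * r) ^ 2) = s * Real.sqrt (1 - r ^ 2) := by
    rw [show s ^ 2 - (s * r) ^ 2 = s ^ 2 * (1 - r ^ 2) by ring, Real.sqrt_mul (by positivity), Real.sqrt_sq hs.le]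
  have e3 : ∀ k, Real.sqrt ((d k : ℝ) ^ 2 * (1 - r ^ 2) / (1 - (r ^ d k) ^ 2)) =
      Real.sqrt (1 - r ^ 2) * (d k / Real.sqrt (1 - (r ^ d k) ^ 2)) := by
    intro k
    rw [Real.sqrt_div' _ (hrd k).le, Real.sqrt_mul (by positivity), Real.sqrt_sq (by positivity)]; ring
  have e4 : (2 * Real.pi) ^ (-(Fintype.card (Fin (n + 1) ⊕ Fin (n + 1)) : ℝ) / 2) =
      (2 * Real.pi) ^ (-((n : ℝ) + 1)) := by
    congr 1
    simp
  have e5 : ∏ k, s ^ d k = s ^ (n + 1) * ∏ k, s ^ (d k - 1) := by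
    have : ∀ k, s ^ d k = s * s ^ (d k - 1) := fun k => by
      rw [← pow_succ']; congr 1; have := hd k; omega
    simp_rw [this]
    rw [Finset.prod_mul_distrib]; simp
  have hq : ∀ k, 0 < Real.sqrt (1 - (r ^ d k) ^ 2) := fun k => Real.sqrt_pos.2 (hrd k)
  have hQ : 0 < ∏ k, Real.sqrt (1 - (r ^ d k) ^ 2) := Finset.prod_pos fun k _ => hq k
  have e6 : S0 d r / ∏ k, Real.sqrt (1 - (r ^ d k) ^ 2) =
      ∑ j, (d j : ℝ) * ∏ k ∈ Finset.univ.erase j, (d k / Real.sqrt (1 - (r ^ d k) ^ 2)) := by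
    unfold S0
    rw [Finset.sum_div]
    refine Finset.sum_congr rfl fun j _ => ?_
    rw [Finset.prod_div_distrib, ← Finset.mul_prod_erase _ _ (Finset.mem_univ j)]
    have h1 := (hq j).ne'
    have h2 : (∏ k ∈ Finset.univ.erase j, Real.sqrt (1 - (r ^ d k) ^ 2)) ≠ 0 :=
      (Finset.prod_pos fun k _ => hq k).ne'
    rw [show 1 - r ^ (2 * d j) = 1 - (r ^ d j) ^ 2 by ring]
    field_simp
  have e7 : hfun d r = Real.sqrt (1 - r ^ 2) ^ n * (S0 d r / ∏ k, Real.sqrt (1 - (r ^ d k) ^ 2)) := by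
    rw [e6, Finset.mul_sum]
    unfold hfun
    refine Finset.sum_congr rfl fun j _ => ?_
    simp_rw [e3]
    rw [Finset.prod_mul_distrib, Finset.prod_const, Finset.card_erase_of_mem (Finset.mem_univ j)]
    simp only [Finset.card_univ, Fintype.card_fin, Nat.add_sub_cancel]
    ring
  simp_rw [e1]
  rw [Finset.prod_mul_distrib, e2, e4, e5, e7, abs_of_pos (by positivity)]
  have h1 : Real.sqrt (1 - r ^ 2) ≠ 0 := (Real.sqrt_pos.2 hr2).ne'
  have h2 : (∏ k, s ^ (d k - 1)) ≠ 0 := (Finset.prod_pos fun k _ => by positivity).ne'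
  have h3 := hQ.ne'
  have h4 := hs.ne'
  rw [mul_pow]
  field_simp
  ring

end

section
open MeasureTheory Set ProbabilityTheory
open scoped ENNReal RealInnerProductSpace Matrix

theorem kr_rad {E : Type*} [NormedAddCommGroup E] [InnerProductSpace ℝ E]
    [FiniteDimensional ℝ E] [MeasurableSpace E] [BorelSpace E] (p i : ℕ)
    (hE : Module.finrank ℝ E = p + i + 1) :
    ∫⁻ x : E, ENNReal.ofReal (Real.exp (-‖x‖ ^ 2 / 2) * (‖x‖ ^ p)⁻¹) =
      ENNReal.ofReal (2 * Real.sqrt Real.pi ^ (p + i + 1) / Real.Gamma (((p : ℝ) + i + 1) / 2) *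
        ((1 / 2 : ℝ) ^ (-((i : ℝ) + 1) / 2) * (1 / 2) * Real.Gamma (((i : ℝ) + 1) / 2))) := by
  have : Nontrivial E := Module.nontrivial_of_finrank_pos (R := ℝ) (by omega)
  have hcongr : Set.EqOn (fun y : ℝ => y ^ (Module.finrank ℝ E - 1) • (Real.exp (-y ^ 2 / 2) * (y ^ p)⁻¹))
      (fun y : ℝ => y ^ (i : ℝ) * Real.exp (-(1 / 2) * y ^ (2 : ℝ))) (Ioi 0) := by
    intro y hy
    have hy : 0 < y := hy
    simp only [smul_eq_mul, hE, Nat.add_sub_cancel]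
    rw [Real.rpow_natCast, pow_add, show y ^ (2 : ℝ) = y ^ 2 by exact_mod_cast Real.rpow_natCast y 2,
      show -y ^ 2 / 2 = -(1 / 2) * y ^ 2 by ring]
    field_simp
  have hIntg : Integrable (fun x : E => Real.exp (-‖x‖ ^ 2 / 2) * (‖x‖ ^ p)⁻¹) := by
    have := integrable_fun_norm_addHaar (volume : Measure E) (f := fun y : ℝ => Real.exp (-y ^ 2 / 2) * (y ^ p)⁻¹)
    refine this.2 ?_
    rw [integrableOn_congr_fun hcongr measurableSet_Ioi]
    exact integrableOn_rpow_mul_exp_neg_mul_rpow (s := (i : ℝ)) (by linarith [(Nat.cast_nonneg i : (0:ℝ) ≤ i)])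
      (by norm_num) (by norm_num)
  rw [← ofReal_integral_eq_lintegral_ofReal hIntg (Filter.Eventually.of_forall fun x => by positivity)]
  congr 1
  rw [integral_fun_norm_addHaar (volume : Measure E) (fun y : ℝ => Real.exp (-y ^ 2 / 2) * (y ^ p)⁻¹),
    setIntegral_congr_fun measurableSet_Ioi hcongr,
    integral_rpow_mul_exp_neg_mul_rpow (by norm_num) (by linarith [(Nat.cast_nonneg i : (0:ℝ) ≤ i)]) (by norm_num)]
  rw [Measure.real, InnerProductSpace.volume_ball, hE]
  have hq : (0 : ℝ) < ((p : ℝ) + i + 1) / 2 := by positivity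
  have hG := Real.Gamma_pos_of_pos hq
  have hG2 : Real.Gamma (((p + i + 1 : ℕ) : ℝ) / 2 + 1) = ((p : ℝ) + i + 1) / 2 * Real.Gamma (((p : ℝ) + i + 1) / 2) := by
    push_cast
    rw [Real.Gamma_add_one hq.ne']
  rw [hG2, ENNReal.ofReal_one, one_pow, one_mul, ENNReal.toReal_ofReal (by positivity)]
  simp only [nsmul_eq_mul, smul_eq_mul]
  push_cast
  field_simp

theorem kr_rad0 {E : Type*} [NormedAddCommGroup E] [InnerProductSpace ℝ E]
    [FiniteDimensional ℝ E] [MeasurableSpace E] [BorelSpace E] (p : ℕ)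
    (hE : Module.finrank ℝ E = p + 1) :
    ∫⁻ x : E, ENNReal.ofReal (Real.exp (-‖x‖ ^ 2 / 2) * (‖x‖ ^ p)⁻¹) =
      ENNReal.ofReal (2 * Real.sqrt Real.pi ^ (p + 1) / Real.Gamma (((p : ℝ) + 1) / 2) *
        (Real.sqrt 2 / 2 * Real.sqrt Real.pi)) := by
  rw [kr_rad p 0 (by simpa using hE)]
  congr 1
  have h : (1 / 2 : ℝ) ^ (-((0 : ℝ) + 1) / 2) = Real.sqrt 2 := by
    rw [one_div, Real.inv_rpow (by norm_num), ← Real.rpow_neg (by norm_num), Real.sqrt_eq_rpow]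
    norm_num
  simp only [Nat.cast_zero, add_zero]
  rw [h, zero_add, Real.Gamma_one_half_eq]
  ring

theorem kr_rad1 {E : Type*} [NormedAddCommGroup E] [InnerProductSpace ℝ E]
    [FiniteDimensional ℝ E] [MeasurableSpace E] [BorelSpace E] (p : ℕ)
    (hE : Module.finrank ℝ E = p + 2) :
    ∫⁻ x : E, ENNReal.ofReal (Real.exp (-‖x‖ ^ 2 / 2) * (‖x‖ ^ p)⁻¹) =
      ENNReal.ofReal (2 * Real.sqrt Real.pi ^ (p + 2) / Real.Gamma (((p : ℝ) + 1) / 2 + 1 / 2)) := by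
  rw [kr_rad p 1 (by simpa using hE)]
  congr 1
  have h : (1 / 2 : ℝ) ^ (-((1 : ℝ) + 1) / 2) = 2 := by
    norm_num [Real.rpow_neg]
  simp only [Nat.cast_one]
  rw [h, show ((1:ℝ) + 1) / 2 = 1 by norm_num, Real.Gamma_one,
    show ((p : ℝ) + 1 + 1) / 2 = ((p : ℝ) + 1) / 2 + 1 / 2 by ring]
  ring

theorem kern_measurable (n : ℕ) : Measurable (kern n) := by
  unfold kern
  fun_prop

theorem kern_inner (n : ℕ) (x : PE (n + 1)) (hx : x ≠ 0) :
    ∫⁻ y, ENNReal.ofReal (kern n (x, y)) = ENNReal.ofReal (Real.exp (-‖x‖ ^ 2 / 2) * (‖x‖ ^ n)⁻¹) *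
      (ENNReal.ofReal ((2 * Real.pi) ^ ((1 : ℝ) / 2)) *
      ENNReal.ofReal (2 * Real.sqrt Real.pi ^ (n + 1) / Real.Gamma (((n : ℝ) + 1) / 2) *
        (Real.sqrt 2 / 2 * Real.sqrt Real.pi))) := by
  have hm : Measurable fun y => ENNReal.ofReal (kern n (x, y)) :=
    ((kern_measurable n).comp (measurable_const.prodMk measurable_id)).ennreal_ofReal
  rw [kr_decomp (Submodule.span ℝ {x}) hm]
  have hS : Module.finrank ℝ (Submodule.span ℝ {x}) = 1 := finrank_span_singleton hx
  have hSo : Module.finrank ℝ (Submodule.span ℝ {x})ᗮ = n + 1 := by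
    have := Submodule.finrank_add_finrank_orthogonal (Submodule.span ℝ {x})
    rw [hS, finrank_euclideanSpace_fin] at this
    omega
  have hk : ∀ (s : Submodule.span ℝ {x}) (κ : (Submodule.span ℝ {x})ᗮ),
      ENNReal.ofReal (kern n (x, (s : PE (n + 1)) + κ)) =
      ENNReal.ofReal (Real.exp (-‖x‖ ^ 2 / 2) * (‖x‖ ^ n)⁻¹) * (ENNReal.ofReal (Real.exp (-‖s‖ ^ 2 / 2)) *
        ENNReal.ofReal (Real.exp (-‖κ‖ ^ 2 / 2) * (‖κ‖ ^ n)⁻¹)) := by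
    rintro ⟨s, hs⟩ ⟨κ, hκ⟩
    obtain ⟨c, rfl⟩ := Submodule.mem_span_singleton.1 hs
    have hxk : ⟪x, κ⟫ = 0 := Submodule.mem_orthogonal_singleton_iff_inner_right.1 hκ
    rw [← ENNReal.ofReal_mul (by positivity), ← ENNReal.ofReal_mul (by positivity)]
    congr 1
    unfold kern
    simp only [Submodule.coe_norm]
    have h1 : ‖c • x + κ‖ ^ 2 = ‖c • x‖ ^ 2 + ‖κ‖ ^ 2 := by
      have := norm_add_sq_eq_norm_sq_add_norm_sq_real (x := c • x) (y := κ) (by rw [real_inner_smul_left, hxk, mul_zero])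
      simpa [pow_two] using this
    have h2 : ⟪x, c • x + κ⟫ = c * ‖x‖ ^ 2 := by
      rw [inner_add_right, hxk, real_inner_smul_right, real_inner_self_eq_norm_sq, add_zero]
    have h3 : ‖x‖ ^ 2 * (‖c • x‖ ^ 2 + ‖κ‖ ^ 2) - (c * ‖x‖ ^ 2) ^ 2 = (‖x‖ * ‖κ‖) ^ 2 := by
      rw [norm_smul, mul_pow, Real.norm_eq_abs, sq_abs]; ring
    rw [h1, h2, h3, Real.sqrt_sq (by positivity), mul_pow, mul_inv,
      show -(‖x‖ ^ 2 + (‖c • x‖ ^ 2 + ‖κ‖ ^ 2)) / 2 = -‖x‖ ^ 2 / 2 + (-‖c • x‖ ^ 2 / 2 + -‖κ‖ ^ 2 / 2) by ring,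
      Real.exp_add, Real.exp_add]
    ring
  simp_rw [hk]
  have hmk : Measurable fun κ : (Submodule.span ℝ {x})ᗮ => ENNReal.ofReal (Real.exp (-‖κ‖ ^ 2 / 2) * (‖κ‖ ^ n)⁻¹) := by
    fun_prop
  have hms : Measurable fun s : (Submodule.span ℝ {x}) => ENNReal.ofReal (Real.exp (-‖s‖ ^ 2 / 2)) := by
    fun_prop
  have e1 : ∀ s : (Submodule.span ℝ {x}), ∫⁻ κ : (Submodule.span ℝ {x})ᗮ,
      ENNReal.ofReal (Real.exp (-‖x‖ ^ 2 / 2) * (‖x‖ ^ n)⁻¹) * (ENNReal.ofReal (Real.exp (-‖s‖ ^ 2 / 2)) *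
        ENNReal.ofReal (Real.exp (-‖κ‖ ^ 2 / 2) * (‖κ‖ ^ n)⁻¹)) =
      ENNReal.ofReal (Real.exp (-‖x‖ ^ 2 / 2) * (‖x‖ ^ n)⁻¹) * (ENNReal.ofReal (Real.exp (-‖s‖ ^ 2 / 2)) *
        ENNReal.ofReal (2 * Real.sqrt Real.pi ^ (n + 1) / Real.Gamma (((n : ℝ) + 1) / 2) *
        (Real.sqrt 2 / 2 * Real.sqrt Real.pi))) := by
    intro s
    rw [lintegral_const_mul _ (hmk.const_mul _), lintegral_const_mul _ hmk, kr_rad0 n hSo]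
  simp_rw [e1]
  rw [lintegral_const_mul _ (hms.mul_const _), lintegral_mul_const _ hms, kr_gauss_int, hS]
  norm_num

theorem kern_int (n : ℕ) : ENNReal.ofReal (4 * n.factorial * (2 * Real.pi) ^ (-((n : ℝ) + 1))) *
    ∫⁻ z, ENNReal.ofReal (kern n z) = ENNReal.ofReal (8 * Real.pi) := by
  have h1 : ∫⁻ z, ENNReal.ofReal (kern n z) = ∫⁻ x, ∫⁻ y, ENNReal.ofReal (kern n (x, y)) := by
    rw [show (volume : Measure (PE (n + 1) × PE (n + 1))) = volume.prod volume from rfl,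
      lintegral_prod _ (kern_measurable n).ennreal_ofReal.aemeasurable]
  have h0 : ∀ᵐ x : PE (n + 1), x ≠ 0 := by
    rw [ae_iff]; simp
  have hmx : Measurable fun x : PE (n + 1) => ENNReal.ofReal (Real.exp (-‖x‖ ^ 2 / 2) * (‖x‖ ^ n)⁻¹) := by
    fun_prop
  rw [h1, lintegral_congr_ae (h0.mono fun x hx => kern_inner n x hx), lintegral_mul_const _ hmx,
    kr_rad1 n (by rw [finrank_euclideanSpace_fin])]
  have hs : (0 : ℝ) < ((n : ℝ) + 1) / 2 := by positivity
  have hg1 := Real.Gamma_pos_of_pos hs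
  have hg2 : 0 < Real.Gamma (((n : ℝ) + 1) / 2 + 1 / 2) := Real.Gamma_pos_of_pos (by positivity)
  rw [← ENNReal.ofReal_mul (by positivity), ← ENNReal.ofReal_mul (by positivity), ← ENNReal.ofReal_mul (by positivity)]
  congr 1
  have hdup := Real.Gamma_mul_Gamma_add_half (((n : ℝ) + 1) / 2)
  have hd1 : (2:ℝ) * (((n : ℝ) + 1) / 2) = n + 1 := by ring
  have hd2 : (2:ℝ) ^ (1 - ((n : ℝ) + 1)) = (2 ^ n)⁻¹ := by
    rw [show (1 - ((n : ℝ) + 1)) = -(n:ℝ) by ring, Real.rpow_neg (by norm_num), Real.rpow_natCast]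
  rw [hd1, hd2, Real.Gamma_nat_eq_factorial] at hdup
  have hp1 : (2 * Real.pi) ^ (-((n : ℝ) + 1)) = ((2 * Real.pi) ^ (n + 1))⁻¹ := by
    rw [Real.rpow_neg (by positivity)]; congr 1; exact_mod_cast Real.rpow_natCast _ (n + 1)
  have hp2 : (2 * Real.pi) ^ ((1:ℝ) / 2) = Real.sqrt 2 * Real.sqrt Real.pi := by
    rw [← Real.sqrt_eq_rpow, Real.sqrt_mul (by norm_num)]
  have hf : (0 : ℝ) < n.factorial := by positivity
  have hq2 : Real.sqrt 2 ^ 2 = 2 := Real.sq_sqrt (by norm_num)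
  have hqp : Real.sqrt Real.pi ^ 2 = Real.pi := Real.sq_sqrt Real.pi_pos.le
  have hqpp : 0 < Real.sqrt Real.pi := Real.sqrt_pos.2 Real.pi_pos
  rw [hp1, hp2]
  set g1 := Real.Gamma (((n : ℝ) + 1) / 2)
  set g2 := Real.Gamma (((n : ℝ) + 1) / 2 + 1 / 2)
  set q := Real.sqrt Real.pi
  set q2 := Real.sqrt 2
  have : (4 : ℝ) * n.factorial * ((2 * Real.pi) ^ (n + 1))⁻¹ *
      (2 * q ^ (n + 2) / g2 * (q2 * q * (2 * q ^ (n + 1) / g1 * (q2 / 2 * q)))) =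
      8 * n.factorial * ((2 * Real.pi) ^ (n + 1))⁻¹ * (q2 ^ 2 * q ^ 2 * (q ^ 2) ^ (n + 1) * q) / (g1 * g2) := by
    field_simp
    ring
  rw [this, hdup, hq2, hqp]
  have := Real.pi_pos
  field_simp
  ring

end

section
open MeasureTheory Set ProbabilityTheory
open scoped ENNReal RealInnerProductSpace Matrix

theorem kr_exp_int : ∫⁻ a : ℝ, (Ioi (0:ℝ)).indicator (fun a => ENNReal.ofReal (Real.exp (-a / 2))) a = 2 := by
  rw [lintegral_indicator measurableSet_Ioi]
  have h1 : (fun a : ℝ => Real.exp (-a / 2)) = fun a => Real.exp ((-1 / 2) * a) := by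
    ext a; congr 1; ring
  rw [← ofReal_integral_eq_lintegral_ofReal]
  · rw [h1, integral_exp_mul_Ioi (by norm_num)]
    norm_num
  · rw [h1]; exact integrableOn_exp_mul_Ioi (by norm_num) 0
  · exact Filter.Eventually.of_forall fun x => by positivity

/-- half weight -/
noncomputable def Ah (N : ℕ) (t : PE N) : ℝ≥0∞ :=
  (Ioi (0:ℝ)).indicator (fun a => ENNReal.ofReal (Real.exp (-a / 2))) (t 0) *
    (Set.pi Set.univ fun _ => Set.Icc (0:ℝ) 1).indicator (fun _ => 1) (fun k : Fin N => t k.succ)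

theorem Ah_int (N : ℕ) : ∫⁻ t, Ah N t = 2 := by
  have hm1 : Measurable ((Ioi (0:ℝ)).indicator (fun a => ENNReal.ofReal (Real.exp (-a / 2)))) :=
    Measurable.indicator (by fun_prop) measurableSet_Ioi
  have hms : MeasurableSet (Set.pi Set.univ fun _ : Fin N => Set.Icc (0:ℝ) 1) :=
    MeasurableSet.univ_pi fun _ => measurableSet_Icc
  have hm2 : Measurable ((Set.pi Set.univ fun _ : Fin N => Set.Icc (0:ℝ) 1).indicator (fun _ => (1 : ℝ≥0∞))) :=
    measurable_const.indicator hms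
  have hA : Measurable (Ah N) := (hm1.comp (by fun_prop)).mul (hm2.comp (by fun_prop))
  rw [← (PiLp.volume_preserving_toLp (Fin (N + 1))).lintegral_comp hA]
  have hv := (volume_preserving_piFinSuccAbove (fun _ : Fin (N + 1) => ℝ) 0)
  have hf : Measurable fun p : ℝ × (Fin N → ℝ) =>
      (Ioi (0:ℝ)).indicator (fun a => ENNReal.ofReal (Real.exp (-a / 2))) p.1 *
      (Set.pi Set.univ fun _ : Fin N => Set.Icc (0:ℝ) 1).indicator (fun _ => (1 : ℝ≥0∞)) p.2 :=
    (hm1.comp measurable_fst).mul (hm2.comp measurable_snd)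
  have h := hv.lintegral_comp hf
  refine (Eq.trans ?_ h).trans ?_
  · rfl
  · rw [show (volume : Measure (ℝ × (Fin N → ℝ))) = volume.prod volume from rfl]
    rw [lintegral_prod_mul hm1.aemeasurable hm2.aemeasurable, kr_exp_int, lintegral_indicator_const hms, volume_pi_pi]
    simp

theorem Th_Ah (N : ℕ) (t : PE N × PE N) : Th N t = Ah N t.1 * Ah N t.2 := by
  unfold Th th0 thc Ah
  have h1 : ((pk N).symm t).1 = (t.1 0, t.2 0) := rfl
  have h2 : ((pk N).symm t).2 = Sum.elim (fun k => t.1 k.succ) (fun k => t.2 k.succ) := rfl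
  rw [h1, h2]
  have h3 : ∀ (x y : Fin N → ℝ), (Sum.elim x y) ∈ (Set.pi Set.univ fun _ : Fin N ⊕ Fin N => Set.Icc (0:ℝ) 1) ↔
      x ∈ (Set.pi Set.univ fun _ : Fin N => Set.Icc (0:ℝ) 1) ∧ y ∈ (Set.pi Set.univ fun _ : Fin N => Set.Icc (0:ℝ) 1) := by
    intro x y
    simp only [Set.mem_pi, Set.mem_univ, true_implies, Sum.forall, Sum.elim_inl, Sum.elim_inr]
  have h4 : ENNReal.ofReal (Real.exp (-(t.1 0 + t.2 0) / 2)) =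
      ENNReal.ofReal (Real.exp (-t.1 0 / 2)) * ENNReal.ofReal (Real.exp (-t.2 0 / 2)) := by
    rw [← ENNReal.ofReal_mul (by positivity), ← Real.exp_add]; congr 2; ring
  generalize (fun k : Fin N => t.1 k.succ) = x at *
  generalize (fun k : Fin N => t.2 k.succ) = y at *
  generalize (Set.pi Set.univ fun _ : Fin N ⊕ Fin N => Set.Icc (0:ℝ) 1) = S2 at *
  generalize (Set.pi Set.univ fun _ : Fin N => Set.Icc (0:ℝ) 1) = S1 at *
  have h5 : S2.indicator (fun _ => (1 : ℝ≥0∞)) (Sum.elim x y) =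
      S1.indicator (fun _ => (1 : ℝ≥0∞)) x * S1.indicator (fun _ => (1 : ℝ≥0∞)) y := by
    have h3 := h3 x y
    by_cases hx : x ∈ S1
    · by_cases hy : y ∈ S1
      · rw [Set.indicator_of_mem (h3.2 ⟨hx, hy⟩), Set.indicator_of_mem hx, Set.indicator_of_mem hy, one_mul]
      · rw [Set.indicator_of_notMem (fun h => hy (h3.1 h).2), Set.indicator_of_notMem hy, mul_zero]
    · rw [Set.indicator_of_notMem (fun h => hx (h3.1 h).1), Set.indicator_of_notMem hx, zero_mul]
  rw [h5]
  simp only [Set.indicator_apply (s := Ioi (0:ℝ)), Set.indicator_apply (s := {p : ℝ × ℝ | 0 < p.1 ∧ 0 < p.2}), mem_Ioi, Set.mem_ofPred_eq]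
  rw [h4]
  by_cases ha : 0 < t.1 0
  · by_cases hb : 0 < t.2 0
    · simp only [ha, hb, and_self, if_true]; ring
    · simp [hb]
  · simp [ha]

theorem Th_int (N : ℕ) : ∫⁻ t, Th N t = 4 := by
  have hm1 : Measurable ((Ioi (0:ℝ)).indicator (fun a => ENNReal.ofReal (Real.exp (-a / 2)))) :=
    Measurable.indicator (by fun_prop) measurableSet_Ioi
  have hms : MeasurableSet (Set.pi Set.univ fun _ : Fin N => Set.Icc (0:ℝ) 1) :=
    MeasurableSet.univ_pi fun _ => measurableSet_Icc
  have hm2 : Measurable ((Set.pi Set.univ fun _ : Fin N => Set.Icc (0:ℝ) 1).indicator (fun _ => (1 : ℝ≥0∞))) :=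
    measurable_const.indicator hms
  have hA : Measurable (Ah N) := (hm1.comp (by fun_prop)).mul (hm2.comp (by fun_prop))
  simp_rw [Th_Ah]
  rw [show (volume : Measure (PE N × PE N)) = volume.prod volume from rfl,
    lintegral_prod_mul hA.aemeasurable hA.aemeasurable, Ah_int]
  norm_num

theorem kr_ord_sc {N : ℕ} {I : Set ℝ} (hI : I.OrdConnected) :
    IsSigmaCompact {z : PE N × PE N | |⟪z.1, z.2⟫| < ‖z.1‖ * ‖z.2‖ ∧ ⟪z.1, z.2⟫ / (‖z.1‖ * ‖z.2‖) ∈ I} := by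
  let U : Set (PE N × PE N) := {z | |⟪z.1, z.2⟫| < ‖z.1‖ * ‖z.2‖}
  have hU : IsOpen U := isOpen_lt (by fun_prop) (by fun_prop)
  have hf : ContinuousOn (fun z : PE N × PE N => ⟪z.1, z.2⟫ / (‖z.1‖ * ‖z.2‖)) U := by
    refine ContinuousOn.div (by fun_prop) (by fun_prop) fun z hz => ?_
    exact (lt_of_le_of_lt (abs_nonneg _) hz).ne'
  let u := ⋃ (x ∈ I) (y ∈ I), Ioo x y
  have huopen : IsOpen u := isOpen_biUnion fun _ _ => isOpen_biUnion fun _ _ => isOpen_Ioo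
  have hfinite : (I \ u).Finite := I.finite_sdiff_iUnion_Ioo
  have hsub : u ⊆ I := iUnion₂_subset fun x hx => iUnion₂_subset fun y hy =>
    Ioo_subset_Icc_self.trans (hI.out hx hy)
  have h1 : IsSigmaCompact (U ∩ (fun z : PE N × PE N => ⟪z.1, z.2⟫ / (‖z.1‖ * ‖z.2‖)) ⁻¹' u) :=
    open_sigmaCompact (hf.isOpen_inter_preimage hU huopen)
  have h2 : IsSigmaCompact (U ∩ (fun z : PE N × PE N => ⟪z.1, z.2⟫ / (‖z.1‖ * ‖z.2‖)) ⁻¹' (I \ u)) := by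
    obtain ⟨K, hK, hKU⟩ := open_sigmaCompact hU
    rw [← hKU, iUnion_inter]
    refine isSigmaCompact_iUnion _ fun n => IsCompact.isSigmaCompact ?_
    refine (hK n).of_isClosed_subset ?_ inter_subset_left
    exact (hf.mono (hKU ▸ subset_iUnion K n)).preimage_isClosed_of_isClosed (hK n).isClosed hfinite.isClosed
  have h3 : {z : PE N × PE N | |⟪z.1, z.2⟫| < ‖z.1‖ * ‖z.2‖ ∧ ⟪z.1, z.2⟫ / (‖z.1‖ * ‖z.2‖) ∈ I} =
      ⋃ b : Bool, cond b (U ∩ (fun z : PE N × PE N => ⟪z.1, z.2⟫ / (‖z.1‖ * ‖z.2‖)) ⁻¹' u)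
        (U ∩ (fun z : PE N × PE N => ⟪z.1, z.2⟫ / (‖z.1‖ * ‖z.2‖)) ⁻¹' (I \ u)) := by
    rw [← union_eq_iUnion, ← inter_union_distrib_left, ← preimage_union, union_sdiff_cancel hsub]
    rfl
  rw [h3]
  refine isSigmaCompact_iUnion _ fun b => ?_
  cases b
  · exact h2
  · exact h1

theorem kr_main {n : ℕ} {V : Type*} [NormedAddCommGroup V] [InnerProductSpace ℝ V]
    [FiniteDimensional ℝ V] [MeasurableSpace V] [BorelSpace V]
    {d : Fin (n + 1) → ℕ} {m : Fin (n + 1) → PE (n + 1) → V} (F : FeatSys d m)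
    (hom : ∀ k (c : ℝ) x, m k (c • x) = c ^ d k • m k x)
    (I : Set ℝ) (hI : I.OrdConnected) (hI1 : I ⊆ Ioo (-1) 1) (S : ℝ) (hS : ∀ r ∈ I, hfun d r ≤ S)
    (hS0 : 0 ≤ S) :
    ∫⁻ g : V, gd g * Measure.count {z : PE (n + 1) × PE (n + 1) | ‖z.1‖ = 1 ∧ ‖z.2‖ = 1 ∧ ⟪z.1, z.2⟫ ∈ I ∧
      ∀ k, ⟪m k z.1, g⟫ = 0 ∧ ⟪m k z.2, g⟫ = 0} ≤ ENNReal.ofReal (2 * Real.pi * S) := by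
  set C : Set (PE (n + 1) × PE (n + 1)) :=
    {z | |⟪z.1, z.2⟫| < ‖z.1‖ * ‖z.2‖ ∧ ⟪z.1, z.2⟫ / (‖z.1‖ * ‖z.2‖) ∈ I} with hCdef
  have hC : IsSigmaCompact C := kr_ord_sc hI
  have hcov := kr_cover F C hC (fun z hz => hz.1)
  have hR : ∫⁻ z in C, ENNReal.ofReal (dens d z) ≤ ENNReal.ofReal (8 * Real.pi) * ENNReal.ofReal S := by
    rw [← kern_int n]
    calc _ ≤ ∫⁻ z in C, ENNReal.ofReal (4 * n.factorial * (2 * Real.pi) ^ (-((n : ℝ) + 1))) *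
          ENNReal.ofReal (kern n z) * ENNReal.ofReal S := by
          refine setLIntegral_mono' (sc_measurable hC) fun z hz => ?_
          have hk : 0 ≤ kern n z := by unfold kern; positivity
          rw [dens_eq d F.two_le z hz.1, ENNReal.ofReal_mul (by positivity), ENNReal.ofReal_mul (by positivity)]
          gcongr
          exact hS _ hz.2
      _ ≤ ∫⁻ z, ENNReal.ofReal (4 * n.factorial * (2 * Real.pi) ^ (-((n : ℝ) + 1))) *
          ENNReal.ofReal (kern n z) * ENNReal.ofReal S := setLIntegral_le_lintegral _ _
      _ = _ := by
          have hkm := (kern_measurable n).ennreal_ofReal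
          rw [lintegral_mul_const _ (hkm.const_mul _), lintegral_const_mul _ hkm]
  have hL : ∀ g : V, 4 * (gd g * Measure.count {z : PE (n + 1) × PE (n + 1) | ‖z.1‖ = 1 ∧ ‖z.2‖ = 1 ∧ ⟪z.1, z.2⟫ ∈ I ∧
      ∀ k, ⟪m k z.1, g⟫ = 0 ∧ ⟪m k z.2, g⟫ = 0}) ≤
      ∫⁻ t, gd g * (Th (n + 1) t * Measure.count {z | z ∈ C ∧ Phi m g z = tau (n + 1) t}) := by
    intro g
    set B := {z : PE (n + 1) × PE (n + 1) | ‖z.1‖ = 1 ∧ ‖z.2‖ = 1 ∧ ⟪z.1, z.2⟫ ∈ I ∧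
      ∀ k, ⟪m k z.1, g⟫ = 0 ∧ ⟪m k z.2, g⟫ = 0} with hB
    have : 4 * (gd g * Measure.count B) = ∫⁻ t, gd g * (Th (n + 1) t * Measure.count B) := by
      rw [lintegral_const_mul _ ((Th_measurable _).mul_const _), lintegral_mul_const _ (Th_measurable _), Th_int]
      ring
    rw [this]
    refine lintegral_mono fun t => ?_
    dsimp only
    obtain ⟨⟨⟨a, b⟩, c⟩, rfl⟩ := (pk (n + 1)).surjective t
    rw [Th_eq, tau, LinearEquiv.symm_apply_apply]
    by_cases hab : 0 < a ∧ 0 < b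
    swap
    · have : th0 (a, b) = 0 := Set.indicator_of_notMem (s := {p : ℝ × ℝ | 0 < p.1 ∧ 0 < p.2}) (a := (a, b)) hab _
      simp [this]
    obtain ⟨ha, hb⟩ := hab
    refine mul_le_mul' le_rfl (mul_le_mul' le_rfl ?_)
    have hsa : 0 < Real.sqrt a := Real.sqrt_pos.2 ha
    have hsb : 0 < Real.sqrt b := Real.sqrt_pos.2 hb
    let f : PE (n + 1) × PE (n + 1) → PE (n + 1) × PE (n + 1) := fun z => (Real.sqrt a • z.1, Real.sqrt b • z.2)
    have hf : Function.Injective f := by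
      intro z z' h
      have h1 := (Prod.ext_iff.1 h).1
      have h2 := (Prod.ext_iff.1 h).2
      exact Prod.ext (smul_right_injective _ hsa.ne' h1) (smul_right_injective _ hsb.ne' h2)
    rw [← Measure.count_injective_image hf B]
    refine measure_mono ?_
    rintro _ ⟨z, ⟨hz1, hz2, hzI, hz⟩, rfl⟩
    have hin := hI1 hzI
    have hn1 : ‖Real.sqrt a • z.1‖ = Real.sqrt a := by rw [norm_smul, hz1, mul_one, Real.norm_of_nonneg hsa.le]
    have hn2 : ‖Real.sqrt b • z.2‖ = Real.sqrt b := by rw [norm_smul, hz2, mul_one, Real.norm_of_nonneg hsb.le]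
    have hii : ⟪Real.sqrt a • z.1, Real.sqrt b • z.2⟫ = Real.sqrt a * Real.sqrt b * ⟪z.1, z.2⟫ := by
      rw [real_inner_smul_left, real_inner_smul_right]; ring
    refine ⟨⟨?_, ?_⟩, ?_⟩
    · simp only [f]
      rw [hn1, hn2, hii, abs_mul, abs_of_pos (by positivity)]
      have : |⟪z.1, z.2⟫| < 1 := abs_lt.2 hin
      exact mul_lt_of_lt_one_right (by positivity) this
    · simp only [f]
      rw [hn1, hn2, hii, mul_div_cancel_left₀ _ (by positivity)]
      exact hzI
    · unfold Phi
      simp only [f]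
      rw [hn1, hn2, Real.sq_sqrt ha.le, Real.sq_sqrt hb.le]
      congr 2
      ext j
      rcases j with k | k
      · simp only [Xf, Sum.elim_inl, hom, real_inner_smul_left, (hz k).1, mul_zero, Pi.zero_apply]
      · simp only [Xf, Sum.elim_inr, hom, real_inner_smul_left, (hz k).2, mul_zero, Pi.zero_apply]
  have hfin : 4 * ∫⁻ g : V, gd g * Measure.count {z : PE (n + 1) × PE (n + 1) | ‖z.1‖ = 1 ∧ ‖z.2‖ = 1 ∧ ⟪z.1, z.2⟫ ∈ I ∧
      ∀ k, ⟪m k z.1, g⟫ = 0 ∧ ⟪m k z.2, g⟫ = 0} ≤ 4 * ENNReal.ofReal (2 * Real.pi * S) := by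
    rw [← lintegral_const_mul' _ _ (by norm_num)]
    refine ((lintegral_mono hL).trans (hcov.trans hR)).trans (le_of_eq ?_)
    rw [← ENNReal.ofReal_mul (by positivity), show (4 : ℝ≥0∞) = ENNReal.ofReal 4 by norm_num,
      ← ENNReal.ofReal_mul (by positivity)]
    congr 1; ring
  exact (ENNReal.mul_le_mul_iff_right (by norm_num) (by norm_num)).1 hfin

end

section
open Set
open scoped RealInnerProductSpace

theorem kr_hom_coef {N : ℕ} {d : Fin N → ℕ} {a : Fin N → ℕ → ℝ}
    (h0 : ∀ k p, p < d k → a k p = 0) (k : Fin N) (p : {p : Fin (d k + 1) // 2 ≤ (p : ℕ)})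
    (hp : (p.1 : ℕ) ≠ d k) : a k p.1 = 0 := h0 k _ (lt_of_le_of_ne (Nat.lt_succ_iff.1 p.1.2) hp)

/-- feature map -/
def fm (N : ℕ) (d : Fin N → ℕ) (a : Fin N → ℕ → ℝ) (k : Fin N) (x : PE N) :
    EuclideanSpace ℝ (GIdx N N d) :=
  WithLp.toLp 2 fun s => if s.1 = k then a s.1 (s.2.1.1 : ℕ) * ∏ j, x (s.2.2 j) else 0

theorem fm_sum {N : ℕ} {d : Fin N → ℕ} (k : Fin N) (f : GIdx N N d → ℝ) :
    ∑ s : GIdx N N d, (if s.1 = k then f s else 0) =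
      ∑ p : {p : Fin (d k + 1) // 2 ≤ (p : ℕ)}, ∑ i : Fin (p.1 : ℕ) → Fin (N + 1), f ⟨k, p, i⟩ := by
  rw [Fintype.sum_sigma, Fintype.sum_eq_single k]
  · simp [Fintype.sum_sigma]
  · intro k' hk'
    simp [hk']

theorem fm_rf {N : ℕ} {d : Fin N → ℕ} {a : Fin N → ℕ → ℝ} (k : Fin N) (x : PE N)
    (g : GIdx N N d → ℝ) : rf N N d a k g (fun i => x i) = ⟪fm N d a k x, WithLp.toLp 2 g⟫ := by
  rw [PiLp.inner_apply]
  simp only [fm, RCLike.inner_apply, conj_trivial, mul_ite, mul_zero]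
  rw [fm_sum k (fun s => g s * (a s.1 (s.2.1.1 : ℕ) * ∏ j, x (s.2.2 j)))]
  unfold rf
  refine Finset.sum_congr rfl fun p _ => ?_
  rw [Finset.mul_sum]
  refine Finset.sum_congr rfl fun i _ => ?_
  ring

theorem fm_inner {N : ℕ} {d : Fin N → ℕ} {a : Fin N → ℕ → ℝ} (h2 : ∀ k, 2 ≤ d k)
    (h0 : ∀ k p, p < d k → a k p = 0) (h1 : ∀ k, a k (d k) = 1) (k l : Fin N) (x y : PE N) :
    ⟪fm N d a k x, fm N d a l y⟫ = if k = l then ⟪x, y⟫ ^ (d k) else 0 := by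
  rw [← WithLp.toLp_ofLp (p := 2) (fm N d a l y), ← fm_rf]
  unfold rf
  rw [Fintype.sum_eq_single (⟨Fin.last (d k), by simpa using h2 k⟩ : {p : Fin (d k + 1) // 2 ≤ (p : ℕ)})]
  · by_cases hkl : k = l
    · subst hkl
      simp only [fm, if_true, Fin.val_last, h1, one_mul]
      rw [PiLp.inner_apply, Fintype.sum_pow]
      refine Finset.sum_congr rfl fun i _ => ?_
      rw [← Finset.prod_mul_distrib]
      rfl
    · simp [fm, hkl]
  · intro p hp
    rw [kr_hom_coef h0 k p, zero_mul]
    intro h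
    exact hp (Subtype.ext (Fin.ext h))

theorem fm_feat {N : ℕ} {d : Fin N → ℕ} {a : Fin N → ℕ → ℝ} (h2 : ∀ k, 2 ≤ d k)
    (h0 : ∀ k p, p < d k → a k p = 0) (h1 : ∀ k, a k (d k) = 1) : FeatSys d (fm N d a) where
  inner_eq := fm_inner h2 h0 h1
  smooth k := by
    rw [contDiff_euclidean]
    intro s
    by_cases hs : s.1 = k
    · simp only [fm, hs, if_true]
      refine contDiff_const.mul (contDiff_prod fun j _ => ?_)
      fun_prop
    · simp only [fm, hs, if_false]
      exact contDiff_const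
  two_le := h2

theorem fm_hom {N : ℕ} {d : Fin N → ℕ} {a : Fin N → ℕ → ℝ}
    (h0 : ∀ k p, p < d k → a k p = 0) (k : Fin N) (c : ℝ) (x : PE N) :
    fm N d a k (c • x) = c ^ d k • fm N d a k x := by
  ext s
  simp only [fm, PiLp.smul_apply, smul_eq_mul]
  by_cases hs : s.1 = k
  · subst hs
    simp only [if_true]
    by_cases hp : (s.2.1.1 : ℕ) = d s.1
    · rw [Finset.prod_mul_distrib, Finset.prod_const, Finset.card_univ, Fintype.card_fin]
      rw [show c ^ (s.2.1.1 : ℕ) = c ^ d s.1 by rw [hp]]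
      ring
    · rw [kr_hom_coef h0 s.1 s.2.1 hp]; simp
  · simp [hs]

theorem xi_hom {d : ℕ} {a : ℕ → ℝ} (h2 : 2 ≤ d) (h0 : ∀ p, p < d → a p = 0) (h1 : a d = 1) :
    xi d a = fun t => t ^ d := by
  ext t
  unfold xi
  rw [Finset.sum_eq_single d]
  · simp [h1]
  · intro p hp hpd
    rw [h0 p (lt_of_le_of_ne (Finset.mem_Icc.1 hp).2 hpd)]; simp
  · intro h; exact absurd (Finset.mem_Icc.2 ⟨h2, le_rfl⟩) h

theorem xi'_hom {d : ℕ} {a : ℕ → ℝ} (h2 : 2 ≤ d) (h0 : ∀ p, p < d → a p = 0) (h1 : a d = 1) :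
    xi' d a 1 = d := by
  unfold xi'
  rw [xi_hom h2 h0 h1]
  simp

theorem hfun_nonneg {n : ℕ} (d : Fin (n + 1) → ℕ) (r : ℝ) : 0 ≤ hfun d r := by
  unfold hfun; positivity

theorem hfun_le {n : ℕ} (d : Fin (n + 1) → ℕ) (h2 : ∀ k, 2 ≤ d k) {r : ℝ} (hr : r ∈ Ioo (-1 : ℝ) 1) :
    hfun d r ≤ ∑ j, (d j : ℝ) * ∏ k ∈ Finset.univ.erase j, (d k : ℝ) := by
  unfold hfun
  have hr2 : r ^ 2 < 1 := by rw [sq_lt_one_iff_abs_lt_one]; exact abs_lt.2 hr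
  refine Finset.sum_le_sum fun j _ => mul_le_mul_of_nonneg_left ?_ (by positivity)
  refine Finset.prod_le_prod (fun _ _ => by positivity) fun k _ => ?_
  have h3 : (r ^ d k) ^ 2 ≤ r ^ 2 := by
    rw [← pow_mul, mul_comm, pow_mul]
    exact pow_le_of_le_one (sq_nonneg r) hr2.le (by have := h2 k; omega)
  rw [Real.sqrt_le_left (by positivity), div_le_iff₀ (by linarith)]
  exact mul_le_mul_of_nonneg_left (by linarith) (by positivity)

theorem kr_hausdorff_count (N : ℕ) (S : Set (PairSpace N)) :
    μH[(0 : ℝ)] S ≤ Measure.count ((WithLp.equiv 2 (PE N × PE N)) '' S) := by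
  by_cases hS : S.Finite
  · rw [Measure.count_apply_finite _ (hS.image _)]
    have h := measure_biUnion_finset_le (μ := μH[(0 : ℝ)]) hS.toFinset (fun z : PairSpace N => {z})
    have h1 : (⋃ z ∈ hS.toFinset, ({z} : Set (PairSpace N))) = S := by ext; simp
    rw [h1] at h
    refine h.trans (le_of_eq ?_)
    simp only [Measure.hausdorffMeasure_zero_singleton, Finset.sum_const, nsmul_eq_mul, mul_one]
    congr 1
    rw [← Set.ncard_eq_toFinset_card _ hS, ← Set.ncard_eq_toFinset_card _ (hS.image _), Set.ncard_image_of_injective _ (WithLp.equiv 2 _).injective]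
  · rw [Measure.count_apply_infinite]
    · exact le_top
    · exact fun h => hS (h.of_finite_image (WithLp.equiv 2 _).injective.injOn)

theorem kr_transfer {N : ℕ} {d : Fin N → ℕ} (f : EuclideanSpace ℝ (GIdx N N d) → ℝ≥0∞) :
    ∫⁻ g, f (WithLp.toLp 2 g) ∂(GaussP N N d) = ∫⁻ g, gd g * f g := by
  have h1 := lintegral_map_equiv (μ := GaussP N N d) f (MeasurableEquiv.toLp 2 (GIdx N N d → ℝ))
  have h2 : (GaussP N N d).map (MeasurableEquiv.toLp 2 (GIdx N N d → ℝ)) = stdGaussian (EuclideanSpace ℝ (GIdx N N d)) :=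
    map_pi_eq_stdGaussian
  rw [h2, kr_stdGaussian] at h1
  refine Eq.trans h1.symm ?_
  rw [lintegral_withDensity_eq_lintegral_mul_non_measurable _ gd_measurable]
  · rfl
  · exact Filter.Eventually.of_forall fun x => by unfold gd; exact ENNReal.ofReal_lt_top

theorem kr_final {N : ℕ} (hN : 1 ≤ N) (d : Fin N → ℕ) (a : Fin N → ℕ → ℝ) (h2 : ∀ k, 2 ≤ d k)
    (h0 : ∀ k p, p < d k → a k p = 0) (h1 : ∀ k, a k (d k) = 1) (I : Set ℝ) (hI : I.OrdConnected)
    (hI1 : I ⊆ Set.Ioo (-1) 1) :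
        ∫⁻ g, Znk2 N N d a g I ∂(GaussP N N d)
          ≤ ENNReal.ofReal (2 * Real.pi *
              sSup ((fun r => ∑ j, xi' (d j) (a j) 1 / xi (d j) (a j) 1 *
                ∏ k ∈ Finset.univ.erase j,
                  Real.sqrt (xi' (d k) (a k) 1 ^ 2 * (1 - r ^ 2) /
                    (xi (d k) (a k) 1 ^ 2 - xi (d k) (a k) r ^ 2))) '' I)) := by
  obtain ⟨n, rfl⟩ : ∃ n, N = n + 1 := ⟨N - 1, by omega⟩
  have hx : ∀ k, xi (d k) (a k) = fun t => t ^ d k := fun k => xi_hom (h2 k) (h0 k) (h1 k)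
  have hx' : ∀ k, xi' (d k) (a k) 1 = d k := fun k => xi'_hom (h2 k) (h0 k) (h1 k)
  have hh : (fun r => ∑ j, xi' (d j) (a j) 1 / xi (d j) (a j) 1 *
                ∏ k ∈ Finset.univ.erase j,
                  Real.sqrt (xi' (d k) (a k) 1 ^ 2 * (1 - r ^ 2) /
                    (xi (d k) (a k) 1 ^ 2 - xi (d k) (a k) r ^ 2))) = hfun d := by
    ext r
    simp only [hx, hx', one_pow, div_one, hfun]
  rw [hh]
  refine le_trans (lintegral_mono fun g => ?_)
    ((kr_transfer _).le.trans (kr_main (fm_feat h2 h0 h1) (fm_hom h0) I hI hI1 _ ?_ ?_))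
  · unfold Znk2
    rw [sub_self, mul_zero]
    refine (kr_hausdorff_count _ _).trans (measure_mono ?_)
    rintro _ ⟨z, ⟨hz1, hz2, hz3, hz4⟩, rfl⟩
    refine ⟨hz1, hz2, ?_, fun k => ?_⟩
    · rw [PiLp.inner_apply]
      have he : ∀ u v : PE (n + 1), ∑ i, ⟪u i, v i⟫ = ∑ i, u i * v i := fun u v =>
        Finset.sum_congr rfl fun i _ => mul_comm _ _
      rw [he]
      exact hz3
    · rw [← fm_rf, ← fm_rf]
      exact hz4 k
  · intro r hr
    refine le_csSup ⟨∑ j, (d j : ℝ) * ∏ k ∈ Finset.univ.erase j, (d k : ℝ), ?_⟩ ⟨r, hr, rfl⟩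
    rintro _ ⟨s, hs, rfl⟩
    exact hfun_le d h2 (hI1 hs)
  · refine Real.sSup_nonneg ?_
    rintro _ ⟨s, hs, rfl⟩
    exact hfun_nonneg d s

end

/-- **Corollary 7 (homogeneous systems, `K = N`).**
There is a universal `c' > 0` such that for every `N ≥ 1`, every homogeneous system with
`K = N` (`ξ_k(t) = t^{d_k}`) and every interval `I ⊆ (−1,1)`,
`E[𝒵²_{N,N}(g, I)] ≤ c' sup_{r∈I} ∑_j (ξ_j'(1)/ξ_j(1)) ∏_{k≠j}
  (ξ_k'(1)²(1−r²)/(ξ_k(1)²−ξ_k(r)²))^{1/2}`. -/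
theorem stmt8 :
    ∃ c' : ℝ, 0 < c' ∧ ∀ N : ℕ, 1 ≤ N →
      ∀ (d : Fin N → ℕ) (a : Fin N → ℕ → ℝ),
        (∀ k, 2 ≤ d k) →
        (∀ k p, p < d k → a k p = 0) → (∀ k, a k (d k) = 1) →
        ∀ I : Set ℝ, I.OrdConnected → I ⊆ Set.Ioo (-1) 1 →
        ∫⁻ g, Znk2 N N d a g I ∂(GaussP N N d)
          ≤ ENNReal.ofReal (c' *
              sSup ((fun r => ∑ j, xi' (d j) (a j) 1 / xi (d j) (a j) 1 *
                ∏ k ∈ Finset.univ.erase j,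
                  Real.sqrt (xi' (d k) (a k) 1 ^ 2 * (1 - r ^ 2) /
                    (xi (d k) (a k) 1 ^ 2 - xi (d k) (a k) r ^ 2))) '' I)) := by
  refine ⟨2 * Real.pi, by positivity, ?_⟩
  intro N hN d a h2 h0 h1 I hI hI1
  exact kr_final hN d a h2 h0 h1 I hI hI1

end
end

section
/- Let N ≥ 1, let 0 < ε < 1/4, and let A be a finite subset of the unit sphere of ℝ^{N+1}. Then the number of ordered pairs (x,y) ∈ A×A with ⟨x,y⟩ ≤ −1+ε is at most twice the number of ordered pairs (x,y) ∈ A×A with ⟨x,y⟩ ≥ 1−4ε. -/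
theorem pairs_aux {α : Type*} [DecidableEq α] (A : Finset α) (F R : α → α → Prop)
    [DecidableRel F] [DecidableRel R] (hs : ∀ x y, F x y → F y x)
    (h : ∀ x ∈ A, ∀ y ∈ A, ∀ z ∈ A, F x z → F y z → R x y) :
    ((A ×ˢ A).filter fun p => F p.1 p.2).card
      ≤ 2 * ((A ×ˢ A).filter fun p => R p.1 p.2).card := by
  classical
  set d : α → ℕ := fun x => (A.filter (F x)).card with hd
  set Q := (A ×ˢ A).filter fun p => F p.1 p.2 ∧ d p.1 ≤ d p.2 with hQ
  have h1 : ((A ×ˢ A).filter fun p => F p.1 p.2) ⊆ Q ∪ Q.image Prod.swap := by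
    rintro ⟨x, y⟩ hp
    simp only [Finset.mem_filter, Finset.mem_product] at hp
    rw [Finset.mem_union]
    rcases le_total (d x) (d y) with hl | hl
    · left
      simp only [hQ, Finset.mem_filter, Finset.mem_product]
      exact ⟨hp.1, hp.2, hl⟩
    · right
      refine Finset.mem_image.2 ⟨(y, x), ?_, rfl⟩
      simp only [hQ, Finset.mem_filter, Finset.mem_product]
      exact ⟨⟨hp.1.2, hp.1.1⟩, hs _ _ hp.2, hl⟩
  have h2 : Q.card ≤ ((A ×ˢ A).filter fun p => R p.1 p.2).card := by
    rw [hQ, Finset.card_filter, Finset.card_filter, Finset.sum_product, Finset.sum_product]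
    refine Finset.sum_le_sum fun x hx => ?_
    simp only
    rw [← Finset.card_filter, ← Finset.card_filter]
    rcases (A.filter fun y => F x y ∧ d x ≤ d y).eq_empty_or_nonempty with he | ⟨y, hy⟩
    · rw [he]; simp
    · simp only [Finset.mem_filter] at hy
      calc (A.filter fun y => F x y ∧ d x ≤ d y).card ≤ d x :=
            Finset.card_le_card (Finset.monotone_filter_right A fun _ _ hz => hz.1)
        _ ≤ d y := hy.2.2
        _ ≤ _ := by
            refine Finset.card_le_card fun w hw => ?_
            simp only [Finset.mem_filter] at hw ⊢
            exact ⟨hw.1, h x hx w hw.1 y hy.1 hy.2.1 (hs _ _ hw.2)⟩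
  have h3 := Finset.card_le_card h1
  have h4 := Finset.card_union_le Q (Q.image Prod.swap)
  have h5 : (Q.image Prod.swap).card ≤ Q.card := Finset.card_image_le
  omega

/-- **Lemma 8 (negative inner products).**
Let `0 < ε < 1/4` and let `A` be a finite subset of the unit sphere of `ℝ^{N+1}`.
Then the number of ordered pairs `(x, y) ∈ A × A` with `⟨x,y⟩ ≤ −1+ε` is at most twice
the number of ordered pairs `(x, y) ∈ A × A` with `⟨x,y⟩ ≥ 1−4ε`. -/
theorem stmt9 (N : ℕ) (hN : 1 ≤ N) (ε : ℝ) (hε : 0 < ε) (hε4 : ε < 1 / 4)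
    (A : Set (EuclideanSpace ℝ (Fin (N + 1)))) (hA : A.Finite)
    (hsphere : ∀ x ∈ A, ‖x‖ = 1) :
    Set.ncard {p : EuclideanSpace ℝ (Fin (N + 1)) × EuclideanSpace ℝ (Fin (N + 1)) |
        p.1 ∈ A ∧ p.2 ∈ A ∧ (∑ i, p.1 i * p.2 i) ≤ -1 + ε}
      ≤ 2 * Set.ncard {p : EuclideanSpace ℝ (Fin (N + 1)) × EuclideanSpace ℝ (Fin (N + 1)) |
        p.1 ∈ A ∧ p.2 ∈ A ∧ 1 - 4 * ε ≤ ∑ i, p.1 i * p.2 i} := by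
  classical
  have hn : ∀ x ∈ A, ∑ i, x i * x i = 1 := by
    intro x hx
    have h := EuclideanSpace.norm_sq_eq x
    rw [hsphere x hx] at h
    simp only [Real.norm_eq_abs, sq_abs] at h
    simp only [← sq]
    linarith
  have key := pairs_aux hA.toFinset
    (fun x y : EuclideanSpace ℝ (Fin (N + 1)) => ∑ i, x i * y i ≤ -1 + ε)
    (fun x y => 1 - 4 * ε ≤ ∑ i, x i * y i)
    (fun x y h => by simpa only [mul_comm] using h)
    (by
      intro x hx y hy z hz h1 h2
      rw [Set.Finite.mem_toFinset] at hx hy hz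
      have h0 : 0 ≤ ∑ i, (x i + y i + 2 * z i) ^ 2 := Finset.sum_nonneg fun i _ => sq_nonneg _
      have e : ∑ i, (x i + y i + 2 * z i) ^ 2 = ∑ i, x i * x i + ∑ i, y i * y i
          + 4 * ∑ i, z i * z i + 2 * ∑ i, x i * y i + 4 * ∑ i, x i * z i
          + 4 * ∑ i, y i * z i := by
        simp only [Finset.mul_sum, ← Finset.sum_add_distrib]
        exact Finset.sum_congr rfl fun i _ => by ring
      rw [e, hn x hx, hn y hy, hn z hz] at h0
      linarith)
  rw [← Set.ncard_coe_finset, ← Set.ncard_coe_finset] at key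
  convert key using 3
  · ext p; simp [and_assoc]
  · congr 1; ext p; simp [and_assoc]
end

section
/- For all x, y, v, w ∈ ℝ^{N+1}: (i) ∫ D_v f(g,x)·f(g,y) dP(g) = ξ'(⟨x,y⟩)·⟨v,y⟩, and (ii) ∫ D_v f(g,x)·D_w f(g,y) dP(g) = ξ'(⟨x,y⟩)·⟨v,w⟩ + ξ''(⟨x,y⟩)·⟨v,y⟩·⟨w,x⟩. -/
open MeasureTheory ProbabilityTheory

noncomputable section

/-- Index pairs `(p, i)` with `2 ≤ p ≤ d`, `i ∈ {0,…,N}^p`. -/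
abbrev GIdx1 (N d : ℕ) : Type :=
  (p : {p : Fin (d + 1) // 2 ≤ (p : ℕ)}) × (Fin (p.1 : ℕ) → Fin (N + 1))

/-- The product of standard Gaussian measures over the index set of pairs. -/
abbrev GaussP1 (N d : ℕ) : Measure (GIdx1 N d → ℝ) :=
  Measure.pi fun _ => gaussianReal 0 1

/-- The random polynomial `f(g, x) = ∑_{p=2}^{d} a_p ∑_i g_{p,i} x_{i₁} ⋯ x_{i_p}`. -/
def rf1 (N d : ℕ) (a : ℕ → ℝ) (g : GIdx1 N d → ℝ) (x : Fin (N + 1) → ℝ) : ℝ :=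
  ∑ p : {p : Fin (d + 1) // 2 ≤ (p : ℕ)},
    a (p.1 : ℕ) * ∑ i : Fin (p.1 : ℕ) → Fin (N + 1), g ⟨p, i⟩ * ∏ j, x (i j)

/-- `ξ''`, the second derivative of `ξ`. -/
def xi'' (d : ℕ) (a : ℕ → ℝ) : ℝ → ℝ := deriv (deriv (xi d a))
/-- Second moments of independent standard Gaussians. -/
lemma gauss_moment {ι : Type*} [Fintype ι] [DecidableEq ι] (k l : ι) :
    Integrable (fun g : ι → ℝ => g k * g l) (Measure.pi fun _ : ι => gaussianReal 0 1) ∧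
    ∫ g : ι → ℝ, g k * g l ∂(Measure.pi fun _ : ι => gaussianReal 0 1)
      = if k = l then 1 else 0 := by
  have hm : ∀ k : ι, MemLp (fun g : ι → ℝ => g k) 2
      (Measure.pi fun _ : ι => gaussianReal 0 1) := fun k =>
    (memLp_id_gaussianReal' (μ := 0) (v := 1) 2 (by simp)).comp_measurePreserving
      (measurePreserving_eval (fun _ : ι => gaussianReal 0 1) k)
  refine ⟨(hm k).integrable_mul (hm l), ?_⟩
  have h0 : ∀ k : ι, ∫ g : ι → ℝ, g k ∂(Measure.pi fun _ : ι => gaussianReal 0 1) = 0 := by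
    intro k
    have := integral_comp_eval (μ := fun _ : ι => gaussianReal 0 1) (i := k)
      (f := fun t : ℝ => t) (by fun_prop)
    rw [this]; simp
  split_ifs with h
  · subst h
    have := integral_comp_eval (μ := fun _ : ι => gaussianReal 0 1) (i := k)
      (f := fun t : ℝ => t * t) (by fun_prop)
    rw [this]
    have hv := variance_id_gaussianReal (μ := 0) (v := 1)
    rw [variance_of_integral_eq_zero (by fun_prop) (by simp)] at hv
    simpa [pow_two] using hv
  · have hi := iIndepFun_pi (μ := fun _ : ι => gaussianReal 0 1) (X := fun _ t => t)
      (by intro i; fun_prop)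
    rw [(hi.indepFun h).integral_fun_mul_eq_mul_integral (hm k).1 (hm l).1, h0, h0, zero_mul]

lemma gauss_bilin {ι : Type*} [Fintype ι] (b c : ι → ℝ) :
    ∫ g : ι → ℝ, (∑ k, g k * b k) * (∑ k, g k * c k) ∂(Measure.pi fun _ : ι => gaussianReal 0 1)
      = ∑ k, b k * c k := by
  classical
  have e : ∀ g : ι → ℝ, (∑ k, g k * b k) * (∑ k, g k * c k)
      = ∑ k, ∑ l, (g k * g l) * (b k * c l) := by
    intro g
    rw [Finset.sum_mul_sum]
    exact Finset.sum_congr rfl fun k _ => Finset.sum_congr rfl fun l _ => by ring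
  simp_rw [e]
  rw [integral_finsetSum _ fun k _ => integrable_finsetSum _ fun l _ =>
    (gauss_moment k l).1.mul_const _]
  refine Finset.sum_congr rfl fun k _ => ?_
  rw [integral_finsetSum _ fun l _ => (gauss_moment k l).1.mul_const _]
  simp [integral_mul_const, (gauss_moment k _).2]

/-- Coefficient of `g k` in `f(g, x)`. -/
def cf (N d : ℕ) (a : ℕ → ℝ) (k : GIdx1 N d) (x : Fin (N + 1) → ℝ) : ℝ :=
  a (k.1.1 : ℕ) * ∏ j, x (k.2 j)

lemma rf1_eq (N d : ℕ) (a : ℕ → ℝ) (g : GIdx1 N d → ℝ) :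
    rf1 N d a g = fun x => ∑ k, g k * cf N d a k x := by
  funext x
  rw [Fintype.sum_sigma]
  unfold rf1 cf
  refine Finset.sum_congr rfl fun p _ => ?_
  rw [Finset.mul_sum]
  exact Finset.sum_congr rfl fun i _ => by ring

lemma cf_diff (N d : ℕ) (a : ℕ → ℝ) (k : GIdx1 N d) : Differentiable ℝ (cf N d a k) := by
  unfold cf
  fun_prop

lemma fderiv_comb {ι : Type*} [Fintype ι] {N : ℕ} (g : ι → ℝ)
    (c : ι → (Fin (N + 1) → ℝ) → ℝ)
    (hc : ∀ k, Differentiable ℝ (c k)) (x v : Fin (N + 1) → ℝ) :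
    fderiv ℝ (fun x => ∑ k, g k * c k x) x v = ∑ k, g k * fderiv ℝ (c k) x v := by
  have h : HasFDerivAt (fun x => ∑ k, g k * c k x) (∑ k, g k • fderiv ℝ (c k) x) x :=
    HasFDerivAt.fun_sum fun k _ => ((hc k x).hasFDerivAt).const_mul (g k)
  rw [h.fderiv]
  simp

lemma kernel (N d : ℕ) (a : ℕ → ℝ) (x y : Fin (N + 1) → ℝ) :
    ∑ k, cf N d a k x * cf N d a k y = xi d a (∑ i, x i * y i) := by
  rw [Fintype.sum_sigma]
  unfold xi cf
  have h1 : ∀ p : {p : Fin (d + 1) // 2 ≤ (p : ℕ)},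
      (∑ i : Fin (p.1 : ℕ) → Fin (N + 1),
        (a (p.1 : ℕ) * ∏ j, x (i j)) * (a (p.1 : ℕ) * ∏ j, y (i j)))
      = a (p.1 : ℕ) ^ 2 * (∑ i, x i * y i) ^ (p.1 : ℕ) := by
    intro p
    rw [Fintype.sum_pow, Finset.mul_sum]
    refine Finset.sum_congr rfl fun i _ => ?_
    rw [Finset.prod_mul_distrib]
    ring
  refine (Finset.sum_congr rfl fun p _ => h1 p).trans ?_
  refine Finset.sum_bij (fun p _ => (p.1 : ℕ)) ?_ ?_ ?_ ?_
  · intro p _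
    have := p.1.2
    have := p.2
    simp only [Finset.mem_Icc]
    omega
  · intro p _ q _ h
    exact Subtype.ext (Fin.ext h)
  · intro n hn
    rw [Finset.mem_Icc] at hn
    exact ⟨⟨⟨n, by omega⟩, hn.1⟩, Finset.mem_univ _, rfl⟩
  · intro p _
    rfl

lemma xi_smooth (d : ℕ) (a : ℕ → ℝ) : ContDiff ℝ 2 (xi d a) := by
  unfold xi
  fun_prop

lemma inner_fderiv {N : ℕ} (y x : Fin (N + 1) → ℝ) :
    HasFDerivAt (fun x : Fin (N + 1) → ℝ => ∑ i, x i * y i)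
      (∑ i, y i • (ContinuousLinearMap.proj i : (Fin (N + 1) → ℝ) →L[ℝ] ℝ)) x := by
  refine HasFDerivAt.fun_sum fun i _ => ?_
  exact (hasFDerivAt_apply i x).mul_const (y i)

lemma kernel1 (N d : ℕ) (a : ℕ → ℝ) (x y v : Fin (N + 1) → ℝ) :
    ∑ k, fderiv ℝ (cf N d a k) x v * cf N d a k y
      = xi' d a (∑ i, x i * y i) * (∑ i, v i * y i) := by
  have h := fderiv_comb (fun k => cf N d a k y) (cf N d a) (cf_diff N d a) x v
  simp_rw [mul_comm (fderiv ℝ _ _ _)]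
  rw [← h]
  have e : (fun x => ∑ k, cf N d a k y * cf N d a k x)
      = fun x => xi d a (∑ i, x i * y i) := by
    funext x
    rw [← kernel]
    exact Finset.sum_congr rfl fun k _ => mul_comm _ _
  rw [e]
  have h1 : HasDerivAt (xi d a) (xi' d a (∑ i, x i * y i)) (∑ i, x i * y i) :=
    ((xi_smooth d a).differentiable (by norm_num) _).hasDerivAt
  have h2 := h1.comp_hasFDerivAt x (inner_fderiv y x)
  have h3 : fderiv ℝ (fun x => xi d a (∑ i, x i * y i)) x = _ := h2.fderiv
  rw [h3]
  simp [mul_comm]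

lemma kernel2 (N d : ℕ) (a : ℕ → ℝ) (x y v w : Fin (N + 1) → ℝ) :
    ∑ k, fderiv ℝ (cf N d a k) x v * fderiv ℝ (cf N d a k) y w
      = xi' d a (∑ i, x i * y i) * (∑ i, v i * w i)
          + xi'' d a (∑ i, x i * y i) * (∑ i, v i * y i) * (∑ i, w i * x i) := by
  have h := fderiv_comb (fun k => fderiv ℝ (cf N d a k) x v) (cf N d a) (cf_diff N d a) y w
  rw [← h]
  have e : (fun y => ∑ k, fderiv ℝ (cf N d a k) x v * cf N d a k y)
      = fun y => xi' d a (∑ i, y i * x i) * (∑ i, y i * v i) := by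
    funext y
    rw [kernel1]
    simp_rw [mul_comm]
  rw [e]
  have hd : Differentiable ℝ (xi' d a) := by
    have h2 : ContDiff ℝ (1 + 1) (xi d a) := by
      have := xi_smooth d a
      norm_num
      exact this
    exact ((contDiff_succ_iff_deriv.1 h2).2.2).differentiable (by norm_num)
  have h1 : HasDerivAt (xi' d a) (xi'' d a (∑ i, y i * x i)) (∑ i, y i * x i) :=
    (hd _).hasDerivAt
  have h2 := (h1.comp_hasFDerivAt y (inner_fderiv x y)).mul (inner_fderiv v y)
  have h3 : fderiv ℝ (fun y => xi' d a (∑ i, y i * x i) * (∑ i, y i * v i)) y = _ := h2.fderiv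
  rw [h3]
  have c1 : ∑ i, x i * y i = ∑ i, y i * x i := Finset.sum_congr rfl fun i _ => mul_comm _ _
  have c2 : ∑ i, v i * y i = ∑ i, y i * v i := Finset.sum_congr rfl fun i _ => mul_comm _ _
  have c3 : ∑ i, w i * x i = ∑ i, x i * w i := Finset.sum_congr rfl fun i _ => mul_comm _ _
  rw [c1, c2, c3]
  simp
  ring

/-- **Covariances involving directional derivatives (proof of Lemma 3):**
(i) `E[D_v f(g,x) · f(g,y)] = ξ'(⟨x,y⟩) ⟨v,y⟩`;
(ii) `E[D_v f(g,x) · D_w f(g,y)] = ξ'(⟨x,y⟩) ⟨v,w⟩ + ξ''(⟨x,y⟩) ⟨v,y⟩ ⟨w,x⟩`. -/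
theorem stmt12 (N d : ℕ) (hN : 1 ≤ N) (hd : 2 ≤ d) (a : ℕ → ℝ)
    (ha : ∃ p ∈ Finset.Icc 2 d, a p ≠ 0) (x y v w : Fin (N + 1) → ℝ) :
    (∫ g, fderiv ℝ (rf1 N d a g) x v * rf1 N d a g y ∂(GaussP1 N d)
        = xi' d a (∑ i, x i * y i) * (∑ i, v i * y i)) ∧
    (∫ g, fderiv ℝ (rf1 N d a g) x v * fderiv ℝ (rf1 N d a g) y w ∂(GaussP1 N d)
        = xi' d a (∑ i, x i * y i) * (∑ i, v i * w i)
          + xi'' d a (∑ i, x i * y i) * (∑ i, v i * y i) * (∑ i, w i * x i)) := by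
  have hf : ∀ g x v, fderiv ℝ (rf1 N d a g) x v
      = ∑ k, g k * fderiv ℝ (cf N d a k) x v := by
    intro g x v
    rw [rf1_eq]
    exact fderiv_comb g (cf N d a) (cf_diff N d a) x v
  have hr : ∀ g x, rf1 N d a g x = ∑ k, g k * cf N d a k x := by
    intro g x
    rw [rf1_eq]
  simp only [hf, hr]
  exact ⟨(gauss_bilin _ _).trans (kernel1 N d a x y v),
    (gauss_bilin _ _).trans (kernel2 N d a x y v w)⟩

end
end

section
/- Let x ∈ ℝ^{N+1} be a unit vector and let v, w ∈ ℝ^{N+1} be unit vectors with ⟨v,x⟩ = ⟨w,x⟩ = ⟨v,w⟩ = 0. Then ∫ D_v f(g,x)·f(g,x) dP(g) = 0, ∫ D_v f(g,x)·D_w f(g,x) dP(g) = 0, and ∫ (D_v f(g,x))² dP(g) = ξ'(1). In particular, the (jointly Gaussian) directional derivatives of f at x along an orthonormal frame of the tangent space of the sphere at x are independent N(0, ξ'(1)) variables, independent of f(g,x). -/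
open MeasureTheory ProbabilityTheory

noncomputable section

/-- Second moments of linear forms in i.i.d. standard Gaussians. -/
lemma aux_cov {ι : Type*} [Fintype ι] (c b : ι → ℝ) :
    ∫ g, (∑ k, c k * g k) * (∑ k, b k * g k) ∂(Measure.pi fun _ : ι => gaussianReal 0 1)
      = ∑ k, c k * b k := by
  classical
  have hm : ∀ k, MemLp (fun g : ι → ℝ => g k) 2 (Measure.pi fun _ : ι => gaussianReal 0 1) := by
    intro k
    exact (memLp_id_gaussianReal' (μ := 0) (v := 1) 2 (by norm_num)).comp_measurePreserving
      (measurePreserving_eval (fun _ : ι => gaussianReal 0 1) k)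
  have hint : ∀ k l, Integrable (fun g : ι → ℝ => g k * g l)
      (Measure.pi fun _ : ι => gaussianReal 0 1) := fun k l => (hm k).integrable_mul (hm l)
  have hmean : ∀ k, ∫ g, g k ∂(Measure.pi fun _ : ι => gaussianReal 0 1) = 0 := by
    intro k
    have := integral_comp_eval (μ := fun _ : ι => gaussianReal 0 1) (i := k)
      (f := fun t : ℝ => t) (by fun_prop)
    rw [this]
    exact integral_id_gaussianReal
  have hcov : ∀ k l, ∫ g, g k * g l ∂(Measure.pi fun _ : ι => gaussianReal 0 1)
      = if k = l then 1 else 0 := by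
    intro k l
    split_ifs with h
    · subst h
      have := integral_comp_eval (μ := fun _ : ι => gaussianReal 0 1) (i := k)
        (f := fun t : ℝ => t * t) (by fun_prop)
      rw [this]
      have hv := variance_fun_id_gaussianReal (μ := 0) (v := 1)
      rw [variance_of_integral_eq_zero (by fun_prop) integral_id_gaussianReal] at hv
      simpa [sq] using hv
    · have hi := (iIndepFun_pi (μ := fun _ : ι => gaussianReal 0 1) (X := fun _ t => t)
        (fun _ => by fun_prop)).indepFun h
      rw [hi.integral_fun_mul_eq_mul_integral (hm k).1 (hm l).1, hmean k]
      simp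
  have he : ∀ g : ι → ℝ, (∑ k, c k * g k) * (∑ k, b k * g k)
      = ∑ k, ∑ l, (c k * b l) * (g k * g l) := by
    intro g
    rw [Finset.sum_mul_sum]
    refine Finset.sum_congr rfl fun k _ => Finset.sum_congr rfl fun l _ => by ring
  simp_rw [he]
  rw [integral_finset_sum _ fun k _ => integrable_finset_sum _ fun l _ => (hint k l).const_mul _]
  refine Finset.sum_congr rfl fun k _ => ?_
  rw [integral_finset_sum _ fun l _ => (hint k l).const_mul _]
  simp_rw [integral_const_mul, hcov]
  simp

/-- The derivative of a monomial in the direction `v`, as a sum of products. -/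
def mder {n p : ℕ} (x v : Fin n → ℝ) (i : Fin p → Fin n) : ℝ :=
  ∑ j, ∏ k, if k = j then v (i k) else x (i k)

lemma aux_sum_prod {n p : ℕ} (F : Fin p → Fin n → ℝ) :
    ∑ i : Fin p → Fin n, ∏ k, F k (i k) = ∏ k, ∑ m, F k m := by
  rw [Finset.prod_univ_sum, Fintype.piFinset_univ]

lemma aux_mder_x {n p : ℕ} (x v : Fin n → ℝ) (hvx : ∑ i, v i * x i = 0) :
    ∑ i : Fin p → Fin n, mder x v i * ∏ k, x (i k) = 0 := by
  simp_rw [mder, Finset.sum_mul, ← Finset.prod_mul_distrib]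
  rw [Finset.sum_comm]
  refine Finset.sum_eq_zero fun j _ => ?_
  rw [aux_sum_prod (fun k m => (if k = j then v m else x m) * x m)]
  exact Finset.prod_eq_zero (Finset.mem_univ j) (by simpa using hvx)

lemma aux_mder_mder {n p : ℕ} (x v w : Fin n → ℝ) (hx : ∑ i, x i * x i = 1)
    (hvx : ∑ i, v i * x i = 0) :
    ∑ i : Fin p → Fin n, mder x v i * mder x w i = p * ∑ i, v i * w i := by
  simp_rw [mder, Finset.sum_mul_sum, ← Finset.prod_mul_distrib]
  rw [Finset.sum_comm]
  have : ∀ j : Fin p, (∑ i : Fin p → Fin n, ∑ l, ∏ k,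
      ((if k = j then v (i k) else x (i k)) * if k = l then w (i k) else x (i k)))
      = ∑ i, v i * w i := by
    intro j
    rw [Finset.sum_comm, Finset.sum_eq_single j]
    · rw [aux_sum_prod (fun k m => (if k = j then v m else x m) * if k = j then w m else x m),
        Finset.prod_eq_single j]
      · simp
      · intro k _ hk
        simpa [hk] using hx
      · simp
    · intro l _ hl
      rw [aux_sum_prod (fun k m => (if k = j then v m else x m) * if k = l then w m else x m)]
      exact Finset.prod_eq_zero (Finset.mem_univ j) (by simpa [hl.symm] using hvx)
    · simp
  simp_rw [this]
  simp

lemma aux_mono {n p : ℕ} (x v : Fin n → ℝ) (i : Fin p → Fin n) :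
    ∃ L : (Fin n → ℝ) →L[ℝ] ℝ, HasFDerivAt (fun y : Fin n → ℝ => ∏ j, y (i j)) L x ∧
      L v = mder x v i := by
  classical
  refine ⟨_, HasFDerivAt.finsetProd (u := Finset.univ) (fun j _ => hasFDerivAt_apply (i j) x), ?_⟩
  simp only [mder, ContinuousLinearMap.sum_apply, ContinuousLinearMap.smul_apply,
    ContinuousLinearMap.proj_apply, smul_eq_mul]
  refine Finset.sum_congr rfl fun j _ => ?_
  rw [← Finset.mul_prod_erase _ _ (Finset.mem_univ j), mul_comm]
  simp only [if_true]
  congr 1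
  exact Finset.prod_congr rfl fun k hk => by simp [Finset.ne_of_mem_erase hk]

lemma aux_fderiv (N d : ℕ) (a : ℕ → ℝ) (x v : Fin (N + 1) → ℝ) (g : GIdx1 N d → ℝ) :
    fderiv ℝ (rf1 N d a g) x v = ∑ k : GIdx1 N d, (a (k.1.1 : ℕ) * mder x v k.2) * g k := by
  choose L hL hLv using fun (p : ℕ) (i : Fin p → Fin (N + 1)) => aux_mono x v i
  have h : HasFDerivAt (rf1 N d a g) (∑ p : {p : Fin (d + 1) // 2 ≤ (p : ℕ)},
      a (p.1 : ℕ) • ∑ i : Fin (p.1 : ℕ) → Fin (N + 1), g ⟨p, i⟩ • L _ i) x := by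
    unfold rf1
    exact HasFDerivAt.fun_sum fun p _ => HasFDerivAt.const_mul
      (HasFDerivAt.fun_sum fun i _ => (hL _ i).const_mul _) _
  rw [h.fderiv, Fintype.sum_sigma]
  simp only [ContinuousLinearMap.sum_apply, ContinuousLinearMap.smul_apply, smul_eq_mul, hLv,
    Finset.mul_sum]
  refine Finset.sum_congr rfl fun p _ => Finset.sum_congr rfl fun i _ => by ring

lemma aux_rf1 (N d : ℕ) (a : ℕ → ℝ) (x : Fin (N + 1) → ℝ) (g : GIdx1 N d → ℝ) :
    rf1 N d a g x = ∑ k : GIdx1 N d, (a (k.1.1 : ℕ) * ∏ j, x (k.2 j)) * g k := by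
  rw [Fintype.sum_sigma]
  simp only [rf1, Finset.mul_sum]
  refine Finset.sum_congr rfl fun p _ => Finset.sum_congr rfl fun i _ => by ring

lemma aux_xi' (d : ℕ) (a : ℕ → ℝ) :
    xi' d a 1 = ∑ p ∈ Finset.Icc 2 d, a p ^ 2 * p := by
  have h : HasDerivAt (xi d a) (∑ p ∈ Finset.Icc 2 d, a p ^ 2 * (p * 1 ^ (p - 1))) 1 := by
    unfold xi
    exact HasDerivAt.fun_sum fun p _ => (hasDerivAt_pow p (1 : ℝ)).const_mul _
  rw [xi', h.deriv]
  simp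

lemma aux_reindex (d : ℕ) (F : ℕ → ℝ) :
    ∑ p : {p : Fin (d + 1) // 2 ≤ (p : ℕ)}, F (p.1 : ℕ) = ∑ p ∈ Finset.Icc 2 d, F p := by
  refine Finset.sum_bij (fun p _ => (p.1 : ℕ)) ?_ ?_ ?_ ?_
  · intro p _
    have := p.1.2
    have := p.2
    simp only [Finset.mem_Icc]
    omega
  · intro p _ q _ h
    exact Subtype.ext (Fin.ext h)
  · intro b hb
    rw [Finset.mem_Icc] at hb
    exact ⟨⟨⟨b, by omega⟩, hb.1⟩, Finset.mem_univ _, rfl⟩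
  · intro p _
    rfl

lemma aux_grad (N d : ℕ) (a : ℕ → ℝ) (x v w : Fin (N + 1) → ℝ)
    (hx : ∑ i, x i * x i = 1) (hvx : ∑ i, v i * x i = 0) :
    ∫ g, fderiv ℝ (rf1 N d a g) x v * fderiv ℝ (rf1 N d a g) x w ∂(GaussP1 N d)
      = (∑ p ∈ Finset.Icc 2 d, a p ^ 2 * p) * ∑ i, v i * w i := by
  simp_rw [aux_fderiv]
  rw [aux_cov, Fintype.sum_sigma, Finset.sum_mul,
    ← aux_reindex d (fun p => a p ^ 2 * p * ∑ i, v i * w i)]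
  refine Finset.sum_congr rfl fun p _ => ?_
  rw [mul_assoc, ← aux_mder_mder x v w hx hvx, Finset.mul_sum]
  refine Finset.sum_congr rfl fun i _ => by ring

/-- **Lemma 3 (gradient covariances at a point of the sphere).**
If `x` is a unit vector and `v, w` are orthonormal tangent directions at `x`
(`⟨v,x⟩ = ⟨w,x⟩ = ⟨v,w⟩ = 0`, `‖v‖ = ‖w‖ = 1`), then
`E[D_v f(g,x) f(g,x)] = 0`, `E[D_v f(g,x) D_w f(g,x)] = 0`, and
`E[(D_v f(g,x))²] = ξ'(1)`. -/
theorem stmt13 (N d : ℕ) (hN : 1 ≤ N) (hd : 2 ≤ d) (a : ℕ → ℝ)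
    (ha : ∃ p ∈ Finset.Icc 2 d, a p ≠ 0) (x v w : Fin (N + 1) → ℝ)
    (hx : ∑ i, x i * x i = 1) (hv : ∑ i, v i * v i = 1) (hw : ∑ i, w i * w i = 1)
    (hvx : ∑ i, v i * x i = 0) (hwx : ∑ i, w i * x i = 0)
    (hvw : ∑ i, v i * w i = 0) :
    (∫ g, fderiv ℝ (rf1 N d a g) x v * rf1 N d a g x ∂(GaussP1 N d) = 0) ∧
    (∫ g, fderiv ℝ (rf1 N d a g) x v * fderiv ℝ (rf1 N d a g) x w ∂(GaussP1 N d) = 0) ∧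
    (∫ g, (fderiv ℝ (rf1 N d a g) x v) ^ 2 ∂(GaussP1 N d) = xi' d a 1) := by
  refine ⟨?_, ?_, ?_⟩
  · simp_rw [aux_fderiv, aux_rf1]
    rw [aux_cov, Fintype.sum_sigma]
    refine Finset.sum_eq_zero fun p _ => ?_
    have h := aux_mder_x (p := (p.1 : ℕ)) x v hvx
    calc _ = a (p.1 : ℕ) ^ 2 * ∑ i : Fin (p.1 : ℕ) → Fin (N + 1),
          mder x v i * ∏ k, x (i k) := by
          rw [Finset.mul_sum]
          refine Finset.sum_congr rfl fun i _ => by ring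
      _ = 0 := by rw [h, mul_zero]
  · rw [aux_grad N d a x v w hx hvx, hvw, mul_zero]
  · simp_rw [sq]
    rw [aux_grad N d a x v v hx hvx, hv, mul_one, aux_xi']

end
end

section
/- Let d ≥ 2 and let a_p, 2 ≤ p ≤ d, be real numbers, not all zero, and set ξ(t) = Σ_{p=2}^d a_p² t^p. Then for every r ∈ (−1,1): ξ(1)² − ξ(r)² > 0 and ξ(1)·ξ'(r)²·(1−r²) ≤ ξ'(1)·(ξ(1)² − ξ(r)²). Equivalently, the quantity λ(r) = 1 − (ξ(1)/ξ'(1))·ξ'(r)²(1−r²)/(ξ(1)² − ξ(r)²) is nonnegative. -/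
noncomputable section

theorem xi'_eq (d : ℕ) (a : ℕ → ℝ) (t : ℝ) :
    xi' d a t = ∑ p ∈ Finset.Icc 2 d, a p ^ 2 * (p * t ^ (p - 1)) := by
  have h : HasDerivAt (fun t => ∑ p ∈ Finset.Icc 2 d, a p ^ 2 * t ^ p)
      (∑ p ∈ Finset.Icc 2 d, a p ^ 2 * (p * t ^ (p - 1))) t :=
    HasDerivAt.fun_sum fun p _ => (hasDerivAt_pow p t).const_mul _
  exact h.deriv

theorem pow_aux (r : ℝ) (hr : r ^ 2 ≤ 1) (p : ℕ) :
    (p : ℝ) * (r ^ (p - 1)) ^ 2 * (1 - r ^ 2) ≤ 1 - (r ^ p) ^ 2 := by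
  induction p with
  | zero => simp
  | succ n ih =>
    rcases Nat.eq_zero_or_pos n with rfl | hn
    · simp
    · obtain ⟨m, rfl⟩ : ∃ m, n = m + 1 := ⟨n - 1, by omega⟩
      simp only [Nat.add_sub_cancel] at ih ⊢
      have h1 : 0 ≤ (r ^ m) ^ 2 * (1 - r ^ 2) * (1 - r ^ 2) := by
        have : 0 ≤ 1 - r ^ 2 := by linarith
        positivity
      have h2 : 0 ≤ ((m : ℝ) + 1) * ((r ^ m) ^ 2 * (1 - r ^ 2) * (1 - r ^ 2)) := by positivity
      push_cast at ih ⊢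
      have e1 : r ^ (m + 1) = r ^ m * r := pow_succ _ _
      have e2 : r ^ (m + 1 + 1) = r ^ m * r * r := by rw [pow_succ, pow_succ]
      rw [e2, e1]
      rw [e1] at ih
      nlinarith

/-- **Nonnegativity of `λ(r)` (Eq. (3.7)).**
For `r ∈ (−1,1)`: `ξ(1)² − ξ(r)² > 0` and `ξ(1) ξ'(r)² (1−r²) ≤ ξ'(1) (ξ(1)² − ξ(r)²)`. -/
theorem stmt15 (d : ℕ) (hd : 2 ≤ d) (a : ℕ → ℝ)
    (ha : ∃ p ∈ Finset.Icc 2 d, a p ≠ 0)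
    (r : ℝ) (hr : r ∈ Set.Ioo (-1 : ℝ) 1) :
    0 < xi d a 1 ^ 2 - xi d a r ^ 2 ∧
    xi d a 1 * xi' d a r ^ 2 * (1 - r ^ 2) ≤ xi' d a 1 * (xi d a 1 ^ 2 - xi d a r ^ 2) := by
  have hr2 : r ^ 2 < 1 := by
    have := hr.1; have := hr.2; nlinarith
  have e1 : xi d a 1 = ∑ p ∈ Finset.Icc 2 d, a p ^ 2 := by simp [xi]
  have e2 : xi' d a 1 = ∑ p ∈ Finset.Icc 2 d, a p ^ 2 * (p : ℝ) := by simp [xi'_eq]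
  have hA : 0 < ∑ p ∈ Finset.Icc 2 d, a p ^ 2 := by
    obtain ⟨p, hp, h⟩ := ha
    exact Finset.sum_pos' (fun _ _ => sq_nonneg _) ⟨p, hp, by positivity⟩
  have hB : 0 ≤ ∑ p ∈ Finset.Icc 2 d, a p ^ 2 * (p : ℝ) :=
    Finset.sum_nonneg fun _ _ => by positivity
  have hX : xi d a r ^ 2 ≤ (∑ p ∈ Finset.Icc 2 d, a p ^ 2) *
      ∑ p ∈ Finset.Icc 2 d, a p ^ 2 * (r ^ p) ^ 2 :=
    Finset.sum_sq_le_sum_mul_sum_of_sq_eq_mul _ (fun _ _ => by positivity)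
      (fun _ _ => by positivity) (fun _ _ => by ring)
  have hS : xi' d a r ^ 2 ≤ (∑ p ∈ Finset.Icc 2 d, a p ^ 2 * (p : ℝ)) *
      ∑ p ∈ Finset.Icc 2 d, a p ^ 2 * (p * (r ^ (p - 1)) ^ 2) := by
    rw [xi'_eq]
    exact Finset.sum_sq_le_sum_mul_sum_of_sq_eq_mul _ (fun _ _ => by positivity)
      (fun _ _ => by positivity) (fun _ _ => by ring)
  have hT : (∑ p ∈ Finset.Icc 2 d, a p ^ 2 * (p * (r ^ (p - 1)) ^ 2)) * (1 - r ^ 2) ≤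
      (∑ p ∈ Finset.Icc 2 d, a p ^ 2) - ∑ p ∈ Finset.Icc 2 d, a p ^ 2 * (r ^ p) ^ 2 := by
    rw [Finset.sum_mul, ← Finset.sum_sub_distrib]
    refine Finset.sum_le_sum fun p _ => ?_
    have := mul_le_mul_of_nonneg_left (pow_aux r hr2.le p) (sq_nonneg (a p))
    linarith
  have hQ : ∑ p ∈ Finset.Icc 2 d, a p ^ 2 * (r ^ p) ^ 2 < ∑ p ∈ Finset.Icc 2 d, a p ^ 2 := by
    have hlt : ∀ p ∈ Finset.Icc 2 d, (r ^ p) ^ 2 < 1 := fun p hp => by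
      rw [← pow_mul, mul_comm, pow_mul]
      have := (Finset.mem_Icc.1 hp).1
      exact pow_lt_one₀ (sq_nonneg r) hr2 (by omega)
    obtain ⟨p, hp, h⟩ := ha
    refine Finset.sum_lt_sum (fun q hq => ?_) ⟨p, hp, ?_⟩
    · exact mul_le_of_le_one_right (sq_nonneg _) (hlt q hq).le
    · exact mul_lt_of_lt_one_right (by positivity) (hlt p hp)
  rw [e1, e2]
  generalize (∑ p ∈ Finset.Icc 2 d, a p ^ 2) = A at *
  generalize (∑ p ∈ Finset.Icc 2 d, a p ^ 2 * (p : ℝ)) = B at *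
  generalize (∑ p ∈ Finset.Icc 2 d, a p ^ 2 * (r ^ p) ^ 2) = Q at *
  generalize (∑ p ∈ Finset.Icc 2 d, a p ^ 2 * (p * (r ^ (p - 1)) ^ 2)) = T at *
  refine ⟨by nlinarith, ?_⟩
  have hr3 : 0 ≤ 1 - r ^ 2 := by linarith
  calc A * xi' d a r ^ 2 * (1 - r ^ 2) ≤ A * (B * T) * (1 - r ^ 2) := by gcongr
    _ = A * B * (T * (1 - r ^ 2)) := by ring
    _ ≤ A * B * (A - Q) := by gcongr
    _ = B * (A ^ 2 - A * Q) := by ring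
    _ ≤ B * (A ^ 2 - xi d a r ^ 2) := by gcongr
end
end
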